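/- Fix an integer N ≥ 2 and let A_N = {1,…,N}. There is a Borel measurable map T from ℝ^{N−1} to the space of nonempty compact subsets of (A_N)^ℤ (with the Hausdorff metric and its Borel σ-algebra) such that every T(x) is a regular Toeplitz subshift of (A_N)^ℤ, and for all x, y ∈ ℝ^{N−1}, x F_N y if and only if the systems (T(x), σ) and (T(y), σ) are orbit equivalent, where σ denotes the shift. In particular, F_N is Borel reducible to the orbit equivalence for regular A_N-Toeplitz subshifts. -/

import Mathlib

open MeasureTheory TopologicalSpace Topology

def zOrbit {X : Type*} (φ : X → X) (x : X) : Set X :=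
  {y | ∃ n : ℕ, φ^[n] x = y ∨ φ^[n] y = x}

def shift {A : Type*} : (ℤ → A) → (ℤ → A) := fun x n => x (n + 1)

def IsToeplitz {A : Type*} (x : ℤ → A) : Prop :=
  ∀ k : ℤ, ∃ p : ℕ, 1 ≤ p ∧ ∀ n : ℤ, x (k + n * p) = x k

noncomputable def toeplitzDelta {A : Type*} (x : ℤ → A) (p : ℕ) : ℝ :=
  ({k : ℤ | 0 ≤ k ∧ k < (p : ℤ) ∧ ∀ n : ℤ, x (k + n * p) = x k}.ncard : ℝ) / p

def IsRegularToeplitz {A : Type*} (x : ℤ → A) : Prop :=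
  IsToeplitz x ∧ sSup {d : ℝ | ∃ p : ℕ, 1 ≤ p ∧ d = toeplitzDelta x p} = 1

def IsRegularToeplitzSubshift {A : Type*} [TopologicalSpace A] (X : Set (ℤ → A)) : Prop :=
  ∃ x : ℤ → A, IsRegularToeplitz x ∧ X = closure (zOrbit shift x)

def SubshiftOrbitEquivalent {A B : Type*} [TopologicalSpace A] [TopologicalSpace B]
    (X : Set (ℤ → A)) (Y : Set (ℤ → B)) : Prop :=
  ∃ f : X ≃ₜ Y, ∀ x y : X,
    (y : ℤ → A) ∈ zOrbit shift (x : ℤ → A) ↔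
      ((f y : ℤ → B) ∈ zOrbit shift (f x : ℤ → B))

/-- Extend `x ∈ ℝ^{N-1}` to the row vector `(x_1, …, x_{N-1}, 1) ∈ ℝ^N`. -/
def extend1 {N : ℕ} (x : Fin (N - 1) → ℝ) : Fin N → ℝ :=
  fun i => if h : (i : ℕ) < N - 1 then x ⟨i, h⟩ else 1

/-- The equivalence relation `F_N` on `ℝ^{N-1}`. -/
def FN (N : ℕ) (x y : Fin (N - 1) → ℝ) : Prop :=
  ∃ M : GL (Fin N) ℚ,
    Matrix.vecMul (extend1 x)
      ((M : Matrix (Fin N) (Fin N) ℚ).map (fun q : ℚ => (q : ℝ))) = extend1 y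

noncomputable instance (n : ℕ) : MetricSpace (ℤ → Fin n) :=
  TopologicalSpace.metrizableSpaceMetric _
noncomputable instance (n : ℕ) : MeasurableSpace (NonemptyCompacts (ℤ → Fin n)) := borel _
instance (n : ℕ) : BorelSpace (NonemptyCompacts (ℤ → Fin n)) := ⟨rfl⟩

namespace ToeplitzOE

set_option linter.unusedSectionVars false

section Patterns

variable {A : Type*}

/-- Translation of a bi-infinite sequence by `j`. -/
def tr (j : ℤ) (y : ℤ → A) : ℤ → A := fun m => y (m + j)

@[simp] theorem tr_zero (y : ℤ → A) : tr 0 y = y := by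
  funext m; simp [tr]

@[simp] theorem tr_tr (i j : ℤ) (y : ℤ → A) : tr i (tr j y) = tr (i + j) y := by
  funext m; simp [tr, add_assoc]

theorem shift_eq_tr (y : ℤ → A) : shift y = tr 1 y := rfl

theorem shift_iterate (n : ℕ) (y : ℤ → A) : shift^[n] y = tr n y := by
  induction n with
  | zero => simp
  | succ n ih => rw [Function.iterate_succ_apply', ih, shift_eq_tr, tr_tr]; push_cast; rw [add_comm]

theorem mem_zOrbit_shift {x y : ℤ → A} : y ∈ zOrbit shift x ↔ ∃ j : ℤ, y = tr j x := by
  simp only [zOrbit, Set.mem_ofPred_eq, shift_iterate]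
  constructor
  · rintro ⟨n, h | h⟩
    · exact ⟨n, h.symm⟩
    · exact ⟨-n, by rw [← h, tr_tr]; simp⟩
  · rintro ⟨j, rfl⟩
    obtain ⟨n, rfl | rfl⟩ := j.eq_nat_or_neg
    · exact ⟨n, Or.inl rfl⟩
    · exact ⟨n, Or.inr (by simp)⟩

theorem continuous_tr [TopologicalSpace A] (j : ℤ) : Continuous (tr j : (ℤ → A) → (ℤ → A)) :=
  continuous_pi fun m => continuous_apply (m + j)

/-- A finite word whose entries may be holes. -/
structure Pat (A : Type*) where
  len : ℕ
  fn : ℕ → Option A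

/-- The concatenation of the copies of `c` whose holes are filled with the letters of `y`. -/
def Pat.sub (c : Pat A) (y : ℤ → A) : ℤ → A :=
  fun m => (c.fn (m % c.len).toNat).getD (y (m / c.len))

theorem Pat.sub_apply (c : Pat A) (y : ℤ → A) (b : ℤ) {r : ℕ} (hr : r < c.len) :
    c.sub y (b * c.len + r) = (c.fn r).getD (y b) := by
  have h1 : (b * c.len + r) % (c.len : ℤ) = r := by
    rw [add_comm, Int.add_mul_emod_self_right]
    exact Int.emod_eq_of_lt (by positivity) (by exact_mod_cast hr)
  have h2 : (b * c.len + r) / (c.len : ℤ) = b := by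
    rw [add_comm, Int.add_mul_ediv_right _ _ (by omega)]
    rw [Int.ediv_eq_zero_of_lt (by positivity) (by exact_mod_cast hr)]; simp
  simp [Pat.sub, h1, h2]

theorem exists_block_coord {q : ℕ} (hq : 0 < q) (m : ℤ) :
    ∃ b : ℤ, ∃ r : ℕ, r < q ∧ m = b * q + r := by
  refine ⟨m / q, (m % q).toNat, ?_, ?_⟩
  · have := Int.emod_lt_of_pos m (by exact_mod_cast hq : (0 : ℤ) < q)
    have := Int.emod_nonneg m (by omega : (q : ℤ) ≠ 0)
    omega
  · have := Int.emod_nonneg m (by omega : (q : ℤ) ≠ 0)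
    rw [Int.toNat_of_nonneg this, mul_comm]
    exact (Int.mul_ediv_add_emod m q).symm

theorem Pat.sub_tr (c : Pat A) (hc : 0 < c.len) (y : ℤ → A) (j : ℤ) :
    c.sub (tr j y) = tr (j * c.len) (c.sub y) := by
  funext m
  obtain ⟨b, r, hr, rfl⟩ := exists_block_coord hc m
  have : b * (c.len : ℤ) + r + j * c.len = (b + j) * c.len + r := by ring
  rw [sub_apply c _ _ hr, tr, tr, this, sub_apply c _ _ hr]

/-- Substitution of patterns: `(c.comp c').sub = c.sub ∘ c'.sub`. -/
def Pat.comp (c c' : Pat A) : Pat A :=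
  ⟨c.len * c'.len, fun r => (c.fn (r % c.len)).or (c'.fn (r / c.len))⟩

theorem Pat.comp_sub (c c' : Pat A) (hc : 0 < c.len) (hc' : 0 < c'.len) (y : ℤ → A) :
    (c.comp c').sub y = c.sub (c'.sub y) := by
  funext m
  obtain ⟨b, r, hr, rfl⟩ := exists_block_coord (q := (c.comp c').len) (Nat.mul_pos hc hc') m
  rw [sub_apply _ _ _ hr]
  have h1 : r % c.len < c.len := Nat.mod_lt _ hc
  have h2 : r / c.len < c'.len := Nat.div_lt_of_lt_mul hr
  have : b * ((c.comp c').len : ℤ) + r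
      = (b * c'.len + (r / c.len : ℕ)) * c.len + (r % c.len : ℕ) := by
    have h3 : ((c.len * (r / c.len) + r % c.len : ℕ) : ℤ) = r := by rw [Nat.div_add_mod]
    rw [← h3]; simp only [comp]; push_cast; ring
  rw [this, sub_apply _ _ _ h1, sub_apply _ _ _ h2]
  simp only [comp]
  cases c.fn (r % c.len) <;> simp

/-- The number of holes of a pattern. -/
def Pat.holes (c : Pat A) : ℕ := ((Finset.range c.len).filter fun r => (c.fn r).isNone).card

theorem Pat.holes_comp_le (c c' : Pat A) : (c.comp c').holes ≤ c.holes * c'.holes := by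
  rw [holes, holes, holes, ← Finset.card_product]
  refine Finset.card_le_card_of_injOn (fun r => (r % c.len, r / c.len)) ?_ ?_
  · intro r hr
    obtain ⟨h1, h2⟩ := Finset.mem_filter.1 hr
    rw [Finset.mem_range] at h1
    simp only [comp] at h1 h2
    have hp : 0 < c.len := Nat.pos_of_mul_pos_right (lt_of_le_of_lt (Nat.zero_le _) h1)
    have h3 := Nat.mod_lt r hp
    have h4 : r / c.len < c'.len := Nat.div_lt_of_lt_mul h1
    have h5 : (c.fn (r % c.len)).isNone ∧ (c'.fn (r / c.len)).isNone := by
      cases e1 : c.fn (r % c.len) <;> cases e2 : c'.fn (r / c.len) <;> simp_all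
    simpa [h3, h4] using h5
  · intro r _ s _ h
    obtain ⟨h1, h2⟩ := Prod.mk.inj h
    rw [← Nat.div_add_mod r c.len, ← Nat.div_add_mod s c.len, h1, h2]

/-- Patterns that contain all letters, begin with `lo`, end with `hi` and allow unique
desubstitution. -/
structure Pat.Good (lo hi : A) (c : Pat A) : Prop where
  two_le : 2 ≤ c.len
  first : c.fn 0 = some lo
  last : c.fn (c.len - 1) = some hi
  surj : ∀ a, ∃ r < c.len, c.fn r = some a
  recog : ∀ y z : ℤ → A, ∀ r < c.len, c.sub y = tr r (c.sub z) → r = 0 ∧ y = z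

variable {lo hi : A}

theorem Pat.Good.pos {c : Pat A} (h : c.Good lo hi) : 0 < c.len := by have := h.two_le; omega

theorem Pat.Good.comp {c c' : Pat A} (h : c.Good lo hi) (h' : c'.Good lo hi) :
    (c.comp c').Good lo hi := by
  have hp := h.pos
  have hp' := h'.pos
  have h2 := h.two_le
  have h2' := h'.two_le
  refine ⟨?_, ?_, ?_, ?_, ?_⟩
  · simp only [Pat.comp]; nlinarith
  · simp [Pat.comp, h.first]
  · have : (c.len * c'.len - 1) % c.len = c.len - 1 := by
      obtain ⟨k, hk⟩ := Nat.exists_eq_add_of_le' hp'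
      rw [hk, Nat.succ_eq_add_one, zero_add, Nat.mul_add, mul_one, Nat.add_sub_assoc hp,
        Nat.mul_add_mod]
      exact Nat.mod_eq_of_lt (by omega)
    simp [Pat.comp, this, h.last]
  · intro a
    obtain ⟨r, hr, ha⟩ := h.surj a
    refine ⟨r, ?_, ?_⟩
    · simp only [Pat.comp]; nlinarith
    · simp [Pat.comp, Nat.mod_eq_of_lt hr, ha]
  · intro y z r hr hyz
    rw [comp_sub _ _ hp hp', comp_sub _ _ hp hp'] at hyz
    have h3 : ((c.len * (r / c.len) + r % c.len : ℕ) : ℤ) = r := by rw [Nat.div_add_mod]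
    have h4 : tr (r : ℤ) (c.sub (c'.sub z))
        = tr ((r % c.len : ℕ) : ℤ) (c.sub (tr ((r / c.len : ℕ) : ℤ) (c'.sub z))) := by
      rw [sub_tr _ hp, tr_tr, ← h3]; push_cast; congr 1; ring
    rw [h4] at hyz
    obtain ⟨e1, e2⟩ := h.recog _ _ _ (Nat.mod_lt _ hp) hyz
    obtain ⟨e3, e4⟩ := h'.recog _ _ _ (Nat.div_lt_of_lt_mul hr) e2
    refine ⟨?_, e4⟩
    rw [← Nat.div_add_mod r c.len, e1, e3]; simp

/-- `Y` is a sequence of iterated desubstitutions of `Y 0`, with phases `r`. -/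
def IsAddr (D : ℕ → Pat A) (Y : ℕ → ℤ → A) (r : ℕ → ℕ) : Prop :=
  ∀ n, r n < (D n).len ∧ Y n = tr (r n) ((D n).sub (Y (n + 1)))

theorem IsAddr.drop {D : ℕ → Pat A} {Y : ℕ → ℤ → A} {r : ℕ → ℕ} (h : IsAddr D Y r) (k : ℕ) :
    IsAddr (fun n => D (k + n)) (fun n => Y (k + n)) (fun n => r (k + n)) :=
  fun n => h (k + n)

theorem IsAddr.apply {D : ℕ → Pat A} {Y : ℕ → ℤ → A} {r : ℕ → ℕ} (h : IsAddr D Y r)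
    (n : ℕ) {m b : ℤ} {s : ℕ} (hs : s < (D n).len) (e : m + r n = b * (D n).len + s) :
    Y n m = ((D n).fn s).getD (Y (n + 1) b) := by
  rw [(h n).2, tr, e, Pat.sub_apply _ _ _ hs]

/-- Two sequences with equal phases that agree on a window after desubstitution agree on a larger
window. -/
theorem tr_sub_agree {c : Pat A} (hc : c.Good lo hi) {y z : ℤ → A} {r : ℕ} (hr : r < c.len)
    {M : ℕ} (hM : ∀ m : ℤ, |m| ≤ M → y m = z m) :
    ∀ m : ℤ, |m| ≤ (M + 1 : ℕ) → tr r (c.sub y) m = tr r (c.sub z) m := by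
  intro m hm
  have hp := hc.pos
  have h2 := hc.two_le
  obtain ⟨b, s, hs, e⟩ := exists_block_coord hp (m + r)
  simp only [tr]
  rw [e, Pat.sub_apply _ _ _ hs, Pat.sub_apply _ _ _ hs]
  rw [abs_le] at hm
  push_cast at hm
  by_cases h : |b| ≤ M
  · rw [hM b h]
  · rw [abs_le, not_and_or] at h
    push Not at h
    rcases h with h | h
    · -- left end of the window
      have hb : b = -1 ∧ s = c.len - 1 := by
        have h3 : b * (c.len : ℤ) + s ≥ m := by omega
        by_cases hM0 : M = 0
        · subst hM0
          have : b ≤ -1 := by simpa using Int.le_sub_one_of_lt h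
          have h5 : b = -1 := by
            by_contra hne
            have : b ≤ -2 := by omega
            have : b * (c.len : ℤ) ≤ -2 * c.len := by nlinarith
            simp at hm
            omega
          refine ⟨h5, ?_⟩
          subst h5
          simp at hm
          omega
        · exfalso
          have : b ≤ -(M : ℤ) - 1 := by omega
          have h6 : b * (c.len : ℤ) ≤ (-(M : ℤ) - 1) * c.len := by nlinarith
          have h7 : (M : ℤ) * 2 ≤ M * c.len := by
            have : (2 : ℤ) ≤ c.len := by exact_mod_cast h2
            nlinarith
          have : 1 ≤ M := Nat.one_le_iff_ne_zero.mpr hM0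
          have : (-(M : ℤ) - 1) * c.len = -(M * c.len) - c.len := by ring
          have : (s : ℤ) < c.len := by exact_mod_cast hs
          omega
      rw [hb.2, hc.last]; rfl
    · have hb : s = 0 := by
        have : b ≥ (M : ℤ) + 1 := by omega
        have h6 : b * (c.len : ℤ) ≥ ((M : ℤ) + 1) * c.len := by nlinarith
        have h7 : (M : ℤ) * 2 ≤ M * c.len := by
          have : (2 : ℤ) ≤ c.len := by exact_mod_cast h2
          nlinarith
        have : ((M : ℤ) + 1) * c.len = M * c.len + c.len := by ring
        have : (r : ℤ) < c.len := by exact_mod_cast hr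
        omega
      rw [hb, hc.first]; rfl

theorem IsAddr.eq_of_letters {D : ℕ → Pat A} (hD : ∀ n, (D n).Good lo hi) {Y Z : ℕ → ℤ → A}
    {r : ℕ → ℕ} (hY : IsAddr D Y r) (hZ : IsAddr D Z r) (h0 : ∀ n, Y n 0 = Z n 0) (n : ℕ) :
    Y n = Z n := by
  have key : ∀ M : ℕ, ∀ n, ∀ m : ℤ, |m| ≤ M → Y n m = Z n m := by
    intro M
    induction M with
    | zero =>
      intro n m hm
      have : m = 0 := by simpa using hm
      rw [this, h0]
    | succ M ih =>
      intro n m hm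
      rw [(hY n).2, (hZ n).2]
      exact tr_sub_agree (hD n) (hY n).1 (ih (n + 1)) m hm
  funext m
  exact key m.natAbs n m (by simp)

theorem IsAddr.unique {D : ℕ → Pat A} (hD : ∀ n, (D n).Good lo hi) {Y Z : ℕ → ℤ → A}
    {r s : ℕ → ℕ} (hY : IsAddr D Y r) (hZ : IsAddr D Z s) (h0 : Y 0 = Z 0) (n : ℕ) :
    Y n = Z n ∧ r n = s n := by
  have step : ∀ n, Y n = Z n → r n = s n ∧ Y (n + 1) = Z (n + 1) := by
    intro n hn
    have e := hn
    rw [(hY n).2, (hZ n).2] at e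
    have hrec := (hD n).recog
    rcases le_total (s n) (r n) with hle | hle
    · have e2 : (D n).sub (Z (n + 1)) = tr ((r n - s n : ℕ) : ℤ) ((D n).sub (Y (n + 1))) := by
        have := congrArg (tr (-(s n : ℤ))) e
        rw [tr_tr, tr_tr] at this
        simp only [neg_add_cancel, tr_zero] at this
        rw [← this]; congr 1; omega
      have h := hrec _ _ _ (by have := (hY n).1; omega) e2
      exact ⟨by omega, h.2.symm⟩
    · have e2 : (D n).sub (Y (n + 1)) = tr ((s n - r n : ℕ) : ℤ) ((D n).sub (Z (n + 1))) := by
        have := congrArg (tr (-(r n : ℤ))) e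
        rw [tr_tr, tr_tr] at this
        simp only [neg_add_cancel, tr_zero] at this
        rw [this]; congr 1; omega
      have h := hrec _ _ _ (by have := (hZ n).1; omega) e2
      exact ⟨by omega, h.2⟩
  have all : ∀ n, Y n = Z n := by
    intro n
    induction n with
    | zero => exact h0
    | succ n ih => exact (step n ih).2
  exact ⟨all n, (step n (all n)).1⟩

theorem IsAddr.exists_tr_zero {D : ℕ → Pat A} (hD : ∀ n, (D n).Good lo hi) {Y Z : ℕ → ℤ → A}
    {r s : ℕ → ℕ} (hY : IsAddr D Y r) (hZ : IsAddr D Z s) (n : ℕ) (h : ∃ j, Y n = tr j (Z n)) :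
    ∃ j, Y 0 = tr j (Z 0) := by
  induction n with
  | zero => exact h
  | succ n ih =>
    obtain ⟨j, hj⟩ := h
    refine ih ⟨r n + j * (D n).len - s n, ?_⟩
    rw [(hY n).2, (hZ n).2, hj, Pat.sub_tr _ (hD n).pos, tr_tr, tr_tr]
    congr 1; ring

/-- Addresses with the same tail belong to the same orbit. -/
theorem IsAddr.same_orbit_of_tail {D : ℕ → Pat A} (hD : ∀ n, (D n).Good lo hi)
    {Y Z : ℕ → ℤ → A} {r s : ℕ → ℕ} (hY : IsAddr D Y r) (hZ : IsAddr D Z s) (n : ℕ)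
    (h : ∀ m, n ≤ m → r m = s m ∧ Y m 0 = Z m 0) : ∃ j, Y 0 = tr j (Z 0) := by
  refine hY.exists_tr_zero hD hZ n ⟨0, ?_⟩
  rw [tr_zero]
  have hr : (fun k => r (n + k)) = fun k => s (n + k) := funext fun k => (h _ (by omega)).1
  have hY' := hY.drop n
  rw [hr] at hY'
  exact hY'.eq_of_letters (fun k => hD (n + k)) (hZ.drop n) (fun k => (h _ (by omega)).2) 0

/-- The address of the translate of a sequence by one. -/
theorem IsAddr.succ {D : ℕ → Pat A} (hD : ∀ n, (D n).Good lo hi) {Y : ℕ → ℤ → A} {r : ℕ → ℕ}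
    (hY : IsAddr D Y r) : ∃ Y' r', IsAddr D Y' r' ∧ Y' 0 = tr 1 (Y 0) ∧
      ((∃ n, ∀ m, n ≤ m → r' m = r m ∧ Y' m = Y m) ∨
        ((∀ m, r m + 1 = (D m).len) ∧ ∀ m, r' m = 0)) := by
  have carry : ∀ n, r n + 1 = (D n).len → tr 1 (Y n) = (D n).sub (tr 1 (Y (n + 1))) := by
    intro n hn
    rw [Pat.sub_tr _ (hD n).pos, (hY n).2, tr_tr, ← hn]
    congr 1; push_cast; ring
  by_cases hall : ∀ m, r m + 1 = (D m).len
  · refine ⟨fun m => tr 1 (Y m), fun _ => 0, fun n => ⟨(hD n).pos, ?_⟩, rfl, Or.inr ⟨hall, fun _ => rfl⟩⟩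
    simpa using carry n (hall n)
  · push Not at hall
    classical
    let n := Nat.find hall
    have hn : r n + 1 ≠ (D n).len := Nat.find_spec hall
    have hlt : ∀ m < n, r m + 1 = (D m).len := fun m hm => by
      simpa using Nat.find_min hall hm
    refine ⟨fun m => if m ≤ n then tr 1 (Y m) else Y m,
      fun m => if m < n then 0 else if m = n then r n + 1 else r m, ?_, by simp,
      Or.inl ⟨n + 1, fun m hm => ?_⟩⟩
    · intro m
      have h1 := (hY m).1
      rcases lt_trichotomy m n with h | h | h
      · have h2 : m ≤ n := h.le
        have h3 : m + 1 ≤ n := h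
        simp only [h, h2, h3, if_true]
        exact ⟨(hD m).pos, by simpa using carry m (hlt m h)⟩
      · subst h
        have h3 : ¬ (n + 1 ≤ n) := by omega
        simp only [lt_irrefl, le_refl, h3, if_true, if_false]
        refine ⟨by omega, ?_⟩
        nth_rewrite 1 [(hY n).2]
        rw [tr_tr]; congr 1; push_cast; ring
      · have h2 : ¬ (m ≤ n) := by omega
        have h3 : ¬ (m + 1 ≤ n) := by omega
        have h4 : ¬ (m < n) := by omega
        have h5 : ¬ (m = n) := by omega
        simp only [h2, h3, h4, h5, if_false]
        exact hY m
    · have h2 : ¬ (m ≤ n) := by omega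
      have h4 : ¬ (m < n) := by omega
      have h5 : ¬ (m = n) := by omega
      simp [h2, h4, h5]

end Patterns

section Systems

variable {A : Type*} {lo hi : A}

/-- A Toeplitz sequence `τ 0` together with its iterated desubstitutions. -/
structure Sys (A : Type*) (lo hi : A) where
  D : ℕ → Pat A
  τ : ℕ → ℤ → A
  good : ∀ n, (D n).Good lo hi
  sub_eq : ∀ n, τ n = (D n).sub (τ (n + 1))

/-- The source of an edge, an edge being a target letter and a position in its block. -/
def Sys.src (S : Sys A lo hi) (k : ℕ) (e : A × Fin (S.D k).len) : A :=
  ((S.D k).fn e.2).getD e.1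

/-- The edge through the first position of a block. -/
def Sys.mn (S : Sys A lo hi) (k : ℕ) : A × Fin (S.D k).len := (lo, ⟨0, (S.good k).pos⟩)

/-- The edge through the last position of a block. -/
def Sys.mx (S : Sys A lo hi) (k : ℕ) : A × Fin (S.D k).len :=
  (hi, ⟨(S.D k).len - 1, Nat.sub_lt (S.good k).pos one_pos⟩)

theorem Sys.src_mn (S : Sys A lo hi) (k : ℕ) : S.src k (S.mn k) = lo := by
  simp [src, mn, (S.good k).first]

theorem Sys.src_mx (S : Sys A lo hi) (k : ℕ) : S.src k (S.mx k) = hi := by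
  simp [src, mx, (S.good k).last]

/-- Infinite paths in the ordered Bratteli diagram of a system. -/
def Sys.Path (S : Sys A lo hi) : Type _ :=
  {e : ∀ k, A × Fin (S.D k).len // ∀ k, (e k).1 = S.src (k + 1) (e (k + 1))}

/-- Equality of two sequences from some index on. -/
def Tail {E : ℕ → Type*} (e e' : ∀ k, E k) : Prop := ∃ n, ∀ m, n ≤ m → e m = e' m

theorem Tail.refl {E : ℕ → Type*} (e : ∀ k, E k) : Tail e e := ⟨0, fun _ _ => rfl⟩

theorem Tail.symm {E : ℕ → Type*} {e e' : ∀ k, E k} (h : Tail e e') : Tail e' e :=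
  h.imp fun _ h m hm => (h m hm).symm

theorem Tail.trans {E : ℕ → Type*} {e e' e'' : ∀ k, E k} (h : Tail e e') (h' : Tail e' e'') :
    Tail e e'' := by
  obtain ⟨n, hn⟩ := h
  obtain ⟨n', hn'⟩ := h'
  exact ⟨max n n', fun m hm => (hn m (le_of_max_le_left hm)).trans (hn' m (le_of_max_le_right hm))⟩

/-- Paths in the orbit of the distinguished sequence. -/
def Special {E : ℕ → Type*} (mn mx e : ∀ k, E k) : Prop := Tail e mn ∨ Tail e mx

/-- The orbit relation on paths. -/
def PathRel {E : ℕ → Type*} (mn mx e e' : ∀ k, E k) : Prop :=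
  Tail e e' ∨ (Special mn mx e ∧ Special mn mx e')

theorem Special.of_tail {E : ℕ → Type*} {mn mx e e' : ∀ k, E k} (h : Special mn mx e)
    (ht : Tail e e') : Special mn mx e' :=
  h.imp (fun h => ht.symm.trans h) (fun h => ht.symm.trans h)

theorem PathRel.refl {E : ℕ → Type*} {mn mx : ∀ k, E k} (e : ∀ k, E k) : PathRel mn mx e e :=
  Or.inl (Tail.refl e)

theorem PathRel.symm {E : ℕ → Type*} {mn mx e e' : ∀ k, E k} (h : PathRel mn mx e e') :
    PathRel mn mx e' e :=
  h.imp Tail.symm And.symm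

theorem PathRel.trans {E : ℕ → Type*} {mn mx e e' e'' : ∀ k, E k} (h : PathRel mn mx e e')
    (h' : PathRel mn mx e' e'') : PathRel mn mx e e'' := by
  rcases h with h | h <;> rcases h' with h' | h'
  · exact Or.inl (h.trans h')
  · exact Or.inr ⟨h'.1.of_tail h.symm, h'.2⟩
  · exact Or.inr ⟨h.1, h.2.of_tail h'⟩
  · exact Or.inr ⟨h.1, h'.2⟩

variable [TopologicalSpace A] [DiscreteTopology A]

instance (S : Sys A lo hi) : TopologicalSpace S.Path :=
  inferInstanceAs (TopologicalSpace {e : ∀ k, A × Fin (S.D k).len //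
    ∀ k, (e k).1 = S.src (k + 1) (e (k + 1))})

instance (S : Sys A lo hi) : T2Space S.Path :=
  inferInstanceAs (T2Space {e : ∀ k, A × Fin (S.D k).len //
    ∀ k, (e k).1 = S.src (k + 1) (e (k + 1))})

theorem Pat.continuous_sub (c : Pat A) : Continuous c.sub :=
  continuous_pi fun m =>
    (continuous_of_discreteTopology (f := fun a : A => (c.fn (m % c.len).toNat).getD a)).comp
      (continuous_apply (m / (c.len : ℤ)))

/-- The orbit closure of the `n`-th desubstitution. -/
def Sys.X (S : Sys A lo hi) (n : ℕ) : Set (ℤ → A) := closure (zOrbit shift (S.τ n))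

theorem tr_mem_closure {x y : ℤ → A} (hy : y ∈ closure (zOrbit shift x)) (j : ℤ) :
    tr j y ∈ closure (zOrbit shift x) := by
  refine map_mem_closure (continuous_tr j) hy fun z hz => ?_
  rw [mem_zOrbit_shift] at hz ⊢
  obtain ⟨i, rfl⟩ := hz
  exact ⟨j + i, by simp⟩

theorem Sys.tr_mem (S : Sys A lo hi) {n : ℕ} {y : ℤ → A} (hy : y ∈ S.X n) (j : ℤ) :
    tr j y ∈ S.X n := tr_mem_closure hy j

theorem Sys.τ_mem (S : Sys A lo hi) (n : ℕ) : S.τ n ∈ S.X n :=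
  subset_closure (mem_zOrbit_shift.2 ⟨0, by simp⟩)

theorem Sys.isClosed_X (S : Sys A lo hi) (n : ℕ) : IsClosed (S.X n) := isClosed_closure

theorem Sys.glue_mem (S : Sys A lo hi) {n : ℕ} {y : ℤ → A} (hy : y ∈ S.X (n + 1)) (r : ℤ) :
    tr r ((S.D n).sub y) ∈ S.X n := by
  refine S.tr_mem (map_mem_closure (S.D n).continuous_sub hy fun z hz => ?_) r
  rw [mem_zOrbit_shift] at hz ⊢
  obtain ⟨i, rfl⟩ := hz
  exact ⟨i * (S.D n).len, by rw [Pat.sub_tr _ (S.good n).pos, ← S.sub_eq]⟩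

variable [Finite A]

theorem Sys.exists_desub (S : Sys A lo hi) {n : ℕ} {y : ℤ → A} (hy : y ∈ S.X n) :
    ∃ r < (S.D n).len, ∃ y' ∈ S.X (n + 1), y = tr r ((S.D n).sub y') := by
  let K : Set (ℤ → A) := ⋃ r : Fin (S.D n).len,
    (fun y => tr (r : ℕ) ((S.D n).sub y)) '' S.X (n + 1)
  have hK : IsClosed K := by
    refine isClosed_iUnion_of_finite fun r => ?_
    exact ((S.isClosed_X (n + 1)).isCompact.image
      ((continuous_tr _).comp (S.D n).continuous_sub)).isClosed
  have hsub : S.X n ⊆ K := by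
    refine closure_minimal (fun z hz => ?_) hK
    rw [mem_zOrbit_shift] at hz
    obtain ⟨j, rfl⟩ := hz
    obtain ⟨b, r, hr, rfl⟩ := exists_block_coord (S.good n).pos j
    refine Set.mem_iUnion.2 ⟨⟨r, hr⟩, tr b (S.τ (n + 1)), S.tr_mem (S.τ_mem _) b, ?_⟩
    simp only
    rw [Pat.sub_tr _ (S.good n).pos, ← S.sub_eq, tr_tr, add_comm]
  obtain ⟨r, y', hy', e⟩ := Set.mem_iUnion.1 (hsub hy)
  exact ⟨r, r.2, y', hy', e.symm⟩

theorem Sys.isAddr_τ (S : Sys A lo hi) : IsAddr S.D S.τ (fun _ => 0) :=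
  fun n => ⟨(S.good n).pos, by simpa using S.sub_eq n⟩

theorem Sys.isAddr_τ_neg (S : Sys A lo hi) :
    IsAddr S.D (fun n => tr (-1) (S.τ n)) (fun n => (S.D n).len - 1) := by
  intro n
  have := (S.good n).pos
  refine ⟨Nat.sub_lt this one_pos, ?_⟩
  change tr (-1) (S.τ n) = tr (((S.D n).len - 1 : ℕ) : ℤ) ((S.D n).sub (tr (-1) (S.τ (n + 1))))
  rw [Pat.sub_tr _ this, ← S.sub_eq, tr_tr]
  congr 1
  omega

/-- Recovering a point from its phase and desubstitution. -/
def Sys.glue (S : Sys A lo hi) (n : ℕ) (p : Fin (S.D n).len × S.X (n + 1)) : S.X n :=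
  ⟨tr (p.1 : ℕ) ((S.D n).sub p.2), S.glue_mem p.2.2 _⟩

theorem Sys.glue_bijective (S : Sys A lo hi) (n : ℕ) : Function.Bijective (S.glue n) := by
  constructor
  · rintro ⟨r, y, hy⟩ ⟨s, z, hz⟩ h
    have e : tr (r : ℕ) ((S.D n).sub y) = tr (s : ℕ) ((S.D n).sub z) := congrArg Subtype.val h
    have key : ∀ (a b : ℕ) (u v : ℤ → A), a < (S.D n).len → b ≤ a →
        tr a ((S.D n).sub u) = tr b ((S.D n).sub v) → a = b ∧ u = v := by
      intro a b u v ha hle e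
      have e2 : (S.D n).sub v = tr ((a - b : ℕ) : ℤ) ((S.D n).sub u) := by
        have := congrArg (tr (-(b : ℤ))) e
        rw [tr_tr, tr_tr] at this
        simp only [neg_add_cancel, tr_zero] at this
        rw [← this]; congr 1; omega
      have h := (S.good n).recog _ _ _ (by omega) e2
      exact ⟨by omega, h.2.symm⟩
    rcases le_total (s : ℕ) (r : ℕ) with hle | hle
    · obtain ⟨h1, h2⟩ := key r s y z r.2 hle e
      simp [Prod.ext_iff, Fin.ext_iff, h1, h2]
    · obtain ⟨h1, h2⟩ := key s r z y s.2 hle e.symm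
      simp [Prod.ext_iff, Fin.ext_iff, h1, h2]
  · rintro ⟨y, hy⟩
    obtain ⟨r, hr, y', hy', e⟩ := S.exists_desub hy
    exact ⟨(⟨r, hr⟩, ⟨y', hy'⟩), Subtype.ext e.symm⟩

instance (S : Sys A lo hi) (n : ℕ) : CompactSpace (S.X n) :=
  isCompact_iff_compactSpace.1 (S.isClosed_X n).isCompact

theorem Sys.continuous_glue (S : Sys A lo hi) (n : ℕ) : Continuous (S.glue n) := by
  refine Continuous.subtype_mk ?_ _
  rw [continuous_prod_of_discrete_left]
  intro r
  exact (continuous_tr ((r : ℕ) : ℤ)).comp ((S.D n).continuous_sub.comp continuous_subtype_val)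

/-- Phase and desubstitution of a point. -/
noncomputable def Sys.desub (S : Sys A lo hi) (n : ℕ) : S.X n ≃ₜ Fin (S.D n).len × S.X (n + 1) :=
  (Continuous.homeoOfEquivCompactToT2 (f := Equiv.ofBijective _ (S.glue_bijective n))
    (S.continuous_glue n)).symm

theorem Sys.desub_symm_apply (S : Sys A lo hi) (n : ℕ) (p) : (S.desub n).symm p = S.glue n p := rfl

theorem Sys.coe_eq (S : Sys A lo hi) (n : ℕ) (y : S.X n) :
    (y : ℤ → A) = tr ((S.desub n y).1 : ℕ) ((S.D n).sub (S.desub n y).2) := by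
  conv_lhs => rw [← (S.desub n).symm_apply_apply y]
  rfl

/-- Iterated desubstitutions of a point. -/
noncomputable def Sys.seq (S : Sys A lo hi) (y : S.X 0) : ∀ n, S.X n
  | 0 => y
  | n + 1 => (S.desub n (S.seq y n)).2

/-- The phases of the iterated desubstitutions. -/
noncomputable def Sys.ph (S : Sys A lo hi) (y : S.X 0) (n : ℕ) : Fin (S.D n).len :=
  (S.desub n (S.seq y n)).1

theorem Sys.isAddr_seq (S : Sys A lo hi) (y : S.X 0) :
    IsAddr S.D (fun n => (S.seq y n : ℤ → A)) (fun n => S.ph y n) :=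
  fun n => ⟨(S.ph y n).2, S.coe_eq n (S.seq y n)⟩

theorem Sys.continuous_seq (S : Sys A lo hi) (n : ℕ) : Continuous fun y => S.seq y n := by
  induction n with
  | zero => exact continuous_id
  | succ n ih => exact continuous_snd.comp ((S.desub n).continuous.comp ih)

theorem Sys.continuous_ph (S : Sys A lo hi) (n : ℕ) : Continuous fun y => S.ph y n :=
  continuous_fst.comp ((S.desub n).continuous.comp (S.continuous_seq n))

/-- The edges of the path of a point. -/
noncomputable def Sys.edge (S : Sys A lo hi) (y : S.X 0) (k : ℕ) : A × Fin (S.D k).len :=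
  ((S.seq y (k + 1) : ℤ → A) 0, S.ph y k)

theorem Sys.src_edge (S : Sys A lo hi) (y : S.X 0) (k : ℕ) :
    S.src k (S.edge y k) = (S.seq y k : ℤ → A) 0 :=
  ((S.isAddr_seq y).apply k (m := 0) (b := 0) (S.ph y k).2 (by simp)).symm

/-- The path of a point. -/
noncomputable def Sys.path (S : Sys A lo hi) (y : S.X 0) : S.Path :=
  ⟨S.edge y, fun k => (S.src_edge y (k + 1)).symm⟩

theorem Sys.continuous_edge (S : Sys A lo hi) (k : ℕ) : Continuous fun y => S.edge y k :=
  ((continuous_apply (0 : ℤ)).comp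
    (continuous_subtype_val.comp (S.continuous_seq (k + 1)))).prodMk (S.continuous_ph k)

theorem Sys.continuous_path (S : Sys A lo hi) : Continuous S.path :=
  Continuous.subtype_mk (continuous_pi fun k => S.continuous_edge k) _

theorem Sys.path_injective (S : Sys A lo hi) : Function.Injective S.path := by
  intro y z h
  have he : ∀ k, S.edge y k = S.edge z k := fun k => congrFun (congrArg Subtype.val h) k
  have hr : (fun n => ((S.ph y n : ℕ))) = fun n => ((S.ph z n : ℕ)) :=
    funext fun n => congrArg (fun e => ((Prod.snd e : Fin _) : ℕ)) (he n)
  have h1 := S.isAddr_seq y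
  rw [hr] at h1
  refine Subtype.ext (h1.eq_of_letters S.good (S.isAddr_seq z) (fun n => ?_) 0)
  simp only [← S.src_edge, he]

theorem Sys.letter_occurs (S : Sys A lo hi) (n : ℕ) (a : A) : ∃ z : S.X n, (z : ℤ → A) 0 = a := by
  obtain ⟨r, hr, ha⟩ := (S.good n).surj a
  refine ⟨⟨tr r (S.τ n), S.tr_mem (S.τ_mem n) _⟩, ?_⟩
  have := (S.D n).sub_apply (S.τ (n + 1)) 0 hr
  rw [← S.sub_eq, ha] at this
  simpa [tr] using this

theorem Sys.exists_prefix (S : Sys A lo hi) (r : ∀ k, Fin (S.D k).len) (n : ℕ) :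
    ∀ z : S.X n, ∃ y : S.X 0, S.seq y n = z ∧ ∀ m < n, S.ph y m = r m := by
  induction n with
  | zero => exact fun z => ⟨z, rfl, fun m hm => absurd hm (by omega)⟩
  | succ n ih =>
    intro z
    obtain ⟨y, hy, hm⟩ := ih ((S.desub n).symm (r n, z))
    refine ⟨y, ?_, fun m hmn => ?_⟩
    · simp [seq, hy]
    · rcases Nat.lt_succ_iff_lt_or_eq.1 hmn with h | rfl
      · exact hm m h
      · simp [ph, hy]

theorem Sys.path_surjective (S : Sys A lo hi) : Function.Surjective S.path := by
  intro p
  let C : ℕ → Set (S.X 0) := fun n => {y | ∀ m < n, S.edge y m = p.1 m}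
  have hC : (⋂ n, C n).Nonempty := by
    refine IsCompact.nonempty_iInter_of_sequence_nonempty_isCompact_isClosed C
      (fun n y hy m hm => hy m (by omega)) (fun n => ?_) ?_ (fun n => ?_)
    · obtain ⟨z, hz⟩ := S.letter_occurs n (S.src n (p.1 n))
      obtain ⟨y, hy, hm⟩ := S.exists_prefix (fun k => (p.1 k).2) n z
      refine ⟨y, ?_⟩
      have key : ∀ k ≤ n, (S.seq y k : ℤ → A) 0 = S.src k (p.1 k) := by
        intro k hk
        refine Nat.decreasingInduction (fun k hk ih => ?_) (by rw [hy, hz]) hk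
        rw [← S.src_edge]
        have : S.edge y k = p.1 k := Prod.ext (by rw [p.2 k]; exact ih) (hm k hk)
        rw [this]
      exact fun m hmn => Prod.ext (by rw [p.2 m]; exact key (m + 1) hmn) (hm m hmn)
    · exact IsClosed.isCompact (by simp [C])
    · simp only [C, Set.ofPred_forall]
      exact isClosed_iInter fun m => isClosed_iInter fun _ =>
        isClosed_eq (S.continuous_edge m) continuous_const
  obtain ⟨y, hy⟩ := hC
  refine ⟨y, Subtype.ext (funext fun k => ?_)⟩
  exact Set.mem_iInter.1 hy (k + 1) k (by omega)

/-- The subshift is homeomorphic to the path space. -/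
noncomputable def Sys.pathHomeo (S : Sys A lo hi) : S.X 0 ≃ₜ S.Path :=
  Continuous.homeoOfEquivCompactToT2
    (f := Equiv.ofBijective _ ⟨S.path_injective, S.path_surjective⟩) S.continuous_path

theorem Sys.edge_eq (S : Sys A lo hi) (y : S.X 0) {Y : ℕ → ℤ → A} {r : ℕ → ℕ}
    (h : IsAddr S.D Y r) (h0 : Y 0 = y) (n : ℕ) :
    (S.edge y n).1 = Y (n + 1) 0 ∧ ((S.edge y n).2 : ℕ) = r n := by
  have := fun n => (S.isAddr_seq y).unique S.good h h0.symm n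
  exact ⟨congrFun (this (n + 1)).1 0, (this n).2⟩

theorem Sys.tail_of_addr (S : Sys A lo hi) (y : S.X 0) {Y : ℕ → ℤ → A} {r : ℕ → ℕ}
    (h : IsAddr S.D Y r) (h0 : Y 0 = y) (hr : ∀ n, r n = 0) : Tail (S.edge y) S.mn := by
  refine ⟨0, fun m _ => ?_⟩
  obtain ⟨h1, h2⟩ := S.edge_eq y h h0 m
  refine Prod.ext ?_ (Fin.ext (by rw [h2, hr]; rfl))
  rw [h1, h.apply (m + 1) (b := 0) (S.good (m + 1)).pos (by simp [hr]), (S.good (m + 1)).first]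
  rfl

theorem Sys.tail_of_addr_last (S : Sys A lo hi) (y : S.X 0) {Y : ℕ → ℤ → A} {r : ℕ → ℕ}
    (h : IsAddr S.D Y r) (h0 : Y 0 = y) (hr : ∀ n, r n + 1 = (S.D n).len) :
    Tail (S.edge y) S.mx := by
  refine ⟨0, fun m _ => ?_⟩
  obtain ⟨h1, h2⟩ := S.edge_eq y h h0 m
  refine Prod.ext ?_ (Fin.ext (by rw [h2]; have := hr m; simp only [mx]; omega))
  have hp := (S.good (m + 1)).pos
  rw [h1, h.apply (m + 1) (b := 0) (s := (S.D (m + 1)).len - 1) (by omega)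
    (by have := hr (m + 1); push_cast [Nat.cast_sub hp]; omega), (S.good (m + 1)).last]
  rfl

theorem Sys.rel_tr_one (S : Sys A lo hi) (y : S.X 0) :
    PathRel S.mn S.mx (S.edge y) (S.edge ⟨tr 1 y, S.tr_mem y.2 1⟩) := by
  obtain ⟨Y', r', h', h0, h | ⟨h1, h2⟩⟩ := (S.isAddr_seq y).succ S.good
  · refine Or.inl ?_
    obtain ⟨n, hn⟩ := h
    refine ⟨n, fun m hm => ?_⟩
    obtain ⟨e1, e2⟩ := S.edge_eq ⟨tr 1 y, S.tr_mem y.2 1⟩ h' h0 m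
    refine Prod.ext ?_ (Fin.ext ?_)
    · rw [e1, (hn (m + 1) (by omega)).2]; rfl
    · rw [e2, (hn m hm).1]; rfl
  · exact Or.inr ⟨Or.inr (S.tail_of_addr_last y (S.isAddr_seq y) rfl h1),
      Or.inl (S.tail_of_addr _ h' h0 h2)⟩

theorem Sys.rel_tr_nat (S : Sys A lo hi) (y : S.X 0) (n : ℕ) :
    PathRel S.mn S.mx (S.edge y) (S.edge ⟨tr n y, S.tr_mem y.2 n⟩) := by
  induction n with
  | zero => simpa using PathRel.refl (S.edge y)
  | succ n ih =>
    refine ih.trans ?_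
    have := S.rel_tr_one ⟨tr n y, S.tr_mem y.2 n⟩
    have e : tr ((n + 1 : ℕ) : ℤ) (y : ℤ → A) = tr 1 (tr n y) := by
      rw [tr_tr]; push_cast; rw [add_comm]
    simp only [e]
    exact this

theorem Sys.mem_orbit_of_special (S : Sys A lo hi) (y : S.X 0)
    (h : Special S.mn S.mx (S.edge y)) : ∃ j, (y : ℤ → A) = tr j (S.τ 0) := by
  have hy := S.isAddr_seq y
  rcases h with ⟨n, hn⟩ | ⟨n, hn⟩
  · refine hy.same_orbit_of_tail S.good S.isAddr_τ n fun m hm => ⟨?_, ?_⟩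
    · exact congrArg (fun e => ((Prod.snd e : Fin _) : ℕ)) (hn m hm)
    · have := S.isAddr_τ.apply m (m := 0) (b := 0) (S.good m).pos (by simp)
      rw [← S.src_edge, hn m hm, src_mn, this, (S.good m).first]; rfl
  · obtain ⟨j, hj⟩ := hy.same_orbit_of_tail S.good S.isAddr_τ_neg n fun m hm => ⟨
        congrArg (fun e => ((Prod.snd e : Fin _) : ℕ)) (hn m hm), by
      have hp := (S.good m).pos
      have := S.isAddr_τ_neg.apply m (m := 0) (b := 0) (s := (S.D m).len - 1) (by omega) (by simp)
      rw [← S.src_edge, hn m hm, src_mx, this, (S.good m).last]; rfl⟩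
    exact ⟨j + -1, by rw [tr_tr] at hj; exact hj⟩

theorem Sys.mem_zOrbit_iff (S : Sys A lo hi) (y z : S.X 0) :
    (z : ℤ → A) ∈ zOrbit shift (y : ℤ → A) ↔ PathRel S.mn S.mx (S.edge y) (S.edge z) := by
  constructor
  · rintro ⟨n, h | h⟩
    · rw [shift_iterate] at h
      have := S.rel_tr_nat y n
      simp only [h] at this
      exact this
    · rw [shift_iterate] at h
      have := S.rel_tr_nat z n
      simp only [h] at this
      exact this.symm
  · rw [mem_zOrbit_shift]
    rintro (⟨n, hn⟩ | ⟨h1, h2⟩)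
    · refine (S.isAddr_seq z).same_orbit_of_tail S.good (S.isAddr_seq y) n fun m hm => ⟨?_, ?_⟩
      · exact congrArg (fun e => ((Prod.snd e : Fin _) : ℕ)) (hn m hm).symm
      · rw [← S.src_edge, ← S.src_edge, hn m hm]
    · obtain ⟨i, hi⟩ := S.mem_orbit_of_special y h1
      obtain ⟨j, hj⟩ := S.mem_orbit_of_special z h2
      exact ⟨j - i, by rw [hi, hj, tr_tr]; congr 1; ring⟩

end Systems

section Interleaving

theorem exists_equiv_of_card_fiber {U V κ : Type*} [Finite U] [Finite V] (f : U → κ) (g : V → κ)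
    (h : ∀ c, Nat.card {u // f u = c} = Nat.card {v // g v = c}) :
    ∃ e : U ≃ V, ∀ u, g (e u) = f u := by
  have h' : ∀ c, Nonempty ({u // f u = c} ≃ {v // g v = c}) := fun c =>
    ⟨(Finite.equivFinOfCardEq (h c)).trans (Finite.equivFin _).symm⟩
  let φ := fun c => (h' c).some
  refine ⟨((Equiv.sigmaFiberEquiv f).symm.trans (Equiv.sigmaCongrRight φ)).trans
    (Equiv.sigmaFiberEquiv g), fun u => ?_⟩
  exact (φ (f u) ⟨u, rfl⟩).2

/-- A class preserving bijection between finite sets can be chosen to respect two marked points in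
distinct classes. -/
theorem exists_equiv_of_card_fiber_marked {U V κ : Type*} [Finite U] [Finite V] (f : U → κ)
    (g : V → κ) (h : ∀ c, Nat.card {u // f u = c} = Nat.card {v // g v = c})
    {u₁ u₂ : U} {v₁ v₂ : V} (h₁ : f u₁ = g v₁) (h₂ : f u₂ = g v₂) (hne : f u₁ ≠ f u₂) :
    ∃ e : U ≃ V, (∀ u, g (e u) = f u) ∧ e u₁ = v₁ ∧ e u₂ = v₂ := by
  classical
  obtain ⟨e, he⟩ := exists_equiv_of_card_fiber f g h
  have hs : ∀ a b : V, g a = g b → ∀ v, g (Equiv.swap a b v) = g v := by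
    intro a b hab v
    rw [Equiv.swap_apply_def]
    split_ifs with h1 h2
    · rw [h1, hab]
    · rw [h2, hab]
    · rfl
  have e1 : g (e u₁) = g v₁ := by rw [he, h₁]
  have e2 : g (e u₂) = g v₂ := by rw [he, h₂]
  have ne1 : g v₁ ≠ g v₂ := by rwa [← h₁, ← h₂]
  refine ⟨(e.trans (Equiv.swap (e u₁) v₁)).trans (Equiv.swap (e u₂) v₂), fun u => ?_, ?_, ?_⟩
  · simp only [Equiv.trans_apply]
    rw [hs _ _ e2, hs _ _ e1, he]
  · simp only [Equiv.trans_apply, Equiv.swap_apply_left]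
    refine Equiv.swap_apply_of_ne_of_ne ?_ ?_
    · intro h; exact ne1 (by rw [h, e2])
    · intro h; exact ne1 (by rw [h])
  · simp only [Equiv.trans_apply]
    rw [Equiv.swap_apply_of_ne_of_ne (a := e u₁) (b := v₁) (x := e u₂)]
    · simp
    · intro h; exact ne1 (by rw [← e1, ← h, e2])
    · intro h; exact ne1 (by rw [← h, e2])

variable {A : Type*} {lo hi : A}

/-- The number of occurrences of `i` in the pattern `c` with holes filled by `j`. -/
noncomputable def Pat.cnt (c : Pat A) (j i : A) : ℕ :=
  Nat.card {r : Fin c.len // (c.fn r).getD j = i}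

/-- Edges of a bipartite multigraph with `m j i` edges from `j` to `i`. -/
abbrev MEdge (m : A → A → ℕ) : Type _ := (p : A × A) × Fin (m p.1 p.2)

/-- Composable pairs of edges. -/
abbrev MPair (f g : A → A → ℕ) : Type _ :=
  {p : MEdge f × MEdge g // p.1.1.2 = p.2.1.1}

/-- The end points of a composable pair of edges. -/
abbrev MPair.ends {f g : A → A → ℕ} (p : MPair f g) : A × A := (p.1.1.1.1, p.1.2.1.2)

theorem card_mpair [Fintype A] (f g : A → A → ℕ) (l i : A) :
    Nat.card {p : MPair f g // p.ends = (l, i)} = ∑ j, f l j * g j i := by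
  let φ : (Σ j, Fin (f l j) × Fin (g j i)) → {p : MPair f g // p.ends = (l, i)} :=
    fun x => ⟨⟨(⟨(l, x.1), x.2.1⟩, ⟨(x.1, i), x.2.2⟩), rfl⟩, rfl⟩
  have hφ : Function.Bijective φ := by
    constructor
    · rintro ⟨j, a, b⟩ ⟨j', a', b'⟩ h
      simp only [φ, Subtype.mk.injEq, Prod.mk.injEq] at h
      obtain ⟨h1, h2⟩ := h
      obtain ⟨h3, h4⟩ := Sigma.mk.inj_iff.1 h1
      obtain ⟨h5, h6⟩ := Sigma.mk.inj_iff.1 h2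
      obtain rfl : j = j' := (Prod.mk.inj h3).2
      obtain rfl := eq_of_heq h4
      obtain rfl := eq_of_heq h6
      rfl
    · rintro ⟨⟨⟨⟨⟨l', j⟩, a⟩, ⟨⟨j', i'⟩, b⟩⟩, h⟩, h'⟩
      obtain rfl : j = j' := h
      obtain ⟨rfl, rfl⟩ := Prod.mk.inj h'
      exact ⟨⟨j, a, b⟩, rfl⟩
  rw [← Nat.card_congr (Equiv.ofBijective φ hφ)]
  simp

theorem card_medge_target [Fintype A] (f : A → A → ℕ) (l : A) :
    Nat.card {p : MEdge f // p.1.1 = l} = ∑ i, f l i := by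
  let φ : (Σ i, Fin (f l i)) → {p : MEdge f // p.1.1 = l} := fun x => ⟨⟨(l, x.1), x.2⟩, rfl⟩
  have hφ : Function.Bijective φ := by
    constructor
    · rintro ⟨j, a⟩ ⟨j', a'⟩ h
      simp only [φ, Subtype.mk.injEq] at h
      obtain ⟨h3, h4⟩ := Sigma.mk.inj_iff.1 h
      obtain rfl : j = j' := (Prod.mk.inj h3).2
      obtain rfl := eq_of_heq h4
      rfl
    · rintro ⟨⟨⟨l', j⟩, a⟩, h⟩
      obtain rfl : l' = l := h
      exact ⟨⟨j, a⟩, rfl⟩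
  rw [← Nat.card_congr (Equiv.ofBijective φ hφ)]
  simp

theorem Sys.card_edges (S : Sys A lo hi) (k : ℕ) (l i : A) :
    Nat.card {e : A × Fin (S.D k).len // (e.1, S.src k e) = (l, i)} = (S.D k).cnt l i := by
  refine Nat.card_congr ⟨fun e => ⟨e.1.2, ?_⟩, fun r => ⟨(l, r.1), ?_⟩, fun e => ?_, fun r => ?_⟩
  · have h := Prod.mk.inj e.2
    exact (congrArg _ h.1.symm).trans h.2
  · exact Prod.ext rfl r.2
  · obtain ⟨⟨a, r⟩, h⟩ := e
    obtain ⟨rfl, h⟩ := Prod.mk.inj h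
    rfl
  · rfl

theorem Sys.card_edges_target (S : Sys A lo hi) (k : ℕ) (l : A) :
    Nat.card {e : A × Fin (S.D k).len // e.1 = l} = (S.D k).len := by
  rw [Nat.card_congr (β := Fin (S.D k).len) ⟨fun e => e.1.2, fun r => ⟨(l, r), rfl⟩, ?_, ?_⟩]
  · simp
  · rintro ⟨⟨a, r⟩, rfl⟩; rfl
  · intro r; rfl

theorem pathRel_map_iff {E E' : ℕ → Type*} (Φ : (∀ k, E k) → ∀ k, E' k)
    (h : ∀ e e', Tail (Φ e) (Φ e') ↔ Tail e e') (mn mx e e' : ∀ k, E k) :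
    PathRel (Φ mn) (Φ mx) (Φ e) (Φ e') ↔ PathRel mn mx e e' := by
  simp only [PathRel, Special, h]

variable [TopologicalSpace A] [DiscreteTopology A]

instance [Finite A] (S : Sys A lo hi) : CompactSpace S.Path := S.pathHomeo.compactSpace

theorem orbitEquivalent_of_paths [Finite A] (S S' : Sys A lo hi) (Φ : S.Path ≃ₜ S'.Path)
    (h : ∀ p q, PathRel S.mn S.mx p.1 q.1 ↔ PathRel S'.mn S'.mx (Φ p).1 (Φ q).1) :
    SubshiftOrbitEquivalent (S.X 0) (S'.X 0) := by
  refine ⟨(S.pathHomeo.trans Φ).trans S'.pathHomeo.symm, fun x y => ?_⟩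
  rw [S.mem_zOrbit_iff, S'.mem_zOrbit_iff]
  have h1 : ∀ z : S.X 0, S'.edge (((S.pathHomeo.trans Φ).trans S'.pathHomeo.symm) z)
      = (Φ (S.pathHomeo z)).1 := by
    intro z
    have : S'.pathHomeo (S'.pathHomeo.symm (Φ (S.pathHomeo z))) = Φ (S.pathHomeo z) :=
      S'.pathHomeo.apply_symm_apply _
    exact congrArg Subtype.val this
  rw [h1, h1]
  exact h (S.pathHomeo x) (S.pathHomeo y)

/-- Two systems whose diagrams interleave are orbit equivalent. -/
theorem orbitEquivalent_of_interleaving [Fintype A] (hlh : lo ≠ hi) (S S' : Sys A lo hi)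
    (E F : ℕ → A → A → ℕ)
    (hE : ∀ k j i, 0 < E k j i) (hF : ∀ k j i, 0 < F k j i)
    (hX : ∀ k l i, (S.D k).cnt l i = ∑ j, F k l j * E k j i)
    (hY : ∀ k l i, (S'.D (k + 1)).cnt l i = ∑ j, E (k + 1) l j * F k j i)
    (h0 : ∀ l, (S'.D 0).len = ∑ i, E 0 l i) :
    SubshiftOrbitEquivalent (S.X 0) (S'.X 0) := by
  let pt : ∀ m : A → A → ℕ, (∀ j i, 0 < m j i) → A → MEdge m := fun m hm a => ⟨(a, a), ⟨0, hm a a⟩⟩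
  have hα : ∀ k, ∃ e : (A × Fin (S.D k).len) ≃ MPair (F k) (E k),
      (∀ u, (e u).ends = (u.1, S.src k u)) ∧
      e (S.mn k) = ⟨(pt _ (hF k) lo, pt _ (hE k) lo), rfl⟩ ∧
      e (S.mx k) = ⟨(pt _ (hF k) hi, pt _ (hE k) hi), rfl⟩ := fun k =>
    exists_equiv_of_card_fiber_marked _ _
      (fun c => by rw [S.card_edges k c.1 c.2, card_mpair, hX])
      (by rw [S.src_mn]; rfl) (by rw [S.src_mx]; rfl) (fun h => hlh (Prod.mk.inj h).1)
  have hβ : ∀ k, ∃ e : (A × Fin (S'.D (k + 1)).len) ≃ MPair (E (k + 1)) (F k),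
      (∀ u, (e u).ends = (u.1, S'.src (k + 1) u)) ∧
      e (S'.mn (k + 1)) = ⟨(pt _ (hE (k + 1)) lo, pt _ (hF k) lo), rfl⟩ ∧
      e (S'.mx (k + 1)) = ⟨(pt _ (hE (k + 1)) hi, pt _ (hF k) hi), rfl⟩ := fun k =>
    exists_equiv_of_card_fiber_marked _ _
      (fun c => by rw [S'.card_edges (k + 1) c.1 c.2, card_mpair, hY])
      (by rw [S'.src_mn]; rfl) (by rw [S'.src_mx]; rfl) (fun h => hlh (Prod.mk.inj h).1)
  have hγ : ∃ e : (A × Fin (S'.D 0).len) ≃ MEdge (E 0),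
      (∀ u, (e u).1.1 = u.1) ∧ e (S'.mn 0) = pt _ (hE 0) lo ∧ e (S'.mx 0) = pt _ (hE 0) hi :=
    exists_equiv_of_card_fiber_marked (fun u : A × Fin (S'.D 0).len => u.1)
      (fun u : MEdge (E 0) => u.1.1)
      (fun c => by rw [card_medge_target, ← h0 c]; exact S'.card_edges_target 0 c) rfl rfl hlh
  choose α hα hαn hαx using hα
  choose β hβ hβn hβx using hβ
  obtain ⟨γ, hγ, hγn, hγx⟩ := hγ
  -- the edges of the common refinement of a path
  have hα1 : ∀ k u, (α k u).1.1.1.1 = u.1 := fun k u => (Prod.mk.inj (hα k u)).1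
  have hα2 : ∀ k u, (α k u).1.2.1.2 = S.src k u := fun k u => (Prod.mk.inj (hα k u)).2
  have hβ1 : ∀ k u, (β k u).1.1.1.1 = u.1 := fun k u => (Prod.mk.inj (hβ k u)).1
  have hβ2 : ∀ k u, (β k u).1.2.1.2 = S'.src (k + 1) u := fun k u => (Prod.mk.inj (hβ k u)).2
  let Z := {z : ∀ k, MEdge (E k) × MEdge (F k) //
    ∀ k, (z k).1.1.1 = (z k).2.1.2 ∧ (z k).2.1.1 = (z (k + 1)).1.1.2}
  let fX : (∀ k, A × Fin (S.D k).len) → ∀ k, MEdge (E k) × MEdge (F k) :=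
    fun e k => ((α k (e k)).1.2, (α k (e k)).1.1)
  let gY : (∀ k, A × Fin (S'.D k).len) → ∀ k, MEdge (E k) := fun e k =>
    match k with
    | 0 => γ (e 0)
    | k + 1 => (β k (e (k + 1))).1.1
  let fY : (∀ k, A × Fin (S'.D k).len) → ∀ k, MEdge (E k) × MEdge (F k) :=
    fun e k => (gY e k, (β k (e (k + 1))).1.2)
  have injX : ∀ k u v, ((α k u).1.2, (α k u).1.1) = ((α k v).1.2, (α k v).1.1) → u = v := by
    intro k u v h
    obtain ⟨h1, h2⟩ := Prod.mk.inj h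
    exact (α k).injective (Subtype.ext (Prod.ext h2 h1))
  have injY : ∀ k u v, (β k u).1.1 = (β k v).1.1 → (β k u).1.2 = (β k v).1.2 → u = v :=
    fun k u v h1 h2 => (β k).injective (Subtype.ext (Prod.ext h1 h2))
  have tailX : ∀ e e', Tail (fX e) (fX e') ↔ Tail e e' := by
    refine fun e e' => exists_congr fun n => forall_congr' fun m => imp_congr_right fun _ => ?_
    exact ⟨fun h => injX m _ _ h, fun h => by simp only [fX, h]⟩
  have tailY : ∀ e e', Tail (fY e) (fY e') ↔ Tail e e' := by
    refine fun e e' => ⟨?_, ?_⟩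
    · rintro ⟨n, hn⟩
      refine ⟨n + 1, fun m hm => ?_⟩
      obtain ⟨m, rfl⟩ : ∃ m', m = m' + 1 := ⟨m - 1, by omega⟩
      exact injY m _ _ (Prod.ext_iff.1 (hn (m + 1) (by omega))).1
        (Prod.ext_iff.1 (hn m (by omega))).2
    · rintro ⟨n, hn⟩
      refine ⟨n + 1, fun m hm => ?_⟩
      obtain ⟨m, rfl⟩ : ∃ m', m = m' + 1 := ⟨m - 1, by omega⟩
      simp only [fY, gY, hn (m + 1) (by omega), hn (m + 1 + 1) (by omega)]
  have memX : ∀ p : S.Path, ∀ k, (fX p.1 k).1.1.1 = (fX p.1 k).2.1.2 ∧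
      (fX p.1 k).2.1.1 = (fX p.1 (k + 1)).1.1.2 := fun p k =>
    ⟨(α k (p.1 k)).2.symm, by simp only [fX]; rw [hα1, hα2, p.2 k]⟩
  have memY : ∀ p : S'.Path, ∀ k, (fY p.1 k).1.1.1 = (fY p.1 k).2.1.2 ∧
      (fY p.1 k).2.1.1 = (fY p.1 (k + 1)).1.1.2 := fun p k => by
    refine ⟨?_, (β k (p.1 (k + 1))).2.symm⟩
    cases k with
    | zero => simp only [fY, gY]; rw [hγ, hβ2, p.2 0]
    | succ k => simp only [fY, gY]; rw [hβ1, hβ2, p.2 (k + 1)]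
  let zX : S.Path → Z := fun p => ⟨fX p.1, memX p⟩
  let zY : S'.Path → Z := fun p => ⟨fY p.1, memY p⟩
  have contX : Continuous zX := by
    refine Continuous.subtype_mk (continuous_pi fun k => ?_) _
    exact (continuous_of_discreteTopology (f := fun u => ((α k u).1.2, (α k u).1.1))).comp
      ((continuous_apply k).comp continuous_subtype_val)
  have contY : Continuous zY := by
    have hc : ∀ k, Continuous fun p : S'.Path => p.1 k :=
      fun k => (continuous_apply k).comp continuous_subtype_val
    refine Continuous.subtype_mk (continuous_pi fun k => Continuous.prodMk ?_ ?_) _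
    · cases k with
      | zero => exact (continuous_of_discreteTopology (f := γ)).comp (hc 0)
      | succ k =>
        exact (continuous_of_discreteTopology (f := fun u => (β k u).1.1)).comp (hc (k + 1))
    · exact (continuous_of_discreteTopology (f := fun u => (β k u).1.2)).comp (hc (k + 1))
  have bijX : Function.Bijective zX := by
    refine ⟨fun p q h => Subtype.ext (funext fun k => ?_), fun z => ?_⟩
    · exact injX k _ _ (congrFun (congrArg Subtype.val h) k)
    · refine ⟨⟨fun k => (α k).symm ⟨((z.1 k).2, (z.1 k).1), (z.2 k).1.symm⟩, fun k => ?_⟩, ?_⟩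
      · rw [← hα1, ← hα2]; simp only [Equiv.apply_symm_apply]; exact (z.2 k).2
      · refine Subtype.ext (funext fun k => ?_)
        simp only [zX, fX, Equiv.apply_symm_apply]
  have bijY : Function.Bijective zY := by
    refine ⟨fun p q h => Subtype.ext (funext fun k => ?_), fun z => ?_⟩
    · have h' : ∀ k, fY p.1 k = fY q.1 k := fun k => congrFun (congrArg Subtype.val h) k
      cases k with
      | zero => exact γ.injective (congrArg Prod.fst (h' 0))
      | succ k => exact injY k _ _ (Prod.ext_iff.1 (h' (k + 1))).1 (Prod.ext_iff.1 (h' k)).2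
    · let e : ∀ k, A × Fin (S'.D k).len := fun k =>
        match k with
        | 0 => γ.symm (z.1 0).1
        | k + 1 => (β k).symm ⟨((z.1 (k + 1)).1, (z.1 k).2), (z.2 k).2.symm⟩
      have e0 : γ (e 0) = (z.1 0).1 := γ.apply_symm_apply _
      have e1 : ∀ k, β k (e (k + 1)) = ⟨((z.1 (k + 1)).1, (z.1 k).2), (z.2 k).2.symm⟩ :=
        fun k => (β k).apply_symm_apply _
      refine ⟨⟨e, fun k => ?_⟩, ?_⟩
      · rw [← hβ2, e1]
        cases k with
        | zero => rw [← hγ, e0]; exact (z.2 0).1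
        | succ k => rw [← hβ1, e1]; exact (z.2 (k + 1)).1
      · refine Subtype.ext (funext fun k => Prod.ext ?_ ?_)
        · cases k with
          | zero => exact e0
          | succ k => simp only [zY, fY, gY, e1]
        · simp only [zY, fY, e1]
  let hX' : S.Path ≃ₜ Z :=
    Continuous.homeoOfEquivCompactToT2 (f := Equiv.ofBijective zX bijX) contX
  let hY' : S'.Path ≃ₜ Z :=
    Continuous.homeoOfEquivCompactToT2 (f := Equiv.ofBijective zY bijY) contY
  refine orbitEquivalent_of_paths S S' (hX'.trans hY'.symm) fun p q => ?_
  have key : ∀ p, fY ((hX'.trans hY'.symm) p).1 = fX p.1 := fun p =>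
    congrArg Subtype.val (hY'.apply_symm_apply (hX' p))
  rw [← pathRel_map_iff fX tailX, ← pathRel_map_iff fY tailY, key, key]
  have hmn : fX S.mn = fY S'.mn := by
    funext k
    cases k with
    | zero => simp only [fX, fY, gY, hαn, hγn, hβn]
    | succ k => simp only [fX, fY, gY, hαn, hβn]
  have hmx : fX S.mx = fY S'.mx := by
    funext k
    cases k with
    | zero => simp only [fX, fY, gY, hαx, hγx, hβx]
    | succ k => simp only [fX, fY, gY, hαx, hβx]
  rw [hmn, hmx]

end Interleaving

section Telescoping

variable {A : Type*} {lo hi : A}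

theorem Pat.cnt_eq_sum [DecidableEq A] (c : Pat A) (j i : A) :
    c.cnt j i = ∑ r : Fin c.len, if (c.fn r).getD j = i then 1 else 0 := by
  rw [cnt, Nat.card_eq_fintype_card, Fintype.card_subtype, Finset.card_filter]

theorem Pat.sum_cnt [Fintype A] (c : Pat A) (j : A) : ∑ i, c.cnt j i = c.len := by
  classical
  simp only [cnt_eq_sum]
  rw [Finset.sum_comm]
  simp

theorem Pat.cnt_comp [Fintype A] (c c' : Pat A) (l i : A) :
    (c.comp c').cnt l i = ∑ j, c'.cnt l j * c.cnt j i := by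
  classical
  have e1 : (c.comp c').cnt l i = ∑ s : Fin c'.len, ∑ t : Fin c.len,
      if (c.fn t).getD ((c'.fn s).getD l) = i then 1 else 0 := by
    rw [cnt_eq_sum, ← Fintype.sum_prod_type']
    refine (Fintype.sum_equiv (finProdFinEquiv.trans (finCongr (Nat.mul_comm _ _))) _ _
      fun p => ?_).symm
    obtain ⟨s, t⟩ := p
    have h1 : ((t : ℕ) + c.len * s) % c.len = t := by
      rw [Nat.add_mul_mod_self_left, Nat.mod_eq_of_lt t.2]
    have h2 : ((t : ℕ) + c.len * s) / c.len = s := by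
      rw [Nat.add_mul_div_left _ _ (by have := t.2; omega), Nat.div_eq_of_lt t.2, zero_add]
    simp only [comp, Equiv.trans_apply, finProdFinEquiv_apply_val, finCongr_apply, Fin.val_cast,
      h1, h2]
    cases c.fn t <;> rfl
  rw [e1]
  simp only [← cnt_eq_sum]
  have e2 : ∀ j, c'.cnt l j * c.cnt j i
      = ∑ s : Fin c'.len, if (c'.fn s).getD l = j then c.cnt j i else 0 := by
    intro j
    rw [cnt_eq_sum, Finset.sum_mul]
    simp
  simp only [e2]
  rw [Finset.sum_comm]
  simp

/-- The composition of the patterns `D n, …, D (n + m)`. -/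
def cmp (D : ℕ → Pat A) : ℕ → ℕ → Pat A
  | n, 0 => D n
  | n, m + 1 => (D n).comp (cmp D (n + 1) m)

theorem Sys.cmp_good (S : Sys A lo hi) (n m : ℕ) : (cmp S.D n m).Good lo hi := by
  induction m generalizing n with
  | zero => exact S.good n
  | succ m ih => exact (S.good n).comp (ih (n + 1))

theorem Sys.cmp_sub (S : Sys A lo hi) (n m : ℕ) :
    S.τ n = (cmp S.D n m).sub (S.τ (n + m + 1)) := by
  induction m generalizing n with
  | zero => exact S.sub_eq n
  | succ m ih =>
    rw [cmp, Pat.comp_sub _ _ (S.good n).pos (S.cmp_good _ _).pos, S.sub_eq, ih (n + 1)]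
    congr 3
    ring_nf

theorem cmp_cnt [Fintype A] {D : ℕ → Pat A} {u : ℕ → A → ℝ}
    (hu : ∀ n i, u n i = ∑ j, u (n + 1) j * (D n).cnt j i) (n m : ℕ) (i : A) :
    u n i = ∑ j, u (n + m + 1) j * (cmp D n m).cnt j i := by
  induction m generalizing n i with
  | zero => exact hu n i
  | succ m ih =>
    rw [hu n i]
    simp only [ih (n + 1), cmp, Pat.cnt_comp]
    push_cast
    simp only [Finset.sum_mul, Finset.mul_sum]
    rw [Finset.sum_comm]
    refine Finset.sum_congr rfl fun l _ => Finset.sum_congr rfl fun j _ => ?_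
    rw [show n + 1 + m + 1 = n + (m + 1) + 1 by ring]
    ring

/-- The system obtained by composing the patterns between the levels `n k` and `n (k + 1)`. -/
def Sys.tele (S : Sys A lo hi) (n : ℕ → ℕ) (hn : ∀ k, n k < n (k + 1)) : Sys A lo hi where
  D k := cmp S.D (n k) (n (k + 1) - n k - 1)
  τ k := S.τ (n k)
  good k := S.cmp_good _ _
  sub_eq k := by
    rw [S.cmp_sub (n k) (n (k + 1) - n k - 1)]
    have := hn k
    congr 2
    omega

theorem Sys.tele_cnt [Fintype A] (S : Sys A lo hi) (n : ℕ → ℕ) (hn : ∀ k, n k < n (k + 1))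
    {u : ℕ → A → ℝ} (hu : ∀ n i, u n i = ∑ j, u (n + 1) j * (S.D n).cnt j i) (k : ℕ) (i : A) :
    u (n k) i = ∑ j, u (n (k + 1)) j * ((S.tele n hn).D k).cnt j i := by
  have h := cmp_cnt hu (n k) (n (k + 1) - n k - 1) i
  rwa [show n k + (n (k + 1) - n k - 1) + 1 = n (k + 1) by have := hn k; omega] at h

theorem LinearIndependent.eq_of_sum_natCast [Fintype A] {u : A → ℝ} (hu : LinearIndependent ℚ u)
    {p q : A → ℕ} (h : ∑ j, u j * p j = ∑ j, u j * q j) : p = q := by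
  funext j
  have := Fintype.linearIndependent_iff.1 hu (fun j => (p j : ℚ) - q j) (by
    simp only [Rat.smul_def]
    push_cast
    simp only [sub_mul, Finset.sum_sub_distrib]
    rw [sub_eq_zero]
    simpa only [mul_comm] using h) j
  have h2 : (p j : ℚ) = q j := by linarith
  exact_mod_cast h2

variable [TopologicalSpace A] [DiscreteTopology A]

/-- Systems with compatible vectors of cylinder measures are orbit equivalent. -/
theorem orbitEquivalent_of_vectors [Fintype A] (hlh : lo ≠ hi) (S S' : Sys A lo hi)
    {u w : ℕ → A → ℝ}
    (hu : ∀ n i, u n i = ∑ j, u (n + 1) j * (S.D n).cnt j i)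
    (hw : ∀ n i, w n i = ∑ j, w (n + 1) j * (S'.D n).cnt j i)
    (hui : ∀ n, LinearIndependent ℚ (u n)) (hwi : ∀ n, LinearIndependent ℚ (w n))
    (h0 : ∑ i, u 0 i = ∑ i, w 0 i)
    (huw : ∀ n M, ∃ m, M ≤ m ∧ ∃ E : A → A → ℕ, (∀ j i, 0 < E j i) ∧
      ∀ i, u n i = ∑ j, w m j * E j i)
    (hwu : ∀ n M, ∃ m, M ≤ m ∧ ∃ E : A → A → ℕ, (∀ j i, 0 < E j i) ∧
      ∀ i, w n i = ∑ j, u m j * E j i) :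
    SubshiftOrbitEquivalent (S.X 0) (S'.X 0) := by
  choose f hf1 hf2 using huw
  choose g hg1 hg2 using hwu
  let p : ℕ → ℕ × ℕ := fun k => Nat.rec (0, f 0 1)
    (fun _ p => (g p.2 (p.1 + 1), f (g p.2 (p.1 + 1)) (p.2 + 1))) k
  let n : ℕ → ℕ := fun k => (p k).1
  let m : ℕ → ℕ := fun k =>
    match k with
    | 0 => 0
    | k + 1 => (p k).2
  have hn : ∀ k, n k < n (k + 1) := fun k => hg1 (p k).2 ((p k).1 + 1)
  have hm : ∀ k, m k < m (k + 1) := by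
    intro k
    cases k with
    | zero => exact hf1 0 1
    | succ k => exact hf1 (n (k + 1)) ((p k).2 + 1)
  have hE : ∀ k, ∃ E : A → A → ℕ, (∀ j i, 0 < E j i) ∧
      ∀ i, u (n k) i = ∑ j, w (m (k + 1)) j * E j i := by
    intro k
    cases k with
    | zero => exact hf2 0 1
    | succ k => exact hf2 (n (k + 1)) ((p k).2 + 1)
  have hF : ∀ k, ∃ E : A → A → ℕ, (∀ j i, 0 < E j i) ∧
      ∀ i, w (m (k + 1)) i = ∑ j, u (n (k + 1)) j * E j i :=
    fun k => hg2 (p k).2 ((p k).1 + 1)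
  choose E hE1 hE2 using hE
  choose F hF1 hF2 using hF
  refine orbitEquivalent_of_interleaving hlh (S.tele n hn) (S'.tele m hm) E F hE1 hF1 ?_ ?_ ?_
  · intro k l i
    refine congrFun (LinearIndependent.eq_of_sum_natCast (hui (n (k + 1)))
      (p := fun l => ((S.tele n hn).D k).cnt l i)
      (q := fun l => ∑ j, F k l j * E k j i) ?_) l
    rw [← S.tele_cnt n hn hu k i, hE2 k i]
    simp only [hF2 k]
    push_cast
    simp only [Finset.sum_mul, Finset.mul_sum]
    rw [Finset.sum_comm]
    simp only [mul_assoc]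
  · intro k l i
    refine congrFun (LinearIndependent.eq_of_sum_natCast (hwi (m (k + 1 + 1)))
      (p := fun l => ((S'.tele m hm).D (k + 1)).cnt l i)
      (q := fun l => ∑ j, E (k + 1) l j * F k j i) ?_) l
    rw [← S'.tele_cnt m hm hw (k + 1) i, hF2 k i]
    simp only [hE2 (k + 1)]
    push_cast
    simp only [Finset.sum_mul, Finset.mul_sum]
    rw [Finset.sum_comm]
    simp only [mul_assoc]
  · intro l
    refine congrFun (LinearIndependent.eq_of_sum_natCast (hwi (m 1))
      (p := fun _ => ((S'.tele m hm).D 0).len) (q := fun l => ∑ i, E 0 l i) ?_) l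
    have e1 : ∑ i, w 0 i = ∑ j, w (m 1) j * (((S'.tele m hm).D 0).len : ℝ) := by
      rw [Finset.sum_congr rfl fun i _ => S'.tele_cnt m hm hw 0 i, Finset.sum_comm]
      refine Finset.sum_congr rfl fun j _ => ?_
      rw [← Finset.mul_sum, ← Pat.sum_cnt _ j]
      push_cast
      rfl
    have e2 : ∑ i, u 0 i = ∑ j, w (m 1) j * ((∑ i, E 0 j i : ℕ) : ℝ) := by
      change ∑ i, u (n 0) i = _
      rw [Finset.sum_congr rfl fun i _ => hE2 0 i, Finset.sum_comm]
      refine Finset.sum_congr rfl fun j _ => ?_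
      rw [← Finset.mul_sum]
      push_cast
      rfl
    rw [← e1, ← e2, h0]

end Telescoping

section Construction

variable {A : Type*} [Fintype A] [DecidableEq A]

/-- The letters other than `lo`, with multiplicities `a`, ending with `hi`. -/
noncomputable def tailList (lo hi : A) (a : A → ℕ) : List A :=
  (((Finset.univ.erase lo).erase hi).toList.flatMap fun i => List.replicate (a i) i)
    ++ List.replicate (a hi) hi

/-- The word `lo^{a lo}` followed by `k` holes and the remaining letters. -/
noncomputable def mkPat (lo hi : A) (a : A → ℕ) (k : ℕ) : Pat A where
  len := a lo + k + (tailList lo hi a).length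
  fn r := if r < a lo then some lo else if r < a lo + k then none
    else (tailList lo hi a)[r - (a lo + k)]?

variable {lo hi : A}

theorem count_tailList (hlh : lo ≠ hi) (a : A → ℕ) (i : A) :
    (tailList lo hi a).count i = if i = lo then 0 else a i := by
  rw [tailList, List.count_append, List.count_flatMap, List.count_replicate]
  have : ((Finset.univ.erase lo).erase hi).toList.map (List.count i ∘ fun j => List.replicate (a j) j)
      = ((Finset.univ.erase lo).erase hi).toList.map fun j => if j = i then a j else 0 := by
    refine List.map_congr_left fun j _ => ?_
    simp [List.count_replicate]
  rw [this, Finset.sum_map_toList, Finset.sum_ite_eq']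
  by_cases h1 : i = lo
  · subst h1; simp [hlh.symm]
  · by_cases h2 : i = hi
    · subst h2; simp [h1]
    · simp [h1, h2, Ne.symm h2]

theorem length_tailList (hlh : lo ≠ hi) (a : A → ℕ) :
    a lo + (tailList lo hi a).length = ∑ i, a i := by
  have h : ∀ l : List A, l.length = ∑ i, l.count i := by
    intro l
    induction l with
    | nil => simp
    | cons b l ih => simp [List.count_cons, Finset.sum_add_distrib, ih]
  rw [h, Finset.sum_congr rfl fun i _ => count_tailList hlh a i,
    ← Finset.add_sum_erase _ a (Finset.mem_univ lo)]
  congr 1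
  rw [← Finset.add_sum_erase _ _ (Finset.mem_univ lo)]
  simp only [if_true, zero_add]
  exact Finset.sum_congr rfl fun i hi => if_neg (Finset.ne_of_mem_erase hi)

theorem mkPat_len (hlh : lo ≠ hi) (a : A → ℕ) (k : ℕ) :
    (mkPat lo hi a k).len = ∑ i, a i + k := by
  rw [← length_tailList hlh]; simp only [mkPat]; ring

theorem mkPat_cnt (hlh : lo ≠ hi) (a : A → ℕ) (k : ℕ) (j i : A) :
    (mkPat lo hi a k).cnt j i = a i + if j = i then k else 0 := by
  have e : (mkPat lo hi a k).cnt j i = ∑ r ∈ Finset.range (mkPat lo hi a k).len,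
      if ((mkPat lo hi a k).fn r).getD j = i then 1 else 0 := by
    rw [Pat.cnt_eq_sum, Finset.sum_range]
  have h1 : (∑ r ∈ Finset.range (a lo), if ((mkPat lo hi a k).fn r).getD j = i then 1 else 0)
      = if lo = i then a lo else 0 := by
    rw [Finset.sum_congr rfl (g := fun _ => if lo = i then 1 else 0)]
    · simp
    · intro r hr
      simp [mkPat, Finset.mem_range.1 hr]
  have h2 : (∑ r ∈ Finset.range k,
      if ((mkPat lo hi a k).fn (a lo + r)).getD j = i then 1 else 0)
      = if j = i then k else 0 := by
    rw [Finset.sum_congr rfl (g := fun _ => if j = i then 1 else 0)]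
    · simp
    · intro r hr
      simp [mkPat, Finset.mem_range.1 hr]
  have h3 : (∑ r ∈ Finset.range (tailList lo hi a).length,
      if ((mkPat lo hi a k).fn (a lo + k + r)).getD j = i then 1 else 0)
      = (tailList lo hi a).count i := by
    have hl : ∀ l : List A, (∑ r ∈ Finset.range l.length, if (l[r]?).getD j = i then 1 else 0)
        = l.count i := by
      intro l
      induction l with
      | nil => simp
      | cons b l ih =>
        rw [List.length_cons, Finset.sum_range_succ']
        simp [ih, List.count_cons]
    rw [← hl]
    refine Finset.sum_congr rfl fun r hr => ?_
    have n1 : ¬ (a lo + k + r < a lo) := by omega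
    simp [mkPat, n1]
  rw [e, show (mkPat lo hi a k).len = a lo + k + (tailList lo hi a).length from rfl,
    Finset.sum_range_add, Finset.sum_range_add, h1, h2, h3, count_tailList hlh]
  by_cases h : i = lo
  · subst h; simp
  · simp [h, Ne.symm h]; ring

theorem mkPat_good (hlh : lo ≠ hi) {a : A → ℕ} (ha : ∀ i, 1 ≤ a i) {k : ℕ} (hk : 1 ≤ k) :
    (mkPat lo hi a k).Good lo hi := by
  have hlen := mkPat_len hlh a k
  have hlo := ha lo
  have hhi := ha hi
  have htl : 1 ≤ (tailList lo hi a).length := by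
    have : (tailList lo hi a).count hi ≠ 0 := by rw [count_tailList hlh]; simp [hlh.symm]; omega
    have := List.count_le_length (a := hi) (l := tailList lo hi a)
    omega
  have hfirst : (mkPat lo hi a k).fn 0 = some lo := by
    simp only [mkPat]; rw [if_pos (by omega)]
  have hlast : (mkPat lo hi a k).fn ((mkPat lo hi a k).len - 1) = some hi := by
    simp only [mkPat]
    rw [if_neg (by omega), if_neg (by omega),
      show a lo + k + (tailList lo hi a).length - 1 - (a lo + k)
        = (tailList lo hi a).length - 1 by omega, ← List.getLast?_eq_getElem?, tailList,
      List.getLast?_append, List.getLast?_replicate, if_neg (by omega)]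
    rfl
  have h2 : 2 ≤ (mkPat lo hi a k).len := by simp only [mkPat]; omega
  refine ⟨h2, hfirst, hlast, ?_, ?_⟩
  · intro i
    by_cases h : i = lo
    · exact ⟨0, by omega, h ▸ hfirst⟩
    · have : i ∈ tailList lo hi a := by
        rw [← List.count_pos_iff, count_tailList hlh, if_neg h]
        exact ha i
      obtain ⟨s, hs, e⟩ := List.getElem_of_mem this
      refine ⟨a lo + k + s, by simp only [mkPat]; omega, ?_⟩
      simp only [mkPat]
      rw [if_neg (by omega), if_neg (by omega), Nat.add_sub_cancel_left,
        List.getElem?_eq_getElem hs, e]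
  · intro y z r hr hyz
    have hpos : 0 < (mkPat lo hi a k).len := by omega
    have hr0 : r = 0 := by
      by_contra hne
      have e0 := congrFun hyz 0
      have e1 := congrFun hyz (-1)
      have f0 := (mkPat lo hi a k).sub_apply y 0 hpos
      have f1 := (mkPat lo hi a k).sub_apply y (-1) (r := (mkPat lo hi a k).len - 1) (by omega)
      have g0 := (mkPat lo hi a k).sub_apply z 0 hr
      have g1 := (mkPat lo hi a k).sub_apply z 0 (r := r - 1) (by omega)
      rw [show (0 : ℤ) * (mkPat lo hi a k).len + (0 : ℕ) = 0 by simp, e0, hfirst] at f0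
      rw [show (-1 : ℤ) * (mkPat lo hi a k).len + ((mkPat lo hi a k).len - 1 : ℕ) = -1 by omega,
        e1, hlast] at f1
      simp only [tr, zero_mul, zero_add, Option.getD_some] at f0 f1 g0 g1
      rw [show (-1 : ℤ) + r = ((r - 1 : ℕ) : ℤ) by omega, g1] at f1
      rw [g0] at f0
      have hnot : ∀ s, a lo + k ≤ s → s < (mkPat lo hi a k).len →
          ((mkPat lo hi a k).fn s).getD (z 0) ≠ lo := by
        intro s hs hs' h
        have hs'' : s - (a lo + k) < (tailList lo hi a).length := by
          simp only [mkPat] at hs'; omega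
        simp only [mkPat] at h
        rw [if_neg (by omega), if_neg (by omega), List.getElem?_eq_getElem hs''] at h
        simp only [Option.getD_some] at h
        have : (tailList lo hi a)[s - (a lo + k)] ∈ tailList lo hi a := List.getElem_mem hs''
        rw [h, ← List.count_pos_iff, count_tailList hlh, if_pos rfl] at this
        omega
      have hrk : r < a lo + k := by
        by_contra h
        exact hnot r (by omega) hr f0
      have f0' := f0
      have f1' := f1
      simp only [mkPat] at f0 f1
      by_cases hra : r - 1 < a lo
      · rw [if_pos hra] at f1
        exact hlh f1
      · rw [if_neg hra, if_pos (by omega)] at f1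
        rw [if_neg (by omega), if_pos hrk] at f0
        simp only [Option.getD_none] at f0 f1
        exact hlh (f0.symm.trans f1)
    refine ⟨hr0, funext fun b => ?_⟩
    have hlt : a lo < (mkPat lo hi a k).len := by simp only [mkPat]; omega
    have hole : (mkPat lo hi a k).fn (a lo) = none := by
      simp only [mkPat]; rw [if_neg (by omega), if_pos (by omega)]
    have e0 := congrFun hyz (b * (mkPat lo hi a k).len + a lo)
    rw [hr0, Nat.cast_zero, tr_zero, Pat.sub_apply _ _ _ hlt, Pat.sub_apply _ _ _ hlt, hole] at e0
    exact e0

theorem mkPat_holes_le (lo hi : A) (a : A → ℕ) (k : ℕ) : (mkPat lo hi a k).holes ≤ k := by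
  have : ((Finset.range (mkPat lo hi a k).len).filter fun r => ((mkPat lo hi a k).fn r).isNone)
      ⊆ Finset.Ico (a lo) (a lo + k) := by
    intro r hr
    obtain ⟨h1, h2⟩ := Finset.mem_filter.1 hr
    rw [Finset.mem_range] at h1
    simp only [mkPat] at h1 h2
    rw [Finset.mem_Ico]
    by_contra hne
    by_cases h : r < a lo
    · simp [h] at h2
    · rw [if_neg h, if_neg (by omega), List.getElem?_eq_getElem (by omega)] at h2
      simp at h2
  calc _ ≤ _ := Finset.card_le_card this
    _ = k := by simp

end Construction

section Vectors

variable {A : Type*} [Fintype A]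

/-- Positive probability vectors with rationally independent entries. -/
structure Adm (v : A → ℝ) : Prop where
  pos : ∀ i, 0 < v i
  sum_one : ∑ i, v i = 1
  indep : LinearIndependent ℚ v

/-- The number of letters of the next block. -/
noncomputable def stepM (v : A → ℝ) : ℕ := ⌈∑ i, (v i)⁻¹⌉₊ + 2 * Fintype.card A

/-- The multiplicities of the letters of the next block. -/
noncomputable def stepA (v : A → ℝ) (i : A) : ℕ := ⌊stepM v * v i⌋₊

/-- The number of holes of the next block. -/
noncomputable def stepK (v : A → ℝ) : ℕ := stepM v - ∑ i, stepA v i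

/-- The frequencies of the letters that fill the holes of the next block. -/
noncomputable def stepV (v : A → ℝ) (i : A) : ℝ := (stepM v * v i - stepA v i) / stepK v

variable {v : A → ℝ}

theorem Adm.one_le_stepA (hv : Adm v) (i : A) : 1 ≤ stepA v i := by
  rw [stepA, Nat.one_le_floor_iff]
  have h1 : (v i)⁻¹ ≤ stepM v := by
    calc (v i)⁻¹ ≤ ∑ i, (v i)⁻¹ :=
          Finset.single_le_sum (fun j _ => (inv_pos.2 (hv.pos j)).le) (Finset.mem_univ i)
      _ ≤ ⌈∑ i, (v i)⁻¹⌉₊ := Nat.le_ceil _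
      _ ≤ stepM v := by rw [stepM]; push_cast; linarith [Nat.cast_nonneg (α := ℝ) (Fintype.card A)]
  have := mul_le_mul_of_nonneg_right h1 (hv.pos i).le
  rwa [inv_mul_cancel₀ (hv.pos i).ne'] at this

theorem Adm.stepA_le (hv : Adm v) (i : A) : (stepA v i : ℝ) ≤ stepM v * v i :=
  Nat.floor_le (mul_nonneg (Nat.cast_nonneg _) (hv.pos i).le)

theorem Adm.sum_stepA_le (hv : Adm v) : ∑ i, stepA v i ≤ stepM v := by
  have : (∑ i, (stepA v i : ℝ)) ≤ stepM v := by
    calc _ ≤ ∑ i, stepM v * v i := Finset.sum_le_sum fun i _ => hv.stepA_le i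
      _ = stepM v := by rw [← Finset.mul_sum, hv.sum_one, mul_one]
  exact_mod_cast this

theorem Adm.sum_stepA_add (hv : Adm v) : ∑ i, stepA v i + stepK v = stepM v := by
  have := hv.sum_stepA_le; rw [stepK]; omega

theorem Adm.stepK_eq (hv : Adm v) : (stepK v : ℝ) = ∑ i, (stepM v * v i - stepA v i) := by
  rw [Finset.sum_sub_distrib, ← Finset.mul_sum, hv.sum_one, mul_one, ← hv.sum_stepA_add]
  push_cast; ring

theorem Adm.two_stepK_le (hv : Adm v) : 2 * stepK v ≤ stepM v := by
  have h1 : (stepK v : ℝ) ≤ Fintype.card A := by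
    rw [hv.stepK_eq]
    calc _ ≤ ∑ i : A, (1 : ℝ) := Finset.sum_le_sum fun i _ => by
          have := Nat.lt_floor_add_one (stepM v * v i)
          rw [stepA]; linarith
      _ = _ := by simp
  have h2 : stepK v ≤ Fintype.card A := by exact_mod_cast h1
  rw [stepM]
  omega

theorem Adm.stepA_lt [Nontrivial A] (hv : Adm v) (i : A) : (stepA v i : ℝ) < stepM v * v i := by
  classical
  refine lt_of_le_of_ne (hv.stepA_le i) fun h => ?_
  obtain ⟨j, hj⟩ := exists_ne i
  have := Fintype.linearIndependent_iff.1 hv.indep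
    (fun l => (stepA v i : ℚ) - if l = i then (stepM v : ℚ) else 0) (by
      simp only [Rat.smul_def]
      push_cast
      simp only [sub_mul, Finset.sum_sub_distrib]
      rw [← Finset.mul_sum, hv.sum_one, mul_one, h,
        Finset.sum_eq_single i (fun l _ hl => by rw [if_neg hl]; simp) (by simp), if_pos rfl]
      simp) j
  have h1 := hv.one_le_stepA i
  rw [if_neg hj, sub_zero] at this
  norm_cast at this
  omega

theorem Adm.stepK_pos [Nontrivial A] (hv : Adm v) : 1 ≤ stepK v := by
  have : (0 : ℝ) < stepK v := by
    rw [hv.stepK_eq]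
    exact Finset.sum_pos (fun i _ => sub_pos.2 (hv.stepA_lt i)) Finset.univ_nonempty
  exact_mod_cast this

theorem Adm.eq_step [Nontrivial A] (hv : Adm v) (i : A) :
    stepM v * v i = stepA v i + stepK v * stepV v i := by
  have : (stepK v : ℝ) ≠ 0 := by have := hv.stepK_pos; positivity
  rw [stepV]; field_simp; ring

theorem Adm.next [Nontrivial A] (hv : Adm v) : Adm (stepV v) := by
  have hk : (0 : ℝ) < stepK v := by have := hv.stepK_pos; positivity
  have hkq : (0 : ℚ) < stepK v := by have := hv.stepK_pos; positivity
  have hm : (0 : ℚ) < stepM v := by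
    have := hv.sum_stepA_add; have := hv.stepK_pos
    have : 0 < stepM v := by omega
    exact_mod_cast this
  refine ⟨fun i => div_pos (sub_pos.2 (hv.stepA_lt i)) hk, ?_, ?_⟩
  · simp only [stepV]
    rw [← Finset.sum_div, ← hv.stepK_eq, div_self hk.ne']
  · rw [Fintype.linearIndependent_iff]
    intro c hc
    have h1 : ∑ i, (c i : ℝ) * (stepM v * v i - stepA v i) = 0 := by
      simp only [Rat.smul_def, stepV] at hc
      have : ∑ i, (c i : ℝ) * (stepM v * v i - stepA v i)
          = stepK v * ∑ i, (c i : ℝ) * ((stepM v * v i - stepA v i) / stepK v) := by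
        rw [Finset.mul_sum]
        refine Finset.sum_congr rfl fun i _ => ?_
        field_simp
      rw [this, hc, mul_zero]
    have h2 := Fintype.linearIndependent_iff.1 hv.indep
      (fun i => c i * stepM v - ∑ j, c j * stepA v j) (by
        simp only [Rat.smul_def]
        push_cast
        simp only [sub_mul, Finset.sum_sub_distrib]
        rw [← Finset.mul_sum, hv.sum_one, mul_one, ← h1, ← Finset.sum_sub_distrib]
        exact Finset.sum_congr rfl fun i _ => by ring)
    set s := ∑ j, c j * stepA v j with hs
    have h3 : ∀ i, c i = s / stepM v := fun i => by
      rw [eq_div_iff hm.ne']; exact sub_eq_zero.1 (h2 i)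
    have h4 : s * stepM v = s * ∑ j, (stepA v j : ℚ) := by
      have : s = s / stepM v * ∑ j, (stepA v j : ℚ) := by
        rw [Finset.mul_sum]
        conv_lhs => rw [hs]
        exact Finset.sum_congr rfl fun j _ => by rw [h3]
      field_simp at this
      linarith
    have h5 : (stepM v : ℚ) = ∑ j, (stepA v j : ℚ) + stepK v := by
      rw [← hv.sum_stepA_add]; push_cast; rfl
    have h6 : s = 0 := by
      have : s * stepK v = 0 := by rw [h5] at h4; linarith
      exact (mul_eq_zero.1 this).resolve_right hkq.ne'
    intro i
    rw [h3, h6, zero_div]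

/-- The sequence of frequency vectors. -/
noncomputable def vec (v : A → ℝ) : ℕ → A → ℝ
  | 0 => v
  | n + 1 => stepV (vec v n)

theorem Adm.vec [Nontrivial A] (hv : Adm v) (n : ℕ) : Adm (vec v n) := by
  induction n with
  | zero => exact hv
  | succ n ih => exact ih.next

end Vectors

section Sequence

variable {A : Type*}

/-- Reading a letter of the iterated substitution, looking at no more than `f` patterns. -/
def fill (lo : A) : ℕ → (ℕ → Pat A) → ℤ → A
  | 0, _, _ => lo
  | f + 1, D, m => ((D 0).fn (m % (D 0).len).toNat).getD
      (fill lo f (fun n => D (n + 1)) (m / (D 0).len))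

/-- Passing to the index of the block decreases absolute values. -/
theorem natAbs_lt_of_block {q r : ℕ} (hq : 2 ≤ q) (hr : r < q) {b : ℤ} (hb : ¬(b = 0 ∧ r = 0))
    (hb' : ¬(b = -1 ∧ r = q - 1)) : b.natAbs < (b * (q : ℤ) + r).natAbs := by
  have hq : (2 : ℤ) ≤ q := by exact_mod_cast hq
  rcases lt_or_ge b 0 with h | h
  · have e1 : b * (q : ℤ) + r < b := by
      have : b * (q - 1 : ℤ) ≤ -1 * (q - 1 : ℤ) :=
        mul_le_mul_of_nonneg_right (by omega) (by omega)
      rcases eq_or_ne b (-1) with h5 | h5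
      · subst h5
        have : r ≠ q - 1 := fun h => hb' ⟨rfl, h⟩
        omega
      · have : b * (q - 1 : ℤ) ≤ -2 * (q - 1 : ℤ) :=
          mul_le_mul_of_nonneg_right (by omega) (by omega)
        have : b * (q - 1 : ℤ) = b * q - b := by ring
        omega
    omega
  · have e1 : b < b * (q : ℤ) + r := by
      rcases eq_or_ne b 0 with h5 | h5
      · subst h5
        have : r ≠ 0 := fun h => hb ⟨rfl, h⟩
        omega
      · have : b * 2 ≤ b * (q : ℤ) := mul_le_mul_of_nonneg_left hq h
        omega
    omega

theorem fill_congr {lo hi : A} (f g : ℕ) (D : ℕ → Pat A) (hD : ∀ n, (D n).Good lo hi) (m : ℤ)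
    (hf : m.natAbs < f) (hg : m.natAbs < g) : fill lo f D m = fill lo g D m := by
  induction f generalizing g D m with
  | zero => omega
  | succ f ih =>
    obtain ⟨g, rfl⟩ : ∃ g', g = g' + 1 := ⟨g - 1, by omega⟩
    simp only [fill]
    have h2 := (hD 0).two_le
    have hp := (hD 0).pos
    obtain ⟨b, r, hr, rfl⟩ := exists_block_coord hp m
    have h1 : (b * ((D 0).len : ℤ) + r) % ((D 0).len : ℤ) = r := by
      rw [add_comm, Int.add_mul_emod_self_right]
      exact Int.emod_eq_of_lt (by positivity) (by exact_mod_cast hr)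
    have h3 : (b * ((D 0).len : ℤ) + r) / ((D 0).len : ℤ) = b := by
      rw [add_comm, Int.add_mul_ediv_right _ _ (by omega)]
      rw [Int.ediv_eq_zero_of_lt (by positivity) (by exact_mod_cast hr)]; simp
    rw [h1, h3]
    simp only [Int.toNat_natCast]
    by_cases hb : b = 0 ∧ r = 0
    · simp [hb.2, (hD 0).first]
    by_cases hb' : b = -1 ∧ r = (D 0).len - 1
    · simp [hb'.2, (hD 0).last]
    have hlt := natAbs_lt_of_block h2 hr hb hb'
    rw [ih g _ (fun n => hD (n + 1)) b (by omega) (by omega)]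

/-- The sequence with the iterated desubstitutions prescribed by `D`. -/
def toep (lo : A) (D : ℕ → Pat A) (m : ℤ) : A := fill lo (m.natAbs + 2) D m

theorem toep_eq {lo hi : A} {D : ℕ → Pat A} (hD : ∀ n, (D n).Good lo hi) :
    toep lo D = (D 0).sub (toep lo fun n => D (n + 1)) := by
  funext m
  rw [toep, fill, Pat.sub]
  congr 1
  have hp := (hD 0).pos
  refine fill_congr _ _ _ (fun n => hD (n + 1)) _ ?_ (by omega)
  have := Int.natAbs_ediv_le_natAbs m ((D 0).len : ℤ)
  omega

/-- The system with prescribed patterns. -/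
def Sys.ofPat {lo hi : A} (D : ℕ → Pat A) (hD : ∀ n, (D n).Good lo hi) : Sys A lo hi where
  D := D
  τ n := toep lo fun m => D (n + m)
  good := hD
  sub_eq n := by
    have := toep_eq (D := fun m => D (n + m)) fun m => hD (n + m)
    rw [this]
    simp only [add_zero]
    congr 2
    funext m
    congr 1
    ring

end Sequence

section Blocks

variable {A : Type*} [Fintype A] [DecidableEq A]

/-- The blocks of the Toeplitz sequence with letter frequencies `v`. -/
noncomputable def blk (lo hi : A) (v : A → ℝ) (n : ℕ) : Pat A :=
  mkPat lo hi (fun i => (n + 1) * stepA (vec v n) i) ((n + 1) * stepK (vec v n))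

variable {lo hi : A} {v : A → ℝ}

theorem blk_good [Nontrivial A] (hlh : lo ≠ hi) (hv : Adm v) (n : ℕ) :
    (blk lo hi v n).Good lo hi :=
  mkPat_good hlh (fun i => Nat.mul_pos n.succ_pos ((hv.vec n).one_le_stepA i))
    (Nat.mul_pos n.succ_pos (hv.vec n).stepK_pos)

theorem blk_len [Nontrivial A] (hlh : lo ≠ hi) (hv : Adm v) (n : ℕ) :
    (blk lo hi v n).len = (n + 1) * stepM (vec v n) := by
  rw [blk, mkPat_len hlh, ← Finset.mul_sum, ← mul_add, (hv.vec n).sum_stepA_add]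

theorem two_holes_blk_le [Nontrivial A] (hlh : lo ≠ hi) (hv : Adm v) (n : ℕ) :
    2 * (blk lo hi v n).holes ≤ (blk lo hi v n).len := by
  rw [blk_len hlh hv]
  have := mkPat_holes_le lo hi (fun i => (n + 1) * stepA (vec v n) i) ((n + 1) * stepK (vec v n))
  have h2 := (hv.vec n).two_stepK_le
  rw [← blk] at this
  nlinarith

theorem vec_eq_blk [Nontrivial A] (hlh : lo ≠ hi) (hv : Adm v) (n : ℕ) (i : A) :
    (blk lo hi v n).len * vec v n i = ∑ j, vec v (n + 1) j * (blk lo hi v n).cnt j i := by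
  have h := (hv.vec n).eq_step i
  have hs := (hv.vec (n + 1)).sum_one
  simp only [blk, mkPat_cnt hlh]
  rw [← blk, blk_len hlh hv]
  push_cast
  simp only [mul_add, Finset.sum_add_distrib]
  rw [← Finset.sum_mul, hs]
  simp only [mul_ite, mul_zero, Finset.sum_ite_eq', Finset.mem_univ, if_true]
  rw [mul_assoc, h, vec]
  ring

/-- The number of letters in the composition of the first `n` blocks. -/
noncomputable def scale (lo hi : A) (v : A → ℝ) (n : ℕ) : ℕ :=
  ∏ m ∈ Finset.range n, (blk lo hi v m).len

theorem scale_pos [Nontrivial A] (hlh : lo ≠ hi) (hv : Adm v) (n : ℕ) : 0 < scale lo hi v n :=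
  Finset.prod_pos fun m _ => (blk_good hlh hv m).pos

/-- The measures of the cylinders of level `n`. -/
noncomputable def cyl (lo hi : A) (v : A → ℝ) (n : ℕ) (i : A) : ℝ := vec v n i / scale lo hi v n

theorem cyl_zero (i : A) : cyl lo hi v 0 i = v i := by simp [cyl, scale, vec]

theorem cyl_pos [Nontrivial A] (hlh : lo ≠ hi) (hv : Adm v) (n : ℕ) (i : A) :
    0 < cyl lo hi v n i :=
  div_pos ((hv.vec n).pos i) (by exact_mod_cast scale_pos hlh hv n)

theorem cyl_eq [Nontrivial A] (hlh : lo ≠ hi) (hv : Adm v) (n : ℕ) (i : A) :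
    cyl lo hi v n i = ∑ j, cyl lo hi v (n + 1) j * (blk lo hi v n).cnt j i := by
  have h1 : (scale lo hi v n : ℝ) ≠ 0 := by have := scale_pos hlh hv n; positivity
  have h2 : ((blk lo hi v n).len : ℝ) ≠ 0 := by have := (blk_good hlh hv n).pos; positivity
  have h := vec_eq_blk hlh hv n i
  have e : ∀ j, cyl lo hi v (n + 1) j * (blk lo hi v n).cnt j i
      = vec v (n + 1) j * (blk lo hi v n).cnt j i / (scale lo hi v n * (blk lo hi v n).len) := by
    intro j
    rw [cyl, scale, Finset.prod_range_succ, ← scale]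
    push_cast
    ring
  simp only [e]
  rw [← Finset.sum_div, ← h, cyl]
  field_simp

theorem cyl_indep [Nontrivial A] (hlh : lo ≠ hi) (hv : Adm v) (n : ℕ) :
    LinearIndependent ℚ (cyl lo hi v n) := by
  have h1 : (scale lo hi v n : ℝ) ≠ 0 := by have := scale_pos hlh hv n; positivity
  rw [Fintype.linearIndependent_iff]
  intro c hc
  refine Fintype.linearIndependent_iff.1 (hv.vec n).indep c ?_
  have : ∑ i, c i • vec v n i = scale lo hi v n * ∑ i, c i • cyl lo hi v n i := by
    rw [Finset.mul_sum]
    refine Finset.sum_congr rfl fun i _ => ?_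
    simp only [Rat.smul_def, cyl]
    field_simp
  rw [this, hc, mul_zero]

theorem stepV_mem_span (hv : Adm v) (i : A) :
    stepV v i ∈ Submodule.span ℚ (Set.range v) := by
  have h1 : ∀ j, v j ∈ Submodule.span ℚ (Set.range v) :=
    fun j => Submodule.subset_span ⟨j, rfl⟩
  have : stepV v i = ((stepK v : ℚ)⁻¹) • ((stepM v : ℚ) • v i - (stepA v i : ℚ) • ∑ j, v j) := by
    rw [hv.sum_one, stepV]
    simp only [Rat.smul_def]
    push_cast
    rw [mul_one]
    ring
  rw [this]
  exact Submodule.smul_mem _ _ (Submodule.sub_mem _ (Submodule.smul_mem _ _ (h1 i))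
    (Submodule.smul_mem _ _ (Submodule.sum_mem _ fun j _ => h1 j)))

theorem vec_mem_span [Nontrivial A] (hv : Adm v) (n : ℕ) (i : A) :
    vec v n i ∈ Submodule.span ℚ (Set.range v) := by
  induction n generalizing i with
  | zero => exact Submodule.subset_span ⟨i, rfl⟩
  | succ n ih =>
    refine Submodule.span_le.2 ?_ (stepV_mem_span (hv.vec n) i)
    rintro _ ⟨j, rfl⟩
    exact ih j

theorem cyl_mem_span [Nontrivial A] (hv : Adm v) (n : ℕ) (i : A) :
    cyl lo hi v n i ∈ Submodule.span ℚ (Set.range v) := by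
  have : cyl lo hi v n i = ((scale lo hi v n : ℚ)⁻¹) • vec v n i := by
    rw [cyl, Rat.smul_def]; push_cast; ring
  rw [this]
  exact Submodule.smul_mem _ _ (vec_mem_span hv n i)

/-- Coordinates with respect to the cylinder measures of level `n`. -/
noncomputable def coord (lo hi : A) (v : A → ℝ) (x : A → ℚ) : ℕ → A → ℚ
  | 0 => x
  | n + 1 => fun j => ∑ i, (blk lo hi v n).cnt j i * coord lo hi v x n i

theorem sum_cyl_coord [Nontrivial A] (hlh : lo ≠ hi) (hv : Adm v) (x : A → ℚ) (n : ℕ) :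
    ∑ i, cyl lo hi v n i * coord lo hi v x n i = ∑ i, v i * x i := by
  induction n with
  | zero => simp only [cyl_zero, coord]
  | succ n ih =>
    rw [← ih]
    simp only [cyl_eq hlh hv n, coord]
    push_cast
    simp only [Finset.sum_mul, Finset.mul_sum]
    rw [Finset.sum_comm]
    refine Finset.sum_congr rfl fun l _ => Finset.sum_congr rfl fun j _ => ?_
    ring

theorem coord_succ (hlh : lo ≠ hi) (x : A → ℚ) (n : ℕ) (j : A) :
    coord lo hi v x (n + 1) j = (n + 1) * (∑ i, stepA (vec v n) i * coord lo hi v x n i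
      + stepK (vec v n) * coord lo hi v x n j) := by
  simp only [coord, blk, mkPat_cnt hlh]
  push_cast
  rw [Finset.sum_congr rfl fun i _ => add_mul _ _ _, Finset.sum_add_distrib, mul_add,
    Finset.mul_sum]
  simp only [ite_mul, zero_mul, Finset.sum_ite_eq, Finset.mem_univ, if_true, mul_assoc]

theorem coord_integral (hlh : lo ≠ hi) {x : A → ℚ} {N : ℕ} (hx : ∀ i, ∃ z : ℤ, N * x i = z)
    (n : ℕ) (i : A) : ∃ z : ℤ, N * coord lo hi v x n i = n.factorial * z := by
  induction n generalizing i with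
  | zero => simpa [coord] using hx i
  | succ n ih =>
    choose z hz using ih
    refine ⟨∑ j, stepA (vec v n) j * z j + stepK (vec v n) * z i, ?_⟩
    rw [coord_succ hlh, Nat.factorial_succ]
    push_cast
    have : (N : ℚ) * ((n + 1) * (∑ j, stepA (vec v n) j * coord lo hi v x n j
        + stepK (vec v n) * coord lo hi v x n i))
        = (n + 1) * (∑ j, stepA (vec v n) j * (N * coord lo hi v x n j)
        + stepK (vec v n) * (N * coord lo hi v x n i)) := by
      simp only [mul_add, Finset.mul_sum]
      congr 1
      · exact Finset.sum_congr rfl fun j _ => by ring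
      · ring
    rw [this]
    simp only [hz]
    simp only [mul_add, Finset.mul_sum]
    congr 1
    · exact Finset.sum_congr rfl fun j _ => by ring
    · ring

theorem coord_sub_le [Nontrivial A] (hlh : lo ≠ hi) (hv : Adm v) {x : A → ℚ} {B : ℚ}
    (hB : ∀ i j, x i - x j ≤ B) (n : ℕ) (i j : A) :
    2 ^ n * (coord lo hi v x n i - coord lo hi v x n j) ≤ scale lo hi v n * B := by
  have hB0 : 0 ≤ B := by simpa using hB i i
  induction n with
  | zero => simpa [coord, scale] using hB i j
  | succ n ih =>
    rw [coord_succ hlh, coord_succ hlh, scale, Finset.prod_range_succ, ← scale, blk_len hlh hv]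
    have h2 : (2 * stepK (vec v n) : ℚ) ≤ stepM (vec v n) := by
      exact_mod_cast (hv.vec n).two_stepK_le
    push_cast
    have h3 : (0 : ℚ) ≤ scale lo hi v n * B := by positivity
    calc _ = (n + 1) * (2 * stepK (vec v n)) *
          (2 ^ n * (coord lo hi v x n i - coord lo hi v x n j)) := by rw [pow_succ]; ring
      _ ≤ (n + 1) * (2 * stepK (vec v n)) * (scale lo hi v n * B) :=
          mul_le_mul_of_nonneg_left ih (by positivity)
      _ ≤ (n + 1) * (stepM (vec v n)) * (scale lo hi v n * B) := by gcongr
      _ = _ := by ring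

/-- Positive elements of the group of measures are eventually positive combinations of the
cylinder measures. -/
theorem exists_nat_coord [Nontrivial A] (hlh : lo ≠ hi) (hv : Adm v) {g : ℝ} (hg : 0 < g)
    (hgv : g ∈ Submodule.span ℚ (Set.range v)) :
    ∃ n₀, ∀ n, n₀ ≤ n → ∃ E : A → ℕ, (∀ i, 0 < E i) ∧ g = ∑ i, cyl lo hi v n i * E i := by
  obtain ⟨x, rfl⟩ := (Submodule.mem_span_range_iff_exists_fun ℚ).1 hgv
  have hsum : ∑ i, x i • v i = ∑ i, v i * x i :=
    Finset.sum_congr rfl fun i _ => by rw [Rat.smul_def, mul_comm]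
  rw [hsum] at hg ⊢
  set g := ∑ i, v i * (x i : ℝ) with hgdef
  let N : ℕ := ∏ i, (x i).den
  have hN : 0 < N := Finset.prod_pos fun i _ => (x i).den_pos
  have hx : ∀ i, ∃ z : ℤ, N * x i = z := by
    intro i
    obtain ⟨c, hc⟩ := Finset.dvd_prod_of_mem (fun i => (x i).den) (Finset.mem_univ i)
    refine ⟨c * (x i).num, ?_⟩
    have : (N : ℚ) = (x i).den * c := by exact_mod_cast hc
    rw [this]
    push_cast
    rw [← Rat.mul_den_eq_num (x i)]
    ring
  obtain ⟨B, hB⟩ : ∃ B : ℚ, ∀ i j, x i - x j ≤ B := by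
    obtain ⟨B, hB⟩ := (Set.finite_range fun p : A × A => x p.1 - x p.2).bddAbove
    exact ⟨B, fun i j => hB ⟨(i, j), rfl⟩⟩
  obtain ⟨n₁, hn₁⟩ := pow_unbounded_of_one_lt ((B : ℝ) / g) (one_lt_two)
  refine ⟨max N n₁, fun n hn => ?_⟩
  have hs := scale_pos hlh hv n
  have hsR : (0 : ℝ) < scale lo hi v n := by exact_mod_cast hs
  have hpos : ∀ j, 0 < coord lo hi v x n j := by
    intro j
    have h1 : ∀ i, (2 : ℝ) ^ n * (coord lo hi v x n i - coord lo hi v x n j)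
        ≤ scale lo hi v n * B := fun i => by exact_mod_cast coord_sub_le hlh hv hB n i j
    have h2 : (B : ℝ) < 2 ^ n * g := by
      have : (2 : ℝ) ^ n₁ ≤ 2 ^ n := pow_le_pow_right₀ one_le_two (le_of_max_le_right hn)
      rw [div_lt_iff₀ hg] at hn₁
      nlinarith
    have h3 : (2 : ℝ) ^ n * ∑ i, vec v n i * (coord lo hi v x n i - coord lo hi v x n j)
        ≤ scale lo hi v n * B := by
      rw [Finset.mul_sum]
      calc _ ≤ ∑ i, vec v n i * (scale lo hi v n * B) := Finset.sum_le_sum fun i _ => by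
            have := mul_le_mul_of_nonneg_left (h1 i) ((hv.vec n).pos i).le
            linarith
        _ = _ := by rw [← Finset.sum_mul, (hv.vec n).sum_one, one_mul]
    have h4 : ∑ i, vec v n i * (coord lo hi v x n i - coord lo hi v x n j)
        = scale lo hi v n * g - coord lo hi v x n j := by
      simp only [mul_sub, Finset.sum_sub_distrib]
      rw [← Finset.sum_mul, (hv.vec n).sum_one, one_mul, hgdef, ← sum_cyl_coord hlh hv x n,
        Finset.mul_sum]
      congr 1
      refine Finset.sum_congr rfl fun i _ => ?_
      rw [cyl]; field_simp
    rw [h4] at h3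
    have h5 : (0 : ℝ) < 2 ^ n * coord lo hi v x n j := by
      have := mul_lt_mul_of_pos_left h2 hsR
      nlinarith
    have h6 : (0 : ℝ) < coord lo hi v x n j := pos_of_mul_pos_right h5 (by positivity)
    exact_mod_cast h6
  have hint : ∀ j, ∃ e : ℕ, coord lo hi v x n j = e := by
    intro j
    obtain ⟨z, hz⟩ := coord_integral (v := v) hlh hx n j
    obtain ⟨c, hc⟩ := Nat.dvd_factorial hN (le_of_max_le_left hn)
    have hNq : (N : ℚ) ≠ 0 := by exact_mod_cast hN.ne'
    have h1 : coord lo hi v x n j = ((c * z : ℤ) : ℚ) := by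
      have : (n.factorial : ℚ) = N * c := by exact_mod_cast hc
      rw [this, mul_assoc] at hz
      rw [mul_left_cancel₀ hNq hz]
      push_cast; rfl
    have h2 : (0 : ℤ) ≤ c * z := by
      have := hpos j
      rw [h1] at this
      exact_mod_cast this.le
    obtain ⟨e, he⟩ := Int.eq_ofNat_of_zero_le h2
    exact ⟨e, by rw [h1, he]; simp⟩
  choose e he using hint
  refine ⟨e, fun i => ?_, ?_⟩
  · have := hpos i
    rw [he] at this
    exact_mod_cast this
  · rw [hgdef, ← sum_cyl_coord hlh hv x n]
    refine Finset.sum_congr rfl fun i _ => ?_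
    rw [he]; simp

/-- The Toeplitz system with letter frequencies `v`. -/
noncomputable def tsys [Nontrivial A] (hlh : lo ≠ hi) (hv : Adm v) : Sys A lo hi :=
  Sys.ofPat (blk lo hi v) (blk_good hlh hv)

variable [TopologicalSpace A] [DiscreteTopology A]

theorem orbitEquivalent_tsys [Nontrivial A] (hlh : lo ≠ hi) {w : A → ℝ} (hv : Adm v) (hw : Adm w)
    (h : Submodule.span ℚ (Set.range v) = Submodule.span ℚ (Set.range w)) :
    SubshiftOrbitEquivalent ((tsys hlh hv).X 0) ((tsys hlh hw).X 0) := by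
  have key : ∀ {v w : A → ℝ} (hv : Adm v) (hw : Adm w)
      (h : Submodule.span ℚ (Set.range v) = Submodule.span ℚ (Set.range w)) (n M : ℕ),
      ∃ m, M ≤ m ∧ ∃ E : A → A → ℕ, (∀ j i, 0 < E j i) ∧
      ∀ i, cyl lo hi v n i = ∑ j, cyl lo hi w m j * E j i := by
    intro v w hv hw h n M
    choose n₀ hn₀ using fun i => exists_nat_coord (lo := lo) (hi := hi) hlh hw
      (cyl_pos hlh hv n i) (h ▸ cyl_mem_span hv n i)
    have hle : ∀ i, n₀ i ≤ max M (∑ i, n₀ i) := fun i =>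
      le_max_of_le_right (Finset.single_le_sum (fun j _ => Nat.zero_le _) (Finset.mem_univ i))
    choose E hE1 hE2 using fun i => hn₀ i _ (hle i)
    exact ⟨_, le_max_left _ _, fun j i => E i j, fun j i => hE1 i j, hE2⟩
  refine orbitEquivalent_of_vectors hlh (tsys hlh hv) (tsys hlh hw) (u := cyl lo hi v)
    (w := cyl lo hi w) (cyl_eq hlh hv) (cyl_eq hlh hw) (cyl_indep hlh hv) (cyl_indep hlh hw) ?_
    (key hv hw h) (key hw hv h.symm)
  simp only [cyl_zero, hv.sum_one, hw.sum_one]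

end Blocks

section InvariantMeasures

open Filter BoundedContinuousFunction in
/-- The Krylov–Bogoliubov theorem. -/
theorem exists_invariant_probabilityMeasure {X : Type*} [TopologicalSpace X] [CompactSpace X]
    [MetrizableSpace X] [MeasurableSpace X] [BorelSpace X] [Nonempty X] {φ : X → X}
    (hφ : Continuous φ) : ∃ μ : Measure X, IsProbabilityMeasure μ ∧ μ.map φ = μ := by
  let x : X := Classical.arbitrary X
  let P : ℕ → Measure X := fun n =>
    ((n + 1 : ℕ) : ENNReal)⁻¹ • ∑ k ∈ Finset.range (n + 1), Measure.dirac (φ^[k] x)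
  have hP : ∀ n, IsProbabilityMeasure (P n) := fun n => ⟨by
    simp only [P, Measure.smul_apply, Measure.finsetSum_apply, measure_univ, Finset.sum_const,
      Finset.card_range, smul_eq_mul, nsmul_eq_mul, mul_one]
    exact ENNReal.inv_mul_cancel (by simp) (by simp)⟩
  have hint : ∀ (f : X →ᵇ ℝ) n, ∫ y, f y ∂(P n)
      = (n + 1 : ℝ)⁻¹ * ∑ k ∈ Finset.range (n + 1), f (φ^[k] x) := by
    intro f n
    simp only [P]
    rw [integral_smul_measure, integral_finsetSum_measure fun i _ => f.integrable _]
    simp only [integral_dirac, ENNReal.toReal_inv, ENNReal.toReal_natCast, smul_eq_mul]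
    push_cast; rfl
  let Q : ℕ → ProbabilityMeasure X := fun n => ⟨P n, hP n⟩
  obtain ⟨μ, -, hμ⟩ := isCompact_univ.ultrafilter_le_nhds ((hyperfilter ℕ).map Q)
    (by simp)
  have hlim : ∀ f : X →ᵇ ℝ, Tendsto (fun n => ∫ y, f y ∂(P n)) (hyperfilter ℕ)
      (𝓝 (∫ y, f y ∂(μ : Measure X))) :=
    (ProbabilityMeasure.tendsto_iff_forall_integral_tendsto (μs := Q)).1 hμ
  refine ⟨μ, inferInstance, ?_⟩
  have : IsProbabilityMeasure ((μ : Measure X).map φ) :=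
    Measure.isProbabilityMeasure_map hφ.measurable.aemeasurable
  refine ext_of_forall_integral_eq_of_IsFiniteMeasure fun f => ?_
  rw [integral_map hφ.measurable.aemeasurable f.continuous.aestronglyMeasurable]
  let g : X →ᵇ ℝ := f.compContinuous ⟨φ, hφ⟩
  have h1 := (hlim g).sub (hlim f)
  have h2 : Tendsto (fun n => ∫ y, g y ∂(P n) - ∫ y, f y ∂(P n)) atTop (𝓝 0) := by
    have h3 : ∀ n, ∫ y, g y ∂(P n) - ∫ y, f y ∂(P n)
        = (n + 1 : ℝ)⁻¹ * (f (φ^[n + 1] x) - f x) := by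
      intro n
      rw [hint, hint, ← mul_sub, ← Finset.sum_sub_distrib]
      congr 1
      have : ∀ k, g (φ^[k] x) = f (φ^[k + 1] x) := fun k => by
        rw [Function.iterate_succ_apply']; rfl
      simp only [this]
      rw [Finset.sum_range_sub (fun k => f (φ^[k] x))]
      rfl
    simp only [h3]
    refine squeeze_zero_norm (a := fun n : ℕ => (n + 1 : ℝ)⁻¹ * (2 * ‖f‖)) (fun n => ?_) ?_
    · rw [norm_mul]
      refine mul_le_mul ?_ ?_ (norm_nonneg _) (by positivity)
      · rw [Real.norm_of_nonneg (by positivity)]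
      · calc _ ≤ ‖f (φ^[n + 1] x)‖ + ‖f x‖ := norm_sub_le _ _
          _ ≤ ‖f‖ + ‖f‖ := add_le_add (f.norm_coe_le_norm _) (f.norm_coe_le_norm _)
          _ = _ := by ring
    · have := tendsto_one_div_add_atTop_nhds_zero_nat (𝕜 := ℝ)
      simpa using this.mul_const (2 * ‖f‖)
  have h4 := tendsto_nhds_unique h1 (h2.mono_left Nat.hyperfilter_le_atTop)
  exact sub_eq_zero.1 h4

/-- An invertible map that moves points within the orbits of countably many measure preserving
maps is measure preserving. -/
theorem map_eq_of_piecewise {X : Type*} [MeasurableSpace X] {μ : Measure X} (g : ℕ → X ≃ᵐ X)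
    (hg : ∀ n, μ.map (g n) = μ) (h : X ≃ᵐ X) (hh : ∀ x, ∃ n, h x = g n x)
    (hm : ∀ n, MeasurableSet {x | h x = g n x}) : μ.map h = μ := by
  let C : ℕ → Set X := fun n => {x | h x = g n x}
  have hD : ∀ n, MeasurableSet (disjointed C n) := fun n => MeasurableSet.disjointed hm n
  have hU : ⋃ n, disjointed C n = Set.univ := by
    rw [iUnion_disjointed]
    exact Set.eq_univ_of_forall fun x => Set.mem_iUnion.2 (hh x)
  have hC : ∀ n x, x ∈ disjointed C n → h x = g n x := fun n x hx => disjointed_subset C n hx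
  ext E hE
  rw [h.map_apply]
  have hE' : MeasurableSet (h ⁻¹' E) := h.measurable hE
  have e1 : h ⁻¹' E = ⋃ n, (h ⁻¹' E ∩ disjointed C n) := by
    rw [← Set.inter_iUnion, hU, Set.inter_univ]
  have e2 : E = ⋃ n, (E ∩ h.symm ⁻¹' disjointed C n) := by
    rw [← Set.inter_iUnion, ← Set.preimage_iUnion, hU, Set.preimage_univ, Set.inter_univ]
  rw [e1, measure_iUnion (fun i j hij => ((disjoint_disjointed C) hij).mono Set.inter_subset_right
    Set.inter_subset_right) fun n => hE'.inter (hD n)]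
  conv_rhs => rw [e2]
  rw [measure_iUnion (fun i j hij => (((disjoint_disjointed C) hij).preimage h.symm).mono
    Set.inter_subset_right Set.inter_subset_right)
    fun n => hE.inter (h.symm.measurable (hD n))]
  refine tsum_congr fun n => ?_
  conv_rhs => rw [← hg n]
  rw [(g n).map_apply]
  congr 1
  ext x
  simp only [Set.mem_inter_iff, Set.mem_preimage]
  constructor
  · rintro ⟨h1, h2⟩
    rw [← hC n x h2]
    exact ⟨h1, by simpa using h2⟩
  · rintro ⟨h1, h2⟩
    have h3 := hC n _ h2
    rw [h.apply_symm_apply] at h3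
    have h4 : x = h.symm (g n x) := (g n).injective h3
    rw [← h4] at h2
    exact ⟨by rw [hC n x h2]; exact h1, h2⟩

end InvariantMeasures

section Frequencies

variable {A : Type*} [MeasurableSpace A]

/-- Translation invariant probability measures concentrated on `X`. -/
structure InvOn (X : Set (ℤ → A)) (μ : Measure (ℤ → A)) : Prop where
  prob : IsProbabilityMeasure μ
  inv : μ.map (tr 1) = μ
  null : μ Xᶜ = 0

theorem measurable_tr (j : ℤ) : Measurable (tr j : (ℤ → A) → (ℤ → A)) :=
  measurable_pi_lambda _ fun m => measurable_pi_apply (m + j)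

/-- Translation by `j` as an automorphism of the measurable space of sequences. -/
def trEquiv (j : ℤ) : (ℤ → A) ≃ᵐ (ℤ → A) where
  toFun := tr j
  invFun := tr (-j)
  left_inv y := by simp
  right_inv y := by simp
  measurable_toFun := measurable_tr j
  measurable_invFun := measurable_tr (-j)

theorem InvOn.map_tr {X : Set (ℤ → A)} {μ : Measure (ℤ → A)} (h : InvOn X μ) (j : ℤ) :
    μ.map (tr j) = μ := by
  have hn : ∀ n : ℕ, μ.map (tr n) = μ := by
    intro n
    induction n with
    | zero => 
      have : (tr ((0 : ℕ) : ℤ) : (ℤ → A) → (ℤ → A)) = id := funext fun y => by simp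
      rw [this, Measure.map_id]
    | succ n ih =>
      have : (tr ((n + 1 : ℕ) : ℤ) : (ℤ → A) → (ℤ → A)) = tr n ∘ tr 1 := funext fun y => by simp
      rw [this, ← Measure.map_map (measurable_tr _) (measurable_tr _), h.inv, ih]
  obtain ⟨n, rfl | rfl⟩ := j.eq_nat_or_neg
  · exact hn n
  · have : μ = (μ.map (tr n)).map (tr (-n)) := by
      rw [Measure.map_map (measurable_tr _) (measurable_tr _)]
      have : (tr (-n : ℤ) ∘ tr n : (ℤ → A) → (ℤ → A)) = id := funext fun y => by simp
      rw [this, Measure.map_id]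
    conv_rhs => rw [this, hn n]

theorem InvOn.preimage_tr {X : Set (ℤ → A)} {μ : Measure (ℤ → A)} (h : InvOn X μ) (j : ℤ)
    (E : Set (ℤ → A)) : μ (tr j ⁻¹' E) = μ E := by
  conv_rhs => rw [← h.map_tr j]
  exact ((trEquiv j).map_apply E).symm

theorem InvOn.image_tr {X : Set (ℤ → A)} {μ : Measure (ℤ → A)} (h : InvOn X μ) (j : ℤ)
    (E : Set (ℤ → A)) : μ (tr j '' E) = μ E := by
  rw [← h.preimage_tr j]
  exact congrArg μ (Set.preimage_image_eq E (trEquiv j).injective)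

variable {lo hi : A} [TopologicalSpace A] [DiscreteTopology A] [Finite A] [BorelSpace A]

theorem Pat.Good.measurableEmbedding_sub {c : Pat A} (hc : c.Good lo hi) :
    MeasurableEmbedding c.sub :=
  (c.continuous_sub.isClosedEmbedding fun y z h => 
    (hc.recog y z 0 hc.pos (by simpa using h)).2).measurableEmbedding

/-- Invariant measures desubstitute. -/
theorem InvOn.desub {S : Sys A lo hi} {n : ℕ} {μ : Measure (ℤ → A)} (h : InvOn (S.X n) μ) :
    ∃ ν : Measure (ℤ → A), InvOn (S.X (n + 1)) ν ∧ ∀ E, MeasurableSet E →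
      μ.real E = ∑ r : Fin (S.D n).len,
        ν.real ((fun y => tr r ((S.D n).sub y)) ⁻¹' E) / (S.D n).len := by
  have hprob := h.prob
  set c := S.D n with hc
  have hg := S.good n
  rw [← hc] at hg
  have hp := hg.pos
  have hemb := hg.measurableEmbedding_sub
  let ρ : Measure (ℤ → A) := μ.comap c.sub
  have hρ : ∀ B, ρ B = μ (c.sub '' B) := fun B => hemb.comap_apply _ _
  have key : ∀ E, MeasurableSet E → μ E = ∑ r : Fin c.len, ρ ((fun y => tr r (c.sub y)) ⁻¹' E) := by
    intro E hE
    let F : Fin c.len → Set (ℤ → A) := fun r =>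
      tr r '' (c.sub '' ((fun y => tr r (c.sub y)) ⁻¹' E))
    have hF : ∀ r, μ (F r) = ρ ((fun y => tr r (c.sub y)) ⁻¹' E) := fun r => by
      rw [h.image_tr, hρ]
    simp only [← hF]
    rw [← measure_biUnion_finset]
    · apply measure_congr
      have : ∀ᵐ y ∂μ, y ∈ S.X n := h.null
      filter_upwards [this] with y hy
      refine propext ⟨fun hyE => ?_, fun hyF => ?_⟩
      · obtain ⟨r, hr, y', -, rfl⟩ := S.exists_desub hy
        exact Set.mem_biUnion (Finset.mem_univ (⟨r, hr⟩ : Fin c.len))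
          ⟨_, ⟨y', hyE, rfl⟩, rfl⟩
      · obtain ⟨r, -, h2⟩ := Set.mem_iUnion₂.1 hyF
        obtain ⟨_, ⟨y', hy', rfl⟩, rfl⟩ := h2
        exact hy'
    · intro r _ s _ hrs
      refine Set.disjoint_left.2 ?_
      rintro _ ⟨_, ⟨y, -, rfl⟩, rfl⟩ ⟨_, ⟨z, -, rfl⟩, e⟩
      apply hrs
      have e' : c.sub z = tr (r - s) (c.sub y) := by
        have := congrArg (tr (-(s : ℤ))) e
        simpa [neg_add_eq_sub] using this
      have e'' : c.sub y = tr (s - r) (c.sub z) := by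
        rw [e']; simp
      rcases le_total s r with hle | hle
      · have := (hg.recog z y (r - s) (by omega) (by rw [e']; congr 1; exact (Nat.cast_sub hle).symm)).1
        ext; have : (s : ℕ) ≤ r := hle; omega
      · have := (hg.recog y z (s - r) (by omega) (by rw [e'']; congr 1; exact (Nat.cast_sub hle).symm)).1
        ext; have : (r : ℕ) ≤ s := hle; omega
    · intro r _
      exact (trEquiv (r : ℤ)).measurableEmbedding.measurableSet_image' (hemb.measurableSet_image' 
        ((measurable_tr r).comp c.continuous_sub.measurable hE))
  have htot : (c.len : ENNReal) * ρ Set.univ = 1 := by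
    have := key Set.univ MeasurableSet.univ
    simpa using this.symm
  have hinv : ∀ B, ρ (tr 1 ⁻¹' B) = ρ B := by
    intro B
    rw [hρ, hρ, ← h.preimage_tr (-c.len)]
    congr 1
    ext y
    constructor
    · rintro ⟨z, hz, e⟩
      exact ⟨tr 1 z, hz, by rw [Pat.sub_tr _ hp, e]; simp⟩
    · rintro ⟨z, hz, rfl⟩
      refine ⟨tr (-1) z, by simpa using hz, ?_⟩
      rw [Pat.sub_tr _ hp]; simp
  have hnull : ρ (S.X (n + 1))ᶜ = 0 := by
    rw [hρ]
    refine measure_mono_null ?_ h.null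
    rintro _ ⟨y, hy, rfl⟩ hy'
    obtain ⟨r, hr, y', hy'', e⟩ := S.exists_desub hy'
    exact hy ((hg.recog _ _ r hr e).2 ▸ hy'')
  have hq : (c.len : ENNReal) ≠ 0 := by simpa using hp.ne'
  refine ⟨(c.len : ENNReal) • ρ, ⟨⟨by simpa using htot⟩, ?_, by simp [hnull]⟩, fun E hE => ?_⟩
  · ext B hB
    rw [Measure.map_apply (measurable_tr 1) hB]
    simp [hinv]
  · have hfin : ∀ B, ρ B ≠ ⊤ := fun B hB => by
      have : ρ Set.univ = ⊤ := top_le_iff.1 (hB ▸ measure_mono (Set.subset_univ B))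
      rw [this, ENNReal.mul_top hq] at htot
      simp at htot
    have hpR : (c.len : ℝ) ≠ 0 := by exact_mod_cast hp.ne'
    simp only [measureReal_def]
    rw [key E hE, ENNReal.toReal_sum fun r _ => hfin _]
    refine Finset.sum_congr rfl fun r _ => ?_
    simp only [Measure.smul_apply, smul_eq_mul, ENNReal.toReal_mul, ENNReal.toReal_natCast]
    field_simp

end Frequencies

section Values

variable {A : Type*} [Fintype A] [DecidableEq A] [Nontrivial A] {lo hi : A} {v : A → ℝ}
  [MeasurableSpace A] [TopologicalSpace A] [DiscreteTopology A] [BorelSpace A]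

theorem measurableSet_letter (I : Set A) : MeasurableSet {y : ℤ → A | y 0 ∈ I} :=
  measurable_pi_apply (0 : ℤ) (isOpen_discrete I).measurableSet

theorem InvOn.real_letters {X : Set (ℤ → A)} {μ : Measure (ℤ → A)} (h : InvOn X μ) (I : Set A)
    [DecidablePred (· ∈ I)] :
    μ.real {y | y 0 ∈ I} = ∑ i, if i ∈ I then μ.real {y | y 0 = i} else 0 := by
  have := h.prob
  have e : {y : ℤ → A | y 0 ∈ I} = ⋃ i ∈ Finset.univ.filter (· ∈ I), {y | y 0 = i} := by
    ext y; simp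
  rw [e, measureReal_biUnion_finset, Finset.sum_filter]
  · intro i _ j _ hij
    exact Set.disjoint_left.2 fun y hy hy' => hij (hy.symm.trans hy')
  · exact fun i _ => measurableSet_letter {i}

theorem InvOn.letter_step (hlh : lo ≠ hi) (hv : Adm v) {n : ℕ} {μ ν : Measure (ℤ → A)}
    (hν : InvOn ((tsys hlh hv).X (n + 1)) ν)
    (hμν : ∀ E, MeasurableSet E → μ.real E = ∑ r : Fin (blk lo hi v n).len,
        ν.real ((fun y => tr r ((blk lo hi v n).sub y)) ⁻¹' E) / (blk lo hi v n).len) (i : A) :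
    (blk lo hi v n).len * μ.real {y | y 0 = i}
      = ∑ j, ν.real {y | y 0 = j} * (blk lo hi v n).cnt j i := by
  have hp : ((blk lo hi v n).len : ℝ) ≠ 0 := by
    exact_mod_cast (blk_good (lo := lo) (hi := hi) hlh hv n).pos.ne'
  rw [hμν {y | y 0 = i} (measurableSet_letter {i}), ← Finset.sum_div, mul_div_cancel₀ _ hp]
  simp only [Pat.cnt_eq_sum]
  push_cast
  simp only [Finset.mul_sum]
  rw [Finset.sum_comm]
  refine Finset.sum_congr rfl fun r _ => ?_
  have : (fun y : ℤ → A => tr r ((blk lo hi v n).sub y)) ⁻¹' {y | y 0 = i}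
      = {y | y 0 ∈ {j | ((blk lo hi v n).fn r).getD j = i}} := by
    ext y
    have := (blk lo hi v n).sub_apply y 0 r.2
    simp only [zero_mul, zero_add] at this
    simp [tr, this]
  rw [this, hν.real_letters]
  refine Finset.sum_congr rfl fun j _ => ?_
  by_cases hj : ((blk lo hi v n).fn r).getD j = i <;> simp [hj]

/-- The letter frequencies of `tsys` are the entries of `vec`. -/
theorem InvOn.real_letter (hlh : lo ≠ hi) (hv : Adm v) {n : ℕ} {μ : Measure (ℤ → A)}
    (hμ : InvOn ((tsys hlh hv).X n) μ) (i : A) : μ.real {y | y 0 = i} = vec v n i := by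
  have main : ∀ m n (μ : Measure (ℤ → A)), InvOn ((tsys hlh hv).X n) μ →
      2 ^ m * |μ.real {y | y 0 = i} - vec v n i| ≤ 1 := by
    intro m
    induction m with
    | zero =>
      intro n μ hμ
      have := hμ.prob
      have h1 : μ.real {y | y 0 = i} ≤ 1 := measureReal_le_one
      have h2 : 0 ≤ μ.real {y | y 0 = i} := measureReal_nonneg
      have h3 := (hv.vec n).pos i
      have h4 : vec v n i ≤ 1 := by
        rw [← (hv.vec n).sum_one]
        exact Finset.single_le_sum (fun j _ => ((hv.vec n).pos j).le) (Finset.mem_univ i)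
      rw [pow_zero, one_mul, abs_le]
      constructor <;> linarith
    | succ m ih =>
      intro n μ hμ
      obtain ⟨ν, hν, hμν⟩ := hμ.desub
      have hstep := hν.letter_step hlh hv hμν i
      have hvec := vec_eq_blk (lo := lo) (hi := hi) hlh hv n i
      have := hν.prob
      have hsν : ∑ j, ν.real {y | y 0 = j} = 1 := by
        have := hν.real_letters Set.univ
        simpa using this.symm
      have hsv := (hv.vec (n + 1)).sum_one
      set q := (blk lo hi v n).len with hq
      have hcnt : ∀ b : A → ℝ, ∑ j, b j = 1 → ∑ j, b j * (blk lo hi v n).cnt j i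
          = (n + 1) * stepA (vec v n) i + ((n + 1) * stepK (vec v n)) * b i := by
        intro b hb
        simp only [blk, mkPat_cnt hlh]
        push_cast
        simp only [mul_add, Finset.sum_add_distrib, ← Finset.sum_mul, hb]
        simp only [mul_ite, mul_zero, Finset.sum_ite_eq', Finset.mem_univ, if_true]
        ring
      rw [hcnt _ hsν] at hstep
      rw [hcnt _ hsv] at hvec
      have h5 : (q : ℝ) * (μ.real {y | y 0 = i} - vec v n i)
          = ((n + 1) * stepK (vec v n)) * (ν.real {y | y 0 = i} - vec v (n + 1) i) := by
        rw [mul_sub, hstep, hvec]; ring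
      have hk : ((n + 1) * (2 * stepK (vec v n)) : ℝ) ≤ q := by
        rw [hq, blk_len hlh hv]
        push_cast
        have : (2 * stepK (vec v n) : ℝ) ≤ stepM (vec v n) := by
          exact_mod_cast (hv.vec n).two_stepK_le
        gcongr
      have hqp : (0 : ℝ) < q := by exact_mod_cast (blk_good (lo := lo) (hi := hi) hlh hv n).pos
      have h6 := congrArg abs h5
      rw [abs_mul, abs_mul, abs_of_pos hqp,
        abs_of_nonneg (show (0 : ℝ) ≤ (n + 1) * stepK (vec v n) by positivity)] at h6
      have h7 := ih (n + 1) ν hν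
      have h8 : (q : ℝ) * (2 ^ (m + 1) * |μ.real {y | y 0 = i} - vec v n i|) ≤ q * 1 := by
        calc _ = 2 ^ (m + 1) * (q * |μ.real {y | y 0 = i} - vec v n i|) := by ring
          _ = ((n + 1) * (2 * stepK (vec v n))) *
              (2 ^ m * |ν.real {y | y 0 = i} - vec v (n + 1) i|) := by
            rw [h6, pow_succ]; ring
          _ ≤ q * 1 := mul_le_mul hk h7 (by positivity) hqp.le
      exact le_of_mul_le_mul_left h8 hqp
  by_contra hne
  have hpos := abs_pos.2 (sub_ne_zero.2 hne)
  obtain ⟨m, hm⟩ := pow_unbounded_of_one_lt (|μ.real {y | y 0 = i} - vec v n i|)⁻¹ one_lt_two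
  have h1 := main m n μ hμ
  rw [inv_lt_iff_one_lt_mul₀ hpos] at hm
  linarith

/-- Sets that depend on finitely many coordinates have measures in the rational span of the letter
frequencies. -/
theorem InvOn.real_mem_span (hlh : lo ≠ hi) (hv : Adm v) (M : ℕ) {n : ℕ} {μ : Measure (ℤ → A)}
    (hμ : InvOn ((tsys hlh hv).X n) μ) {E : Set (ℤ → A)} (hE : MeasurableSet E)
    (hM : ∀ y z : ℤ → A, (∀ m : ℤ, |m| ≤ M → y m = z m) → (y ∈ E ↔ z ∈ E)) :
    μ.real E ∈ Submodule.span ℚ (Set.range v) := by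
  classical
  induction M generalizing n μ E with
  | zero =>
    have e : E = {y | y 0 ∈ {i | ∃ z ∈ E, z 0 = i}} := by
      ext y
      refine ⟨fun hy => ⟨y, hy, rfl⟩, ?_⟩
      rintro ⟨z, hz, hzy⟩
      refine (hM z y fun m hm => ?_).1 hz
      have : m = 0 := by simpa using hm
      rw [this, hzy]
    rw [e, hμ.real_letters]
    refine Submodule.sum_mem _ fun i _ => ?_
    split_ifs
    · rw [hμ.real_letter hlh hv]
      exact vec_mem_span hv n i
    · exact Submodule.zero_mem _
  | succ M ih =>
    obtain ⟨ν, hν, hμν⟩ := hμ.desub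
    rw [hμν E hE]
    refine Submodule.sum_mem _ fun r _ => ?_
    have hg := (tsys hlh hv).good n
    have h1 := ih hν (E := (fun y => tr r (((tsys hlh hv).D n).sub y)) ⁻¹' E)
      (((measurable_tr r).comp (Pat.continuous_sub _).measurable) hE)
      fun y z hyz => hM _ _ (tr_sub_agree hg r.2 hyz)
    have h2 : ∀ x : ℝ, x / (((tsys hlh hv).D n).len : ℝ)
        = ((((tsys hlh hv).D n).len : ℚ)⁻¹) • x := fun x => by
      rw [Rat.smul_def]; push_cast; rw [div_eq_mul_inv, mul_comm]
    rw [h2]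
    exact Submodule.smul_mem _ _ h1

end Values

section Transfer

variable {A B : Type*} [Finite A] [MeasurableSpace A] [TopologicalSpace A] [DiscreteTopology A]
  [BorelSpace A] [MeasurableSpace B] [TopologicalSpace B] [DiscreteTopology B] [BorelSpace B]
  [Finite B]

/-- A closed translation invariant nonempty set supports an invariant measure. -/
theorem exists_invOn {X : Set (ℤ → A)} (hX : IsClosed X) (hne : X.Nonempty)
    (htr : ∀ y ∈ X, tr 1 y ∈ X) : ∃ μ, InvOn X μ := by
  have : CompactSpace X := isCompact_iff_compactSpace.1 hX.isCompact
  have : Nonempty X := hne.to_subtype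
  let φ : X → X := fun y => ⟨tr 1 y, htr y y.2⟩
  have hφ : Continuous φ := ((continuous_tr 1).comp continuous_subtype_val).subtype_mk _
  obtain ⟨μ, hμ, hinv⟩ := exists_invariant_probabilityMeasure hφ
  have hm : Measurable (Subtype.val : X → ℤ → A) := measurable_subtype_coe
  refine ⟨μ.map Subtype.val, Measure.isProbabilityMeasure_map hm.aemeasurable, ?_, ?_⟩
  · rw [Measure.map_map (measurable_tr 1) hm]
    conv_rhs => rw [← hinv, Measure.map_map hm hφ.measurable]
    rfl
  · rw [Measure.map_apply hm hX.measurableSet.compl]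
    have : (Subtype.val : X → ℤ → A) ⁻¹' Xᶜ = ∅ := by
      ext y; simp
    rw [this, measure_empty]

/-- Orbit equivalences carry invariant measures to invariant measures. -/
theorem InvOn.transfer {X : Set (ℤ → A)} {Y : Set (ℤ → B)} (hX : IsClosed X) (hY : IsClosed Y)
    (hXt : ∀ j, ∀ y ∈ X, tr j y ∈ X) (hYt : ∀ j, ∀ y ∈ Y, tr j y ∈ Y) (f : X ≃ₜ Y)
    (hf : ∀ x y : X, (y : ℤ → A) ∈ zOrbit shift (x : ℤ → A) ↔
      (f y : ℤ → B) ∈ zOrbit shift (f x : ℤ → B))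
    {μ : Measure (ℤ → A)} (hμ : InvOn X μ) :
    InvOn Y (((μ.comap (Subtype.val : X → ℤ → A)).map f).map (Subtype.val : Y → ℤ → B)) := by
  have hprob := hμ.prob
  let ρ : Measure X := μ.comap Subtype.val
  have hembX : MeasurableEmbedding (Subtype.val : X → ℤ → A) := .subtype_coe hX.measurableSet
  have hembY : MeasurableEmbedding (Subtype.val : Y → ℤ → B) := .subtype_coe hY.measurableSet
  have hρ : ∀ E, ρ E = μ (Subtype.val '' E) := fun E => hembX.comap_apply _ _
  have hρ1 : IsProbabilityMeasure ρ := ⟨by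
    rw [hρ, Set.image_univ, Subtype.range_coe]
    exact (prob_compl_eq_zero_iff hX.measurableSet).1 hμ.null⟩
  let g : ℤ → X ≃ₜ X := fun j =>
    { toFun := fun y => ⟨tr j y, hXt j y y.2⟩
      invFun := fun y => ⟨tr (-j) y, hXt (-j) y y.2⟩
      left_inv := fun y => by ext1; simp
      right_inv := fun y => by ext1; simp
      continuous_toFun := ((continuous_tr j).comp continuous_subtype_val).subtype_mk _
      continuous_invFun := ((continuous_tr (-j)).comp continuous_subtype_val).subtype_mk _ }
  let s : Y ≃ₜ Y :=
    { toFun := fun y => ⟨tr 1 y, hYt 1 y y.2⟩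
      invFun := fun y => ⟨tr (-1) y, hYt (-1) y y.2⟩
      left_inv := fun y => by ext1; simp
      right_inv := fun y => by ext1; simp
      continuous_toFun := ((continuous_tr 1).comp continuous_subtype_val).subtype_mk _
      continuous_invFun := ((continuous_tr (-1)).comp continuous_subtype_val).subtype_mk _ }
  have hg : ∀ j, ρ.map (g j) = ρ := by
    intro j
    ext E hE
    rw [Measure.map_apply (g j).continuous.measurable hE, hρ, hρ, ← hμ.preimage_tr (-j)]
    congr 1
    ext y
    constructor
    · rintro ⟨z, hz, e⟩
      refine ⟨_, hz, ?_⟩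
      change tr j (z : ℤ → A) = y
      rw [e]; simp
    · rintro ⟨z, hz, rfl⟩
      exact ⟨(g j).symm z, by simpa using hz, rfl⟩
  let h : X ≃ₜ X := (f.trans s).trans f.symm
  have hh : ∀ x, f (h x) = s (f x) := fun x => by simp [h]
  let e : ℕ ≃ ℤ := (Denumerable.eqv ℤ).symm
  have hρh : ρ.map h = ρ := by
    refine map_eq_of_piecewise (fun n => (g (e n)).toMeasurableEquiv) (fun n => hg (e n))
      h.toMeasurableEquiv (fun x => ?_) fun n => ?_
    · have h1 : (h x : ℤ → A) ∈ zOrbit shift (x : ℤ → A) := by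
        rw [hf, hh, mem_zOrbit_shift]
        exact ⟨1, rfl⟩
      obtain ⟨j, hj⟩ := mem_zOrbit_shift.1 h1
      refine ⟨e.symm j, Subtype.ext ?_⟩
      simp only [Equiv.apply_symm_apply]
      exact hj
    · exact (isClosed_eq h.continuous (g (e n)).continuous).measurableSet
  refine ⟨?_, ?_, ?_⟩
  · have : IsProbabilityMeasure (ρ.map f) :=
      Measure.isProbabilityMeasure_map f.continuous.measurable.aemeasurable
    exact Measure.isProbabilityMeasure_map hembY.measurable.aemeasurable
  · change ((ρ.map f).map (Subtype.val : Y → ℤ → B)).map (tr 1)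
      = (ρ.map f).map (Subtype.val : Y → ℤ → B)
    have h1 : (ρ.map f).map s = ρ.map f := by
      conv_rhs => rw [← hρh]
      rw [Measure.map_map s.continuous.measurable f.continuous.measurable,
        Measure.map_map f.continuous.measurable h.continuous.measurable]
      congr 1
      funext x
      exact (hh x).symm
    rw [Measure.map_map (measurable_tr 1) hembY.measurable]
    conv_rhs => rw [← h1, Measure.map_map hembY.measurable s.continuous.measurable]
    rfl
  · rw [Measure.map_apply hembY.measurable hY.measurableSet.compl]
    have : (Subtype.val : Y → ℤ → B) ⁻¹' Yᶜ = ∅ := by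
      ext y; simp
    rw [this, measure_empty]

/-- Relatively clopen subsets of a closed set depend on finitely many coordinates. -/
theorem exists_finite_window {X : Set (ℤ → A)} (hX : IsClosed X) {U : Set X} (hU : IsClopen U) :
    ∃ (M : ℕ) (E : Set (ℤ → A)), IsOpen E ∧ Subtype.val '' U = E ∩ X ∧
      ∀ y z : ℤ → A, (∀ m : ℤ, |m| ≤ M → y m = z m) → (y ∈ E ↔ z ∈ E) := by
  have hK : IsCompact ((Subtype.val '' U) ×ˢ (Subtype.val '' Uᶜ) : Set ((ℤ → A) × (ℤ → A))) :=
    ((hX.isClosedEmbedding_subtypeVal.isClosedMap _ hU.1).isCompact).prod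
      ((hX.isClosedEmbedding_subtypeVal.isClosedMap _ hU.compl.1).isCompact)
  let Z : ℕ → Set ((ℤ → A) × (ℤ → A)) := fun M => {p | ∀ m : ℤ, |m| ≤ M → p.1 m = p.2 m}
  have hZc : ∀ M, IsClosed (Z M) := by
    intro M
    simp only [Z, Set.ofPred_forall]
    exact isClosed_iInter fun m => isClosed_iInter fun _ =>
      isClosed_eq ((continuous_apply m).comp continuous_fst)
        ((continuous_apply m).comp continuous_snd)
  have hZ : ⋂ M, Z M ⊆ {p | p.1 = p.2} := by
    intro p hp
    funext m
    exact Set.mem_iInter.1 hp m.natAbs m (by simp)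
  obtain ⟨M, hM⟩ := hK.elim_directed_family_closed Z hZc (by
    rw [Set.eq_empty_iff_forall_notMem]
    rintro p ⟨⟨⟨a, ha, ha'⟩, b, hb, hb'⟩, hp⟩
    have : p.1 = p.2 := hZ hp
    rw [← ha', ← hb'] at this
    exact hb (Subtype.ext this ▸ ha)) (by
    refine directed_of_isDirected_le fun M M' hMM p hp m hm => hp m (hm.trans ?_)
    exact_mod_cast hMM)
  refine ⟨M, ⋃ x ∈ U, {y | ∀ m : ℤ, |m| ≤ M → y m = (x : ℤ → A) m}, ?_, ?_, ?_⟩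
  · refine isOpen_biUnion fun x _ => ?_
    have hfin : (Set.Icc (-(M : ℤ)) M).Finite := Set.finite_Icc _ _
    have : {y : ℤ → A | ∀ m : ℤ, |m| ≤ M → y m = (x : ℤ → A) m}
        = ⋂ m ∈ Set.Icc (-(M : ℤ)) M, (fun y => y m) ⁻¹' {(x : ℤ → A) m} := by
      ext y
      simp [abs_le]
    rw [this]
    exact hfin.isOpen_biInter fun m _ => (isOpen_discrete _).preimage (continuous_apply m)
  · ext y
    simp only [Set.mem_inter_iff, Set.mem_iUnion]
    constructor
    · rintro ⟨x, hx, rfl⟩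
      exact ⟨⟨x, hx, fun _ _ => rfl⟩, x.2⟩
    · rintro ⟨⟨x, hx, hxy⟩, hy⟩
      refine ⟨⟨y, hy⟩, ?_, rfl⟩
      by_contra hyU
      exact Set.eq_empty_iff_forall_notMem.1 hM (x, y)
        ⟨⟨⟨x, hx, rfl⟩, ⟨y, hy⟩, hyU, rfl⟩, fun m hm => (hxy m hm).symm⟩
  · intro y z hyz
    simp only [Set.mem_iUnion, Set.mem_ofPred_eq]
    exact exists_congr fun x => exists_congr fun hx => forall_congr' fun m =>
      forall_congr' fun hm => by rw [hyz m hm]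

end Transfer

section Span

variable {A B : Type*} [Fintype A] [DecidableEq A] [Nontrivial A] {lo hi : A} {v : A → ℝ}
  [TopologicalSpace A] [DiscreteTopology A]
  [Fintype B] [DecidableEq B] [Nontrivial B] {lo' hi' : B} {w : B → ℝ}
  [TopologicalSpace B] [DiscreteTopology B]

theorem span_le_of_orbitEquivalent (hlh : lo ≠ hi) (hv : Adm v) (hlh' : lo' ≠ hi') (hw : Adm w)
    (h : SubshiftOrbitEquivalent ((tsys hlh hv).X 0) ((tsys hlh' hw).X 0)) :
    Submodule.span ℚ (Set.range w) ≤ Submodule.span ℚ (Set.range v) := by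
  borelize A B
  obtain ⟨f, hf⟩ := h
  have hX := (tsys hlh hv).isClosed_X 0
  have hY := (tsys hlh' hw).isClosed_X 0
  obtain ⟨μ, hμ⟩ := exists_invOn hX ⟨_, (tsys hlh hv).τ_mem 0⟩ fun y hy => (tsys hlh hv).tr_mem hy 1
  have hν := hμ.transfer hX hY (fun j y hy => (tsys hlh hv).tr_mem hy j)
    (fun j y hy => (tsys hlh' hw).tr_mem hy j) f hf
  have hembX : MeasurableEmbedding (Subtype.val : (tsys hlh hv).X 0 → ℤ → A) :=
    .subtype_coe hX.measurableSet
  refine Submodule.span_le.2 ?_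
  rintro _ ⟨i, rfl⟩
  have h1 := hν.real_letter hlh' hw i
  change _ = w i at h1
  rw [← h1]
  let U : Set ((tsys hlh hv).X 0) := (fun x => (f x : ℤ → B) 0) ⁻¹' {i}
  have hU : IsClopen U := (isClopen_discrete {i}).preimage
    ((continuous_apply 0).comp (continuous_subtype_val.comp f.continuous))
  obtain ⟨M, E, hE, hUE, hM⟩ := exists_finite_window hX hU
  have h2 := hμ.real_mem_span hlh hv M hE.measurableSet hM
  suffices (((μ.comap (Subtype.val : (tsys hlh hv).X 0 → ℤ → A)).map f).map
      (Subtype.val : (tsys hlh' hw).X 0 → ℤ → B)) {y | y 0 ∈ ({i} : Set B)} = μ E by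
    rw [measureReal_def] at h2 ⊢
    rw [← this] at h2
    exact h2
  rw [Measure.map_apply measurable_subtype_coe (measurableSet_letter {i}),
    Measure.map_apply f.continuous.measurable
      (measurable_subtype_coe (measurableSet_letter {i})), hembX.comap_apply]
  have : ∀ᵐ y ∂μ, y ∈ (tsys hlh hv).X 0 := hμ.null
  change μ (Subtype.val '' U) = _
  rw [hUE]
  refine measure_congr ?_
  filter_upwards [this] with y hy
  exact propext ⟨fun h => h.1, fun h => ⟨h, hy⟩⟩

end Span

section Regularity

variable {A : Type*} {lo hi : A}

theorem Sys.exists_period (S : Sys A lo hi) (n : ℕ) (k : ℤ) :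
    ∃ p : ℕ, 1 ≤ p ∧ ∀ j : ℤ, S.τ n (k + j * p) = S.τ n k := by
  induction hm : k.natAbs using Nat.strong_induction_on generalizing n k with
  | _ m ih =>
    have hp := (S.good n).pos
    obtain ⟨b, r, hr, rfl⟩ := exists_block_coord hp k
    rw [S.sub_eq n]
    cases hfn : (S.D n).fn r with
    | some a =>
      refine ⟨(S.D n).len, hp, fun j => ?_⟩
      have : b * ((S.D n).len : ℤ) + r + j * (S.D n).len = (b + j) * (S.D n).len + r := by ring
      rw [this, Pat.sub_apply _ _ _ hr, Pat.sub_apply _ _ _ hr, hfn]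
      rfl
    | none =>
      have hlt : b.natAbs < m := by
        rw [← hm]
        refine natAbs_lt_of_block (S.good n).two_le hr ?_ ?_
        · rintro ⟨-, rfl⟩
          simp [(S.good n).first] at hfn
        · rintro ⟨-, rfl⟩
          simp [(S.good n).last] at hfn
      obtain ⟨p, hp1, hp2⟩ := ih _ hlt (n + 1) b rfl
      refine ⟨p * (S.D n).len, Nat.mul_pos hp1 hp, fun j => ?_⟩
      have : b * ((S.D n).len : ℤ) + r + j * (p * (S.D n).len : ℕ)
          = (b + j * p) * (S.D n).len + r := by push_cast; ring
      rw [this, Pat.sub_apply _ _ _ hr, Pat.sub_apply _ _ _ hr, hp2]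

theorem toeplitzDelta_le_one (x : ℤ → A) {p : ℕ} (hp : 1 ≤ p) : toeplitzDelta x p ≤ 1 := by
  rw [toeplitzDelta, div_le_one (by exact_mod_cast hp)]
  have h : {k : ℤ | 0 ≤ k ∧ k < (p : ℤ) ∧ ∀ n : ℤ, x (k + n * p) = x k} ⊆ Set.Ico 0 (p : ℤ) :=
    fun k hk => ⟨hk.1, hk.2.1⟩
  have := Set.ncard_le_ncard h (Set.finite_Ico _ _)
  rw [← Finset.coe_Ico, Set.ncard_coe_finset, Int.card_Ico, sub_zero, Int.toNat_natCast] at this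
  exact_mod_cast this

theorem Pat.one_sub_holes_le_toeplitzDelta {c : Pat A} (hc : 0 < c.len) (y : ℤ → A) :
    1 - (c.holes : ℝ) / c.len ≤ toeplitzDelta (c.sub y) c.len := by
  have hc' : (0 : ℝ) < c.len := by exact_mod_cast hc
  rw [toeplitzDelta, le_div_iff₀ hc', sub_mul, div_mul_cancel₀ _ hc'.ne', one_mul,
    sub_le_iff_le_add]
  have h1 : ((Finset.range c.len).filter fun r => ¬ (c.fn r).isNone).card + c.holes = c.len := by
    rw [holes, add_comm, Finset.card_filter_add_card_filter_not, Finset.card_range]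
  have h2 : ((Finset.range c.len).filter fun r => ¬ (c.fn r).isNone).card
      ≤ {k : ℤ | 0 ≤ k ∧ k < (c.len : ℤ) ∧ ∀ n : ℤ, c.sub y (k + n * c.len) = c.sub y k}.ncard := by
    rw [← Finset.card_image_of_injective _ (Nat.cast_injective (R := ℤ)), ← Set.ncard_coe_finset]
    refine Set.ncard_le_ncard ?_ ((Set.finite_Ico 0 (c.len : ℤ)).subset fun k hk => ⟨hk.1, hk.2.1⟩)
    intro k hk
    obtain ⟨r, hr, rfl⟩ := Finset.mem_image.1 hk
    obtain ⟨hr1, hr2⟩ := Finset.mem_filter.1 hr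
    rw [Finset.mem_range] at hr1
    refine ⟨by positivity, by exact_mod_cast hr1, fun n => ?_⟩
    have e0 := c.sub_apply y 0 hr1
    have e1 := c.sub_apply y n hr1
    rw [zero_mul, zero_add] at e0
    rw [add_comm, e0, e1]
    cases h : c.fn r with
    | none => simp [h] at hr2
    | some a => rfl
  have h3 : c.len ≤ {k : ℤ | 0 ≤ k ∧ k < (c.len : ℤ) ∧
      ∀ n : ℤ, c.sub y (k + n * c.len) = c.sub y k}.ncard + c.holes := by omega
  exact_mod_cast h3

theorem two_pow_holes_cmp_le {D : ℕ → Pat A} (hD : ∀ n, 2 * (D n).holes ≤ (D n).len) (n m : ℕ) :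
    2 ^ (m + 1) * (cmp D n m).holes ≤ (cmp D n m).len := by
  induction m generalizing n with
  | zero => simpa [cmp] using hD n
  | succ m ih =>
    have h := Pat.holes_comp_le (D n) (cmp D (n + 1) m)
    simp only [cmp]
    calc _ ≤ 2 ^ (m + 1 + 1) * ((D n).holes * (cmp D (n + 1) m).holes) := by gcongr
      _ = (2 * (D n).holes) * (2 ^ (m + 1) * (cmp D (n + 1) m).holes) := by ring
      _ ≤ (D n).len * (cmp D (n + 1) m).len := Nat.mul_le_mul (hD n) (ih (n + 1))

theorem Sys.isRegularToeplitz (S : Sys A lo hi) (hS : ∀ n, 2 * (S.D n).holes ≤ (S.D n).len) :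
    IsRegularToeplitz (S.τ 0) := by
  refine ⟨S.exists_period 0, csSup_eq_of_forall_le_of_forall_lt_exists_gt ⟨_, 1, le_rfl, rfl⟩ ?_ ?_⟩
  · rintro d ⟨p, hp, rfl⟩
    exact toeplitzDelta_le_one _ hp
  · intro w hw
    obtain ⟨m, hm⟩ := exists_pow_lt_of_lt_one (sub_pos.2 hw) (by norm_num : (1 / 2 : ℝ) < 1)
    have hp := (S.cmp_good 0 m).pos
    refine ⟨_, ⟨_, hp, rfl⟩, lt_of_lt_of_le ?_
      ((cmp S.D 0 m).one_sub_holes_le_toeplitzDelta hp (S.τ (0 + m + 1)) |>.trans_eq ?_)⟩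
    · have h := two_pow_holes_cmp_le hS 0 m
      have h' : (2 : ℝ) ^ (m + 1) * (cmp S.D 0 m).holes ≤ (cmp S.D 0 m).len := by exact_mod_cast h
      have hl : (0 : ℝ) < (cmp S.D 0 m).len := by exact_mod_cast hp
      have h2 : ((cmp S.D 0 m).holes : ℝ) / (cmp S.D 0 m).len ≤ (1 / 2) ^ m := by
        rw [div_le_iff₀ hl, one_div, inv_pow, inv_mul_eq_div, le_div_iff₀ (by positivity)]
        have : (0 : ℝ) ≤ 2 ^ m * (cmp S.D 0 m).holes := by positivity
        rw [pow_succ] at h'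
        linarith
      linarith
    · rw [← S.cmp_sub]

theorem isRegularToeplitz_tsys [Fintype A] [DecidableEq A] [Nontrivial A] (hlh : lo ≠ hi)
    {v : A → ℝ} (hv : Adm v) : IsRegularToeplitz ((tsys hlh hv).τ 0) :=
  Sys.isRegularToeplitz _ (two_holes_blk_le hlh hv)

theorem isRegularToeplitz_const (a : A) : IsRegularToeplitz fun _ : ℤ => a := by
  refine ⟨fun k => ⟨1, le_rfl, fun n => rfl⟩, ?_⟩
  refine csSup_eq_of_forall_le_of_forall_lt_exists_gt ⟨_, 1, le_rfl, rfl⟩ ?_ ?_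
  · rintro d ⟨p, hp, rfl⟩
    exact toeplitzDelta_le_one _ hp
  · intro w hw
    refine ⟨_, ⟨1, le_rfl, rfl⟩, hw.trans_le ?_⟩
    have : {k : ℤ | 0 ≤ k ∧ k < ((1 : ℕ) : ℤ) ∧ ∀ n : ℤ, a = a} = {0} := by
      ext k
      simp
      omega
    rw [toeplitzDelta, this]
    simp

end Regularity

section Comparison

variable {A B C : Type*} [TopologicalSpace A] [TopologicalSpace B] [TopologicalSpace C]

theorem _root_.SubshiftOrbitEquivalent.symm {X : Set (ℤ → A)} {Y : Set (ℤ → B)}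
    (h : SubshiftOrbitEquivalent X Y) : SubshiftOrbitEquivalent Y X := by
  obtain ⟨f, hf⟩ := h
  exact ⟨f.symm, fun x y => by simpa using (hf (f.symm x) (f.symm y)).symm⟩

theorem _root_.SubshiftOrbitEquivalent.trans {X : Set (ℤ → A)} {Y : Set (ℤ → B)} {Z : Set (ℤ → C)}
    (h : SubshiftOrbitEquivalent X Y) (h' : SubshiftOrbitEquivalent Y Z) :
    SubshiftOrbitEquivalent X Z := by
  obtain ⟨f, hf⟩ := h
  obtain ⟨g, hg⟩ := h'
  exact ⟨f.trans g, fun x y => (hf x y).trans (hg (f x) (f y))⟩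

theorem _root_.SubshiftOrbitEquivalent.nontrivial {X : Set (ℤ → A)} {Y : Set (ℤ → B)}
    (h : SubshiftOrbitEquivalent X Y) (hX : X.Nontrivial) : Y.Nontrivial := by
  obtain ⟨f, -⟩ := h
  rw [← Set.nontrivial_coe_sort] at hX ⊢
  exact f.symm.toEquiv.nontrivial

theorem Sys.nontrivial_X [Finite A] [DiscreteTopology A] {lo hi : A} (hlh : lo ≠ hi)
    (S : Sys A lo hi) : (S.X 0).Nontrivial := by
  obtain ⟨z, hz⟩ := S.letter_occurs 0 lo
  obtain ⟨z', hz'⟩ := S.letter_occurs 0 hi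
  exact ⟨z, z.2, z', z'.2, fun h => hlh (hz.symm.trans ((congrFun h 0).trans hz'))⟩

end Comparison

section Recoding

variable {A B : Type*} {ι : A → B}

theorem comp_mem_zOrbit_iff (hι : Function.Injective ι) {x y : ℤ → A} :
    ι ∘ y ∈ zOrbit shift (ι ∘ x) ↔ y ∈ zOrbit shift x := by
  simp only [mem_zOrbit_shift]
  exact exists_congr fun j => hι.comp_left.eq_iff (a := y) (b := tr j x)

theorem zOrbit_comp (ι : A → B) (x : ℤ → A) :
    zOrbit shift (ι ∘ x) = (fun y => ι ∘ y) '' zOrbit shift x := by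
  ext z
  simp only [mem_zOrbit_shift, Set.mem_image]
  constructor
  · rintro ⟨j, rfl⟩
    exact ⟨_, ⟨j, rfl⟩, rfl⟩
  · rintro ⟨_, ⟨j, rfl⟩, rfl⟩
    exact ⟨j, rfl⟩

theorem zOrbit_const (a : A) : zOrbit shift (fun _ : ℤ => a) = {fun _ => a} := by
  ext y
  rw [mem_zOrbit_shift]
  exact ⟨fun ⟨_, h⟩ => h, fun h => ⟨0, h⟩⟩

theorem isRegularToeplitz_comp (hι : Function.Injective ι) {x : ℤ → A} (hx : IsRegularToeplitz x) :
    IsRegularToeplitz (ι ∘ x) := by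
  have : ∀ p, toeplitzDelta (ι ∘ x) p = toeplitzDelta x p := fun p => by
    simp only [toeplitzDelta, Function.comp_apply, hι.eq_iff]
  refine ⟨fun k => ?_, ?_⟩
  · obtain ⟨p, hp, h⟩ := hx.1 k
    exact ⟨p, hp, fun n => congrArg ι (h n)⟩
  · simp only [this]
    exact hx.2

variable [TopologicalSpace A] [TopologicalSpace B] [Finite A] [DiscreteTopology A] [T2Space B]

theorem isClosedEmbedding_comp (hι : Function.Injective ι) :
    IsClosedEmbedding fun x : ℤ → A => ι ∘ x :=
  Continuous.isClosedEmbedding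
    (continuous_pi fun n => continuous_of_discreteTopology.comp (continuous_apply n))
    hι.comp_left

theorem orbitEquivalent_comp (hι : Function.Injective ι) (x : ℤ → A) :
    SubshiftOrbitEquivalent (closure (zOrbit shift x)) (closure (zOrbit shift (ι ∘ x))) := by
  have hemb := isClosedEmbedding_comp hι
  rw [zOrbit_comp, hemb.isClosedMap.closure_image_eq_of_continuous hemb.continuous]
  exact ⟨hemb.isEmbedding.homeomorphImage _, fun y z => (comp_mem_zOrbit_iff hι).symm⟩

end Recoding

section Measurability

variable {Z A : Type*} [MeasurableSpace Z]

theorem measurable_stepM [Fintype A] {v : Z → A → ℝ} (hv : Measurable v) :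
    Measurable fun z => stepM (v z) :=
  ((Nat.measurable_ceil.comp (Finset.measurable_sum _ fun i _ =>
    ((measurable_pi_apply i).comp hv).inv)).add_const _)

theorem measurable_stepA [Fintype A] {v : Z → A → ℝ} (hv : Measurable v) (i : A) :
    Measurable fun z => stepA (v z) i :=
  Nat.measurable_floor.comp
    ((measurable_from_nat.comp (measurable_stepM hv)).mul ((measurable_pi_apply i).comp hv))

theorem measurable_stepK [Fintype A] {v : Z → A → ℝ} (hv : Measurable v) :
    Measurable fun z => stepK (v z) :=
  (measurable_stepM hv).sub (Finset.measurable_sum _ fun i _ => measurable_stepA hv i)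

theorem measurable_vec [Fintype A] {v : Z → A → ℝ} (hv : Measurable v) (n : ℕ) :
    Measurable fun z => vec (v z) n := by
  induction n with
  | zero => exact hv
  | succ n ih =>
    refine measurable_pi_lambda _ fun i => ?_
    simp only [vec, stepV]
    exact (((measurable_from_nat.comp (measurable_stepM ih)).mul
      ((measurable_pi_apply i).comp ih)).sub
      (measurable_from_nat.comp (measurable_stepA ih i))).div
      (measurable_from_nat.comp (measurable_stepK ih))

theorem measurable_fill {κ : Type*} [MeasurableSpace A] [MeasurableSpace κ] [Countable κ]
    [MeasurableSingletonClass κ] (lo : A) (mk : κ → Pat A) (f : ℕ) {P : Z → ℕ → κ}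
    (hP : ∀ n, Measurable fun z => P z n) (m : ℤ) :
    Measurable fun z => fill lo f (fun n => mk (P z n)) m := by
  induction f generalizing P m with
  | zero => exact measurable_const
  | succ f ih =>
    simp only [fill]
    have : Measurable fun q : κ × Z => ((mk q.1).fn (m % (mk q.1).len).toNat).getD
        (fill lo f (fun n => mk (P q.2 (n + 1))) (m / (mk q.1).len)) := by
      refine measurable_from_prod_countable_right fun c => ?_
      dsimp only
      cases (mk c).fn (m % (mk c).len).toNat with
      | none => exact ih (fun n => hP (n + 1)) _
      | some a => exact measurable_const
    exact this.comp ((hP 0).prodMk measurable_id)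

theorem measurable_toep_blk [Fintype A] [DecidableEq A] [MeasurableSpace A] (lo hi : A)
    {v : Z → A → ℝ} (hv : Measurable v) : Measurable fun z => toep lo (blk lo hi (v z)) :=
  measurable_pi_lambda _ fun m => measurable_fill lo
    (fun q : (A → ℕ) × ℕ => mkPat lo hi q.1 q.2) _ (fun n =>
      (measurable_pi_lambda _ fun i => (measurable_stepA (measurable_vec hv n) i).const_mul _).prodMk
        ((measurable_stepK (measurable_vec hv n)).const_mul _)) m

/-- The subshift generated by a sequence. -/
def orb {B : Type*} [TopologicalSpace B] [CompactSpace B] (t : ℤ → B) :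
    NonemptyCompacts (ℤ → B) :=
  ⟨⟨closure (zOrbit shift t), isClosed_closure.isCompact⟩,
    ⟨t, subset_closure (mem_zOrbit_shift.2 ⟨0, (tr_zero t).symm⟩)⟩⟩

theorem coe_orb {B : Type*} [TopologicalSpace B] [CompactSpace B] (t : ℤ → B) :
    (orb t : Set (ℤ → B)) = closure (zOrbit shift t) := rfl

theorem measurable_orb {n : ℕ} {t : Z → ℤ → Fin n} (ht : Measurable t) :
    Measurable fun z => orb (t z) := by
  have hb := (isTopologicalBasis_isClopen (X := ℤ → Fin n)).nonemptyCompacts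
  have htr : ∀ (j : ℤ) {U : Set (ℤ → Fin n)}, IsOpen U → MeasurableSet {z | tr j (t z) ∈ U} :=
    fun j U hU => ((continuous_tr j).measurable.comp ht) hU.measurableSet
  rw [measurable_iff_comap_le, BorelSpace.measurable_eq (α := NonemptyCompacts (ℤ → Fin n)),
    hb.borel_eq_generateFrom, ← measurable_iff_comap_le]
  refine measurable_generateFrom ?_
  rintro _ ⟨u, ⟨hu, -, huc⟩, rfl⟩
  have h1 : MeasurableSet {z | (orb (t z) : Set (ℤ → Fin n)) ⊆ ⋃₀ u} := by
    have hU : IsClopen (⋃₀ u) := by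
      rw [Set.sUnion_eq_biUnion]
      exact hu.isClopen_biUnion fun U hU => huc hU
    have : {z | (orb (t z) : Set (ℤ → Fin n)) ⊆ ⋃₀ u} = ⋂ j : ℤ, {z | tr j (t z) ∈ ⋃₀ u} := by
      ext z
      rw [Set.mem_ofPred_eq, coe_orb, hU.isClosed.closure_subset_iff, Set.mem_iInter]
      exact ⟨fun h j => h (mem_zOrbit_shift.2 ⟨j, rfl⟩), fun h y hy => by
        obtain ⟨j, rfl⟩ := mem_zOrbit_shift.1 hy
        exact h j⟩
    rw [this]
    exact MeasurableSet.iInter fun j => htr j hU.isOpen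
  have h2 : ∀ U ∈ u, MeasurableSet {z | ((orb (t z) : Set (ℤ → Fin n)) ∩ U).Nonempty} := by
    intro U hU
    have hUo : IsOpen U := (huc hU).isOpen
    have : {z | ((orb (t z) : Set (ℤ → Fin n)) ∩ U).Nonempty} = ⋃ j : ℤ, {z | tr j (t z) ∈ U} := by
      ext z
      rw [Set.mem_ofPred_eq, coe_orb, closure_inter_open_nonempty_iff hUo, Set.mem_iUnion]
      constructor
      · rintro ⟨y, hy, hyU⟩
        obtain ⟨j, rfl⟩ := mem_zOrbit_shift.1 hy
        exact ⟨j, hyU⟩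
      · rintro ⟨j, hj⟩
        exact ⟨_, mem_zOrbit_shift.2 ⟨j, rfl⟩, hj⟩
    rw [this]
    exact MeasurableSet.iUnion fun j => htr j hUo
  have h3 := h1.inter (MeasurableSet.biInter hu.countable h2)
  convert h3 using 1
  ext z
  simp

end Measurability

section LinearAlgebra

/-- Two linear maps on the same space with the same range differ by an automorphism. -/
theorem exists_comp_eq_of_range_eq {K V W : Type*} [Field K] [AddCommGroup V] [Module K V]
    [AddCommGroup W] [Module K W] [FiniteDimensional K V] {f g : V →ₗ[K] W}
    (h : f.range = g.range) : ∃ e : V ≃ₗ[K] V, f ∘ₗ e.toLinearMap = g := by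
  obtain ⟨C, hC⟩ := f.ker.exists_isCompl
  obtain ⟨C', hC'⟩ := g.ker.exists_isCompl
  have hker : Module.finrank K g.ker = Module.finrank K f.ker := by
    have h1 := f.finrank_range_add_finrank_ker
    have h2 := g.finrank_range_add_finrank_ker
    rw [h] at h1
    omega
  let eK : g.ker ≃ₗ[K] f.ker := LinearEquiv.ofFinrankEq _ _ hker
  let eC : C' ≃ₗ[K] C := (g.kerComplementEquivRange hC'.symm).trans
    ((LinearEquiv.ofEq _ _ h.symm).trans (f.kerComplementEquivRange hC.symm).symm)
  have heC : ∀ c, f (eC c) = g c := by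
    intro c
    have h1 : f.kerComplementEquivRange hC.symm (eC c)
        = LinearEquiv.ofEq _ _ h.symm (g.kerComplementEquivRange hC'.symm c) :=
      (f.kerComplementEquivRange hC.symm).apply_symm_apply _
    exact congrArg Subtype.val h1
  refine ⟨((Submodule.prodEquivOfIsCompl _ _ hC').symm.trans (eK.prodCongr eC)).trans
    (Submodule.prodEquivOfIsCompl _ _ hC), LinearMap.ext fun y => ?_⟩
  obtain ⟨⟨a, c⟩, rfl⟩ := (Submodule.prodEquivOfIsCompl _ _ hC').surjective y
  have h1 : f (eK a) = 0 := (eK a).2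
  have h2 : g a = 0 := a.2
  simp [h1, h2, heC]

theorem exists_vecMul_eq_iff {n : Type*} [Fintype n] [DecidableEq n] (u w : n → ℝ) :
    (∃ M : GL n ℚ, Matrix.vecMul u ((M : Matrix n n ℚ).map (fun q : ℚ => (q : ℝ))) = w) ↔
      Submodule.span ℚ (Set.range u) = Submodule.span ℚ (Set.range w) := by
  have hle : ∀ (u : n → ℝ) (M : Matrix n n ℚ),
      Submodule.span ℚ (Set.range (Matrix.vecMul u (M.map (fun q : ℚ => (q : ℝ)))))
        ≤ Submodule.span ℚ (Set.range u) := by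
    intro u M
    rw [Submodule.span_le]
    rintro _ ⟨j, rfl⟩
    have : Matrix.vecMul u (M.map (fun q : ℚ => (q : ℝ))) j = ∑ i, M i j • u i := by
      simp only [Matrix.vecMul, dotProduct, Matrix.map_apply, Rat.smul_def, mul_comm]
    rw [this]
    exact Submodule.sum_mem _ fun i _ => Submodule.smul_mem _ _ (Submodule.subset_span ⟨i, rfl⟩)
  constructor
  · rintro ⟨M, rfl⟩
    refine le_antisymm ?_ (hle _ _)
    have h := hle (Matrix.vecMul u ((M : Matrix n n ℚ).map (fun q : ℚ => (q : ℝ))))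
      ((M⁻¹ : GL n ℚ) : Matrix n n ℚ)
    have h1 : (M : Matrix n n ℚ).map (fun q : ℚ => (q : ℝ))
        * ((M⁻¹ : GL n ℚ) : Matrix n n ℚ).map (fun q : ℚ => (q : ℝ)) = 1 := by
      have := Matrix.map_mul (L := (M : Matrix n n ℚ)) (M := ((M⁻¹ : GL n ℚ) : Matrix n n ℚ))
        (f := Rat.castHom ℝ)
      rw [← Units.val_mul, mul_inv_cancel, Units.val_one, Matrix.map_one _ (map_zero _) (map_one _)]
        at this
      exact this.symm
    rwa [Matrix.vecMul_vecMul, h1, Matrix.vecMul_one] at h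
  · intro h
    obtain ⟨e, he⟩ := exists_comp_eq_of_range_eq (f := Fintype.linearCombination ℚ u)
      (g := Fintype.linearCombination ℚ w)
      (by rw [Fintype.range_linearCombination, Fintype.range_linearCombination, h])
    refine ⟨⟨LinearMap.toMatrix' e.toLinearMap, LinearMap.toMatrix' e.symm.toLinearMap, ?_, ?_⟩, ?_⟩
    · rw [← LinearMap.toMatrix'_comp, LinearEquiv.comp_symm, LinearMap.toMatrix'_id]
    · rw [← LinearMap.toMatrix'_comp, LinearEquiv.symm_comp, LinearMap.toMatrix'_id]
    funext j
    have h1 := LinearMap.congr_fun he (Pi.single j 1)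
    rw [Fintype.linearCombination_apply_single, one_smul] at h1
    rw [← h1]
    simp only [LinearMap.comp_apply, Fintype.linearCombination_apply, Rat.smul_def, Matrix.vecMul,
      dotProduct, Matrix.map_apply]
    refine Finset.sum_congr rfl fun i _ => ?_
    rw [mul_comm]
    rfl

theorem exists_adm {V : Submodule ℚ ℝ} [FiniteDimensional ℚ V] (h1 : (1 : ℝ) ∈ V) {e : ℕ}
    (hk : Module.finrank ℚ V = e + 2) :
    ∃ v : Fin (e + 2) → ℝ, Adm v ∧ Submodule.span ℚ (Set.range v) = V := by
  let one : V := ⟨1, h1⟩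
  have hone : one ≠ 0 := fun h => one_ne_zero (α := ℝ) (congrArg Subtype.val h)
  have hq : Module.finrank ℚ (V ⧸ Submodule.span ℚ {one}) = e + 1 := by
    have h2 := (Submodule.span ℚ {one}).finrank_quotient_add_finrank
    rw [finrank_span_singleton hone] at h2
    omega
  let q := Module.finBasisOfFinrankEq ℚ _ hq
  choose b hb using fun i => (Submodule.span ℚ {one}).mkQ_surjective (q i)
  have hspan : ∀ y ∈ V, ∃ (a : ℚ) (c : Fin (e + 1) → ℚ), y = a + ∑ i, c i * (b i : ℝ) := by
    intro y hy
    have h2 : (⟨y, hy⟩ - ∑ i, q.repr ((Submodule.span ℚ {one}).mkQ ⟨y, hy⟩) i • b i : V)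
        ∈ Submodule.span ℚ {one} := by
      rw [← Submodule.Quotient.mk_eq_zero, ← Submodule.mkQ_apply, map_sub, map_sum]
      simp only [map_smul, hb]
      rw [q.sum_repr, sub_self]
    obtain ⟨a, ha⟩ := Submodule.mem_span_singleton.1 h2
    have h3 := congrArg Subtype.val ha
    refine ⟨a, fun i => q.repr ((Submodule.span ℚ {one}).mkQ ⟨y, hy⟩) i, ?_⟩
    simp only [one, Submodule.coe_smul, Submodule.coe_sub, Submodule.coe_sum, Rat.smul_def] at h3
    linarith
  let c : Fin (e + 1) → ℝ := fun i => (Int.fract (b i : ℝ) + 1) / (2 * (e + 2))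
  have he : (0 : ℝ) < 2 * (e + 2) := by positivity
  have hc0 : ∀ i, 0 < c i := fun i => div_pos (by linarith [Int.fract_nonneg (b i : ℝ)]) he
  have hc1 : ∑ i, c i < 1 := by
    calc ∑ i, c i ≤ ∑ i : Fin (e + 1), (1 / (e + 2) : ℝ) := Finset.sum_le_sum fun i _ => by
          rw [div_le_div_iff₀ he (by positivity)]
          nlinarith [Int.fract_lt_one (b i : ℝ)]
      _ < 1 := by
          rw [Finset.sum_const, Finset.card_univ, Fintype.card_fin, nsmul_eq_mul, mul_one_div,
            div_lt_one (by positivity)]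
          push_cast
          linarith
  have hcV : ∀ i, c i ∈ V := by
    intro i
    have : c i = ((1 / (2 * (e + 2)) : ℚ)) • ((b i : ℝ) + ((1 - ⌊(b i : ℝ)⌋ : ℚ)) • (1 : ℝ)) := by
      simp only [c, Rat.smul_def, Int.fract]
      push_cast
      ring
    rw [this]
    exact V.smul_mem _ (V.add_mem (b i).2 (V.smul_mem _ h1))
  let v : Fin (e + 2) → ℝ := Fin.cons (1 - ∑ i, c i) c
  have hv1 : ∑ i, v i = 1 := by simp [v, Fin.sum_univ_succ]
  have hvV : Submodule.span ℚ (Set.range v) = V := by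
    refine le_antisymm (Submodule.span_le.2 ?_) fun y hy => ?_
    · rintro _ ⟨i, rfl⟩
      refine Fin.cases ?_ (fun i => ?_) i
      · exact V.sub_mem h1 (V.sum_mem fun i _ => hcV i)
      · exact hcV i
    · have hmem : ∀ i, v i ∈ Submodule.span ℚ (Set.range v) :=
        fun i => Submodule.subset_span ⟨i, rfl⟩
      have h1m : (1 : ℝ) ∈ Submodule.span ℚ (Set.range v) :=
        hv1 ▸ Submodule.sum_mem _ fun i _ => hmem i
      have hbm : ∀ i, (b i : ℝ) ∈ Submodule.span ℚ (Set.range v) := by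
        intro i
        have : (b i : ℝ) = ((2 * (e + 2) : ℚ)) • v i.succ + ((⌊(b i : ℝ)⌋ - 1 : ℚ)) • (1 : ℝ) := by
          simp only [v, Fin.cons_succ, c, Rat.smul_def, Int.fract]
          push_cast
          field_simp
          ring
        rw [this]
        exact Submodule.add_mem _ (Submodule.smul_mem _ _ (hmem _)) (Submodule.smul_mem _ _ h1m)
      obtain ⟨a, d, rfl⟩ := hspan y hy
      refine Submodule.add_mem _ ?_ (Submodule.sum_mem _ fun i _ => ?_)
      · simpa [Rat.smul_def] using Submodule.smul_mem _ a h1m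
      · simpa [Rat.smul_def] using Submodule.smul_mem _ (d i) (hbm i)
  refine ⟨v, ⟨fun i => ?_, hv1, ?_⟩, hvV⟩
  · refine Fin.cases ?_ (fun i => ?_) i
    · simpa [v] using hc1
    · exact hc0 i
  · rw [linearIndependent_iff_card_eq_finrank_span, Set.finrank, hvV, hk, Fintype.card_fin]

end LinearAlgebra

section Selection

/-- Measurable choice among countably many alternatives, with a default value. -/
theorem exists_measurable_selection {Z W D : Type*} [MeasurableSpace Z] [MeasurableSpace W]
    [Countable D] {p : D → Z → Prop} (hp : ∀ d, MeasurableSet {z | p d z}) {f : D → Z → W}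
    (hf : ∀ d, Measurable (f d)) (c : W) :
    ∃ t : Z → W, Measurable t ∧
      ∀ z, (∃ d, p d z ∧ t z = f d z) ∨ ((∀ d, ¬ p d z) ∧ t z = c) := by
  classical
  obtain ⟨g, hg⟩ := exists_surjective_nat (Option D)
  let P : Option D → Z → Prop := fun o z => o.elim (∀ d, ¬ p d z) fun d => p d z
  let F : Option D → Z → W := fun o z => o.elim c fun d => f d z
  have hP : ∀ o, MeasurableSet {z | P o z} := by
    rintro (_ | d)
    · have : {z | P none z} = ⋂ d, {z | p d z}ᶜ := by
        ext z
        simp [P]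
      rw [this]
      exact MeasurableSet.iInter fun d => (hp d).compl
    · exact hp d
  have hF : ∀ o, Measurable (F o) := by
    rintro (_ | d)
    · exact measurable_const
    · exact hf d
  have hex : ∀ z, ∃ n, P (g n) z := by
    intro z
    by_cases h : ∃ d, p d z
    · obtain ⟨d, hd⟩ := h
      obtain ⟨n, hn⟩ := hg (some d)
      exact ⟨n, by rw [hn]; exact hd⟩
    · obtain ⟨n, hn⟩ := hg none
      exact ⟨n, by rw [hn]; exact not_exists.1 h⟩
  refine ⟨fun z => F (g (Nat.find (hex z))) z,
    Measurable.find (fun n => hF (g n)) (fun n => hP (g n)) hex, fun z => ?_⟩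
  have h := Nat.find_spec (hex z)
  dsimp only
  revert h
  cases g (Nat.find (hex z)) with
  | none => exact fun h => Or.inr ⟨h, rfl⟩
  | some d => exact fun h => Or.inl ⟨d, h, rfl⟩

theorem measurableSet_adm {Z A : Type*} [MeasurableSpace Z] [Fintype A] {v : Z → A → ℝ}
    (hv : Measurable v) : MeasurableSet {z | Adm (v z)} := by
  have hvi : ∀ i, Measurable fun z => v z i := fun i => (measurable_pi_apply i).comp hv
  have : {z | Adm (v z)} = ((⋂ i, {z | 0 < v z i}) ∩ {z | ∑ i, v z i = 1}) ∩
      ⋂ c : {c : A → ℚ // c ≠ 0}, {z | ∑ i, (c.1 i : ℝ) * v z i = 0}ᶜ := by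
    ext z
    simp only [Set.mem_inter_iff, Set.mem_iInter, Set.mem_ofPred_eq, Set.mem_compl_iff]
    constructor
    · intro h
      refine ⟨⟨h.pos, h.sum_one⟩, fun c hc => c.2 (funext ?_)⟩
      exact Fintype.linearIndependent_iff.1 h.indep c.1 (by simpa only [Rat.smul_def] using hc)
    · rintro ⟨⟨h1, h2⟩, h3⟩
      refine ⟨h1, h2, Fintype.linearIndependent_iff.2 fun c hc => ?_⟩
      by_contra hne
      refine h3 ⟨c, fun h => hne fun i => congrFun h i⟩ ?_
      simpa only [Rat.smul_def] using hc
  rw [this]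
  refine ((MeasurableSet.iInter fun i => measurableSet_lt measurable_const (hvi i)).inter
    (measurableSet_eq_fun (Finset.measurable_sum _ fun i _ => hvi i) measurable_const)).inter
    (MeasurableSet.iInter fun c => (measurableSet_eq_fun
      (Finset.measurable_sum _ fun i _ => (hvi i).const_mul _) measurable_const).compl)

end Selection

section Reduction

variable {N : ℕ}

/-- Rational matrices for changing between a generating family of `N` reals and letter
frequencies. -/
abbrev Change (N : ℕ) : Type :=
  Σ e : Fin (N - 1), (Fin (e + 2) → Fin N → ℚ) × (Fin N → Fin (e + 2) → ℚ)

/-- The letter frequencies obtained from `u`. -/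
noncomputable def Change.freq (d : Change N) (u : Fin N → ℝ) (i : Fin (d.1 + 2)) : ℝ :=
  ∑ j, (d.2.1 i j : ℝ) * u j

/-- The frequencies obtained from `u` are admissible and generate the same space. -/
def Change.Valid (d : Change N) (u : Fin N → ℝ) : Prop :=
  Adm (d.freq u) ∧ ∀ j, u j = ∑ i, (d.2.2 j i : ℝ) * d.freq u i

/-- The Toeplitz sequence with the letter frequencies obtained from `u`. -/
noncomputable def Change.code (d : Change N) (u : Fin N → ℝ) : ℤ → Fin N :=
  (Fin.castLE (by omega) : Fin (d.1 + 2) → Fin N) ∘ toep 0 (blk 0 (Fin.last _) (d.freq u))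

theorem Change.Valid.span_eq {d : Change N} {u : Fin N → ℝ} (h : d.Valid u) :
    Submodule.span ℚ (Set.range (d.freq u)) = Submodule.span ℚ (Set.range u) := by
  refine le_antisymm (Submodule.span_le.2 ?_) (Submodule.span_le.2 ?_)
  · rintro _ ⟨i, rfl⟩
    rw [freq]
    exact Submodule.sum_mem _ fun j _ => by
      rw [← Rat.smul_def]
      exact Submodule.smul_mem _ _ (Submodule.subset_span (Set.mem_range_self j))
  · rintro _ ⟨j, rfl⟩
    rw [h.2 j]
    exact Submodule.sum_mem _ fun i _ => by
      rw [← Rat.smul_def]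
      exact Submodule.smul_mem _ _ (Submodule.subset_span (Set.mem_range_self i))

theorem Change.Valid.finrank_eq {d : Change N} {u : Fin N → ℝ} (h : d.Valid u) :
    Module.finrank ℚ (Submodule.span ℚ (Set.range u)) = d.1 + 2 := by
  rw [← h.span_eq, finrank_span_eq_card h.1.indep, Fintype.card_fin]

theorem exists_valid {u : Fin N → ℝ} (h1 : (1 : ℝ) ∈ Submodule.span ℚ (Set.range u))
    (h2 : 2 ≤ Module.finrank ℚ (Submodule.span ℚ (Set.range u))) : ∃ d : Change N, d.Valid u := by
  have hN := finrank_range_le_card (R := ℚ) u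
  rw [Set.finrank, Fintype.card_fin] at hN
  have : FiniteDimensional ℚ (Submodule.span ℚ (Set.range u)) :=
    FiniteDimensional.span_of_finite ℚ (Set.finite_range u)
  obtain ⟨e, he⟩ := Nat.exists_eq_add_of_le' h2
  obtain ⟨v, hv, hvu⟩ := exists_adm h1 he
  have hQ : ∀ i, ∃ q : Fin N → ℚ, ∑ j, q j • u j = v i := fun i =>
    (Submodule.mem_span_range_iff_exists_fun ℚ).1 (hvu ▸ Submodule.subset_span ⟨i, rfl⟩)
  have hR : ∀ j, ∃ r : Fin (e + 2) → ℚ, ∑ i, r i • v i = u j := fun j =>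
    (Submodule.mem_span_range_iff_exists_fun ℚ).1 (hvu ▸ Submodule.subset_span ⟨j, rfl⟩)
  choose Q hQ using hQ
  choose R hR using hR
  let d : Change N := ⟨⟨e, by omega⟩, Q, R⟩
  have hf : d.freq u = v := by
    funext i
    rw [← hQ i]
    simp only [Change.freq, Rat.smul_def, d]
  refine ⟨d, ?_, fun j => ?_⟩
  · rw [hf]; exact hv
  · rw [hf, ← hR j]
    simp only [Rat.smul_def, d]

theorem Change.measurable_freq (d : Change N) : Measurable d.freq :=
  measurable_pi_lambda _ fun _ =>
    Finset.measurable_sum _ fun j _ => (measurable_pi_apply j).const_mul _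

theorem Change.measurableSet_valid (d : Change N) : MeasurableSet {u | d.Valid u} := by
  have : {u | d.Valid u} = {u | Adm (d.freq u)} ∩
      ⋂ j, {u | u j = ∑ i, (d.2.2 j i : ℝ) * d.freq u i} := by
    ext u
    simp [Valid]
  rw [this]
  exact (measurableSet_adm d.measurable_freq).inter (MeasurableSet.iInter fun j =>
    measurableSet_eq_fun (measurable_pi_apply j) (Finset.measurable_sum _ fun i _ =>
      ((measurable_pi_apply i).comp d.measurable_freq).const_mul _))

theorem Change.measurable_code (d : Change N) : Measurable d.code :=
  measurable_pi_lambda _ fun m => (measurable_of_countable _).comp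
    ((measurable_pi_apply m).comp (measurable_toep_blk 0 (Fin.last _) d.measurable_freq))

theorem zero_ne_last (n : ℕ) : (0 : Fin (n + 2)) ≠ Fin.last (n + 1) := Fin.last_pos.ne

/-- The Toeplitz system with the letter frequencies obtained from `u`. -/
noncomputable def Change.Valid.sys {d : Change N} {u : Fin N → ℝ} (h : d.Valid u) :
    Sys (Fin (d.1 + 2)) 0 (Fin.last (d.1 + 1)) :=
  tsys (zero_ne_last d.1) h.1

theorem Change.Valid.isRegularToeplitz_code {d : Change N} {u : Fin N → ℝ} (h : d.Valid u) :
    IsRegularToeplitz (d.code u) := by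
  have := isRegularToeplitz_tsys (zero_ne_last d.1) h.1
  simp only [tsys, Sys.ofPat, zero_add] at this
  exact isRegularToeplitz_comp (Fin.castLE_injective _) this

theorem Change.Valid.orbitEquivalent_code {d : Change N} {u : Fin N → ℝ} (h : d.Valid u) :
    SubshiftOrbitEquivalent (h.sys.X 0)
      (closure (zOrbit shift (d.code u))) := by
  have := orbitEquivalent_comp (Fin.castLE_injective (by omega : (d.1 : ℕ) + 2 ≤ N))
    (h.sys.τ 0)
  have hτ : toep 0 (blk 0 (Fin.last _) (d.freq u)) = h.sys.τ 0 := by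
    simp only [sys, tsys, Sys.ofPat, zero_add]
  rw [code, hτ]
  exact this

theorem orbitEquivalent_tsys_iff {d d' : Change N} {u u' : Fin N → ℝ} (h : d.Valid u)
    (h' : d'.Valid u') :
    SubshiftOrbitEquivalent (h.sys.X 0)
      (h'.sys.X 0) ↔
      Submodule.span ℚ (Set.range u) = Submodule.span ℚ (Set.range u') := by
  rw [← h.span_eq, ← h'.span_eq]
  refine ⟨fun H => le_antisymm (span_le_of_orbitEquivalent _ _ _ _ H.symm)
    (span_le_of_orbitEquivalent _ _ _ _ H), fun H => ?_⟩
  have he : d.1 = d'.1 := by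
    have h1 := h.finrank_eq
    have h2 := h'.finrank_eq
    rw [← h.span_eq] at h1
    rw [← h'.span_eq, ← H] at h2
    exact Fin.ext (by omega)
  obtain ⟨e, q⟩ := d
  obtain ⟨e', q'⟩ := d'
  obtain rfl : e = e' := he
  exact orbitEquivalent_tsys _ h.1 h'.1 H

theorem orbitEquivalent_code_iff {d d' : Change N} {u u' : Fin N → ℝ} (h : d.Valid u)
    (h' : d'.Valid u') :
    SubshiftOrbitEquivalent (closure (zOrbit shift (d.code u)))
      (closure (zOrbit shift (d'.code u'))) ↔
      Submodule.span ℚ (Set.range u) = Submodule.span ℚ (Set.range u') := by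
  rw [← orbitEquivalent_tsys_iff h h']
  exact ⟨fun H => (h.orbitEquivalent_code.trans H).trans h'.orbitEquivalent_code.symm,
    fun H => (h.orbitEquivalent_code.symm.trans H).trans h'.orbitEquivalent_code⟩

theorem Change.Valid.not_orbitEquivalent_const {d : Change N} {u : Fin N → ℝ} (h : d.Valid u)
    (a : Fin N) : ¬ SubshiftOrbitEquivalent (closure (zOrbit shift (d.code u)))
      (closure (zOrbit shift fun _ => a)) := by
  intro H
  have := (h.orbitEquivalent_code.trans H).nontrivial
    (Sys.nontrivial_X (zero_ne_last d.1) _)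
  rw [zOrbit_const, closure_singleton] at this
  exact Set.not_nontrivial_singleton this

theorem span_eq_of_not_valid {u : Fin N → ℝ} (h1 : (1 : ℝ) ∈ Submodule.span ℚ (Set.range u))
    (h : ∀ d : Change N, ¬ d.Valid u) :
    Submodule.span ℚ (Set.range u) = Submodule.span ℚ {1} := by
  have : FiniteDimensional ℚ (Submodule.span ℚ (Set.range u)) :=
    FiniteDimensional.span_of_finite ℚ (Set.finite_range u)
  refine (Submodule.eq_of_le_of_finrank_le ?_ ?_).symm
  · rwa [Submodule.span_le, Set.singleton_subset_iff]
  · rw [finrank_span_singleton one_ne_zero]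
    by_contra hlt
    obtain ⟨d, hd⟩ := exists_valid h1 (by omega)
    exact h d hd

theorem measurable_extend1 : Measurable (extend1 (N := N)) := by
  refine measurable_pi_lambda _ fun i => ?_
  by_cases h : (i : ℕ) < N - 1
  · simpa only [extend1, h, dite_true] using measurable_pi_apply _
  · simpa only [extend1, h, dite_false] using measurable_const

theorem one_mem_span_extend1 (hN : 2 ≤ N) (x : Fin (N - 1) → ℝ) :
    (1 : ℝ) ∈ Submodule.span ℚ (Set.range (extend1 x)) :=
  Submodule.subset_span ⟨⟨N - 1, by omega⟩, by simp [extend1]⟩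

end Reduction

end ToeplitzOE

open ToeplitzOE

theorem stmt11 (N : ℕ) (hN : 2 ≤ N) :
    ∃ T : (Fin (N - 1) → ℝ) → NonemptyCompacts (ℤ → Fin N),
      Measurable T ∧
      (∀ x, IsRegularToeplitzSubshift (T x : Set (ℤ → Fin N))) ∧
      ∀ x y : Fin (N - 1) → ℝ,
        (FN N x y ↔
          SubshiftOrbitEquivalent (T x : Set (ℤ → Fin N)) (T y : Set (ℤ → Fin N))) := by
  let a : Fin N := ⟨0, by omega⟩
  obtain ⟨t, ht, hcase⟩ := exists_measurable_selection (Z := Fin (N - 1) → ℝ)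
    (p := fun (d : Change N) x => d.Valid (extend1 x)) (f := fun d x => d.code (extend1 x))
    (fun d => measurable_extend1 d.measurableSet_valid)
    (fun d => d.measurable_code.comp measurable_extend1) fun _ => a
  refine ⟨fun x => orb (t x), measurable_orb ht, fun x => ⟨t x, ?_, rfl⟩, fun x y => ?_⟩
  · rcases hcase x with ⟨d, hd, h⟩ | ⟨-, h⟩
    · rw [h]; exact hd.isRegularToeplitz_code
    · rw [h]; exact isRegularToeplitz_const a
  · rw [FN, exists_vecMul_eq_iff, coe_orb, coe_orb]
    rcases hcase x with ⟨d, hd, h⟩ | ⟨hd, h⟩ <;> rcases hcase y with ⟨d', hd', h'⟩ | ⟨hd', h'⟩ <;>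
      rw [h, h']
    · exact (orbitEquivalent_code_iff hd hd').symm
    · refine iff_of_false (fun H => ?_) (hd.not_orbitEquivalent_const a)
      obtain ⟨d', h⟩ := exists_valid (one_mem_span_extend1 hN y)
        (H ▸ hd.finrank_eq.ge.trans' (by omega))
      exact hd' d' h
    · refine iff_of_false (fun H => ?_) fun H => hd'.not_orbitEquivalent_const a H.symm
      obtain ⟨d, h⟩ := exists_valid (one_mem_span_extend1 hN x)
        (H ▸ hd'.finrank_eq.ge.trans' (by omega))
      exact hd d h
    · refine iff_of_true ?_ ⟨Homeomorph.refl _, fun _ _ => Iff.rfl⟩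
      rw [span_eq_of_not_valid (one_mem_span_extend1 hN x) hd,
        span_eq_of_not_valid (one_mem_span_extend1 hN y) hd']
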